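/- Let η ∈ {1,2} and let q, r, s be primes with q ≡ 3 (mod 4), r ≡ s ≡ 5 (mod 8), Legendre symbols (q/r) = (q/s) = (−1)^{δ_{η,2}} and (r/s) = 1, and let (γ, γ′) be the fundamental solution of X² − ηqrs·Y² = 1. Let F₁ = ℚ(√2, √(qrs)). Then h₂(F₁) = h₂(ηqrs) or h₂(F₁) = 2·h₂(ηqrs), and h₂(F₁) = h₂(ηqrs) if and only if 2^{δ_{η,1}}·q·(γ−1) is not a perfect square. -/

import Mathlib

open IntermediateField NumberField

/-- The `n`-th layer `k(2·cos(2π/2^(n+2)))` of the cyclotomic `ℤ₂`-extension of a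
(totally real) subfield of `ℝ`. -/
noncomputable def layer (F : IntermediateField ℚ ℝ) (n : ℕ) : IntermediateField ℚ ℝ :=
  F ⊔ IntermediateField.adjoin ℚ {2 * Real.cos (2 * Real.pi / 2 ^ (n + 2))}

/-- The 2-part of the class number of a subfield of `ℝ` (the largest power of 2 dividing
the cardinality of the class group of its ring of integers). -/
noncomputable def h2 (F : IntermediateField ℚ ℝ) : ℕ :=
  2 ^ ((Nat.card (ClassGroup (NumberField.RingOfIntegers F))).factorization 2)


section IdealGeneral

variable {A B : Type*} [CommRing A] [CommRing B]

theorem ideal_sq_inj [IsDedekindDomain B] {I J : Ideal B} (h : I ^ 2 = J ^ 2) : I = J := by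
  apply dvd_antisymm
  · exact (UniqueFactorizationMonoid.pow_dvd_pow_iff_dvd two_ne_zero).1 (dvd_of_eq h)
  · exact (UniqueFactorizationMonoid.pow_dvd_pow_iff_dvd two_ne_zero).1 (dvd_of_eq h.symm)

/-- `𝔞 · σ𝔞` is extended from the fixed ring. -/
theorem ideal_norm_ext [IsDedekindDomain B] (f : A →+* B) (σ : B ≃+* B)
    (hσσ : ∀ x, σ (σ x) = x) (hfix : ∀ x, σ x = x → ∃ a, f a = x) (I : Ideal B) :
    ∃ J : Ideal A, I * I.map (σ : B →+* B) = J.map f := by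
  let J : Ideal A := Ideal.span {a | ∃ x ∈ I, f a = x * σ x}
  have hN : ∀ x ∈ I, x * σ x ∈ J.map f := by
    intro x hx
    obtain ⟨a, ha⟩ := hfix (x * σ x) (by rw [map_mul, hσσ, mul_comm])
    rw [← ha]
    exact Ideal.mem_map_of_mem f (Ideal.subset_span ⟨x, hx, ha⟩)
  refine ⟨J, le_antisymm ?_ ?_⟩
  · have hI : I.map (σ : B →+* B) = Ideal.span (σ '' I) := rfl
    rw [Ideal.mul_le]
    intro x hx y hy
    rw [hI] at hy
    induction hy using Submodule.span_induction with
    | zero => simp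
    | add y z _ _ hy hz => rw [mul_add]; exact add_mem hy hz
    | smul c y _ hy =>
      rw [smul_eq_mul, mul_left_comm]; exact Ideal.mul_mem_left _ _ hy
    | mem y hy =>
      obtain ⟨z, hz, rfl⟩ := hy
      have hz : z ∈ I := hz
      set M := J.map f with hM
      set w := x * σ z with hw
      have hT : w + σ w ∈ M := by
        have h1 := hN (x + z) (add_mem hx hz)
        have h2 := hN x hx
        have h3 := hN z hz
        have : w + σ w = (x + z) * σ (x + z) - x * σ x - z * σ z := by
          rw [hw, map_mul, hσσ, map_add]; ring
        rw [this]
        exact sub_mem (sub_mem h1 h2) h3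
      have hP : w * σ w ∈ M * M := by
        have : w * σ w = (x * σ x) * (z * σ z) := by rw [hw, map_mul, hσσ]; ring
        rw [this]
        exact Ideal.mul_mem_mul (hN x hx) (hN z hz)
      set K := M ⊔ Ideal.span {w} with hK
      have hwK : w ∈ K := Ideal.mem_sup_right (Ideal.mem_span_singleton_self w)
      have hMK : M ≤ K := le_sup_left
      by_cases hK0 : K = ⊥
      · rw [hK0] at hwK
        rw [(Submodule.mem_bot B).1 hwK]; exact zero_mem _
      have hKK : K * K = M * K := by
        apply le_antisymm
        · have e1 : M * K ≤ M * K := le_rfl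
          have e2 : Ideal.span {w} * K ≤ M * K := by
            have e3 : Ideal.span {w} * M ≤ M * K := by
              rw [mul_comm]; exact Ideal.mul_mono_right le_sup_right
            have e4 : Ideal.span {w} * Ideal.span {w} ≤ M * K := by
              rw [Ideal.span_singleton_mul_span_singleton, Ideal.span_singleton_le_iff_mem]
              have : w * w = (w + σ w) * w - w * σ w := by ring
              rw [this]
              exact sub_mem (Ideal.mul_mem_mul hT hwK) (Ideal.mul_mono_right hMK hP)
            calc Ideal.span {w} * K = Ideal.span {w} * M ⊔ Ideal.span {w} * Ideal.span {w} := by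
                  rw [hK, Ideal.mul_sup]
              _ ≤ M * K := sup_le e3 e4
          calc K * K = M * K ⊔ Ideal.span {w} * K := by
                conv_lhs => enter [1]; rw [hK]
                rw [Ideal.sup_mul]
            _ ≤ M * K := sup_le e1 e2
        · exact Ideal.mul_mono_left hMK
      have := mul_right_cancel₀ (b := K) hK0 hKK
      rw [← this]; exact hwK
  · rw [Ideal.map_le_iff_le_comap, Ideal.span_le]
    rintro a ⟨x, hx, ha⟩
    rw [SetLike.mem_coe, Ideal.mem_comap, ha]
    exact Ideal.mul_mem_mul hx (Ideal.mem_map_of_mem (σ : B →+* B) hx)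

theorem ideal_map_le [IsDedekindDomain A] [IsDedekindDomain B] (f : A →+* B)
    (hf : Function.Injective f) (σ : B ≃+* B) (hσf : ∀ a, σ (f a) = f a)
    (hfix : ∀ x, σ x = x → ∃ a, f a = x) {I J : Ideal A}
    (h : I.map f ≤ J.map f) : I ≤ J := by
  by_cases hJ : J = ⊥
  · subst hJ
    rw [Ideal.map_bot, le_bot_iff, Ideal.map_eq_bot_iff_of_injective hf] at h
    rw [h]
  obtain ⟨a, ha, ha0⟩ := Submodule.exists_mem_ne_zero_of_ne_bot hJ
  obtain ⟨K, hK⟩ : J ∣ Ideal.span {a} := by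
    rw [Ideal.dvd_span_singleton]; exact ha
  have hK0 : K ≠ ⊥ := by
    rintro rfl
    rw [Ideal.mul_bot, Ideal.span_singleton_eq_bot] at hK
    exact ha0 hK
  have h1 : I * K ≤ J * K := by
    rw [← hK]
    intro x hx
    have h2 : f x ∈ (J * K).map f := by
      have : f x ∈ (I * K).map f := Ideal.mem_map_of_mem f hx
      rw [Ideal.map_mul] at this ⊢
      exact Ideal.mul_mono_left h this
    rw [← hK, Ideal.map_span, Set.image_singleton, Ideal.mem_span_singleton'] at h2
    obtain ⟨b, hb⟩ := h2
    have hfa : f a ≠ 0 := fun h => ha0 (hf (by rw [h, map_zero]))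
    obtain ⟨c, hc⟩ := hfix b (by
      apply mul_right_cancel₀ hfa
      have := congrArg σ hb
      rw [map_mul, hσf, hσf] at this
      rw [this, hb])
    rw [Ideal.mem_span_singleton']
    exact ⟨c, hf (by rw [map_mul, hc, hb])⟩
  have : J * K ∣ I * K := Ideal.dvd_iff_le.2 h1
  exact Ideal.dvd_iff_le.1 ((mul_dvd_mul_iff_right hK0).1 this)

theorem ideal_map_inj [IsDedekindDomain A] [IsDedekindDomain B] (f : A →+* B)
    (hf : Function.Injective f) (σ : B ≃+* B) (hσf : ∀ a, σ (f a) = f a)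
    (hfix : ∀ x, σ x = x → ∃ a, f a = x) {I J : Ideal A}
    (h : I.map f = J.map f) : I = J :=
  le_antisymm (ideal_map_le f hf σ hσf hfix h.le) (ideal_map_le f hf σ hσf hfix h.ge)

open scoped nonZeroDivisors

/-- The class of an ideal (`1` for the zero ideal). -/
noncomputable def cl [IsDedekindDomain B] (I : Ideal B) : ClassGroup B :=
  open scoped Classical in
  if h : I ∈ (Ideal B)⁰ then ClassGroup.mk0 ⟨I, h⟩ else 1

theorem cl_of_ne [IsDedekindDomain B] {I : Ideal B} (h : I ≠ ⊥) :
    cl I = ClassGroup.mk0 ⟨I, mem_nonZeroDivisors_of_ne_zero h⟩ := by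
  rw [cl, dif_pos]

theorem cl_mul [IsDedekindDomain B] {I J : Ideal B} (hI : I ≠ ⊥) (hJ : J ≠ ⊥) :
    cl (I * J) = cl I * cl J := by
  rw [cl_of_ne hI, cl_of_ne hJ, cl_of_ne (mul_ne_zero hI hJ), ← map_mul]
  rfl

theorem cl_eq_iff [IsDedekindDomain B] {I J : Ideal B} (hI : I ≠ ⊥) (hJ : J ≠ ⊥) :
    cl I = cl J ↔ ∃ x y : B, x ≠ 0 ∧ y ≠ 0 ∧ Ideal.span {x} * I = Ideal.span {y} * J := by
  rw [cl_of_ne hI, cl_of_ne hJ, ClassGroup.mk0_eq_mk0_iff]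
  constructor
  · rintro ⟨x, y, hx, hy, h⟩; exact ⟨x, y, hx, hy, h⟩
  · rintro ⟨x, y, hx, hy, h⟩; exact ⟨x, y, hx, hy, h⟩

theorem cl_span [IsDedekindDomain B] (x : B) : cl (Ideal.span {x}) = 1 := by
  by_cases hx : x = 0
  · rw [cl, dif_neg]
    rw [mem_nonZeroDivisors_iff_ne_zero, not_not, hx]; simp
  · rw [cl_of_ne (by simpa using hx), ClassGroup.mk0_eq_one_iff]
    exact ⟨x, rfl⟩

theorem cl_eq_one_iff [IsDedekindDomain B] {I : Ideal B} (hI : I ≠ ⊥) :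
    cl I = 1 ↔ ∃ x, x ≠ 0 ∧ I = Ideal.span {x} := by
  constructor
  · intro h
    rw [cl_of_ne hI, ClassGroup.mk0_eq_one_iff] at h
    obtain ⟨x, hx⟩ := h
    refine ⟨x, ?_, hx⟩
    rintro rfl
    apply hI
    rw [hx]; simp
  · rintro ⟨x, _, rfl⟩
    exact cl_span x

theorem cl_surj [IsDedekindDomain B] (c : ClassGroup B) : ∃ I : Ideal B, I ≠ ⊥ ∧ cl I = c := by
  obtain ⟨I, rfl⟩ := ClassGroup.mk0_surjective c
  have hI : (I : Ideal B) ≠ ⊥ := nonZeroDivisors.ne_zero I.2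
  exact ⟨I, hI, by rw [cl_of_ne hI]⟩

theorem cl_pow [IsDedekindDomain B] {I : Ideal B} (hI : I ≠ ⊥) (n : ℕ) :
    cl (I ^ n) = cl I ^ n := by
  induction n with
  | zero => rw [pow_zero, pow_zero, Ideal.one_eq_top, ← Ideal.span_singleton_one, cl_span]
  | succ n ih => rw [pow_succ, pow_succ, cl_mul (pow_ne_zero n hI) hI, ih]

/-- The homomorphism of class groups induced by an injective ring homomorphism. -/
noncomputable def clHom [IsDomain A] [IsDomain B] (f : A →+* B) (hf : Function.Injective f) :
    ClassGroup A →* ClassGroup B :=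
  letI := f.toAlgebra
  haveI : Module.IsTorsionFree A B := by
    have : FaithfulSMul A B := (faithfulSMul_iff_algebraMap_injective A B).2 hf
    infer_instance
  ClassGroup.extendedHom A B

theorem map_ne_bot {f : A →+* B} (hf : Function.Injective f) {I : Ideal A} (hI : I ≠ ⊥) :
    I.map f ≠ ⊥ := by
  rwa [Ne, Ideal.map_eq_bot_iff_of_injective hf]

theorem clHom_cl [IsDedekindDomain A] [IsDedekindDomain B] (f : A →+* B)
    (hf : Function.Injective f) {I : Ideal A} (hI : I ≠ ⊥) :
    clHom f hf (cl I) = cl (I.map f) := by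
  letI := f.toAlgebra
  haveI : Module.IsTorsionFree A B := by
    have : FaithfulSMul A B := (faithfulSMul_iff_algebraMap_injective A B).2 hf
    infer_instance
  rw [cl_of_ne hI, cl_of_ne (map_ne_bot hf hI)]
  exact ClassGroup.extendedHom_mk0 A B _

end IdealGeneral


section Leg

/-- The arithmetic hypotheses. -/
structure Hyp (η η' q r s : ℕ) (Q d d' : ℤ) : Prop where
  hq : q.Prime
  hr : r.Prime
  hs : s.Prime
  hη : (η = 1 ∧ η' = 2) ∨ (η = 2 ∧ η' = 1)
  hq4 : q % 4 = 3
  hr8 : r % 8 = 5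
  hs8 : s % 8 = 5
  hQ : Q = η * q
  hd : d = Q * r * s
  hd' : d' = η' * q * r * s
  qr : ∀ [Fact r.Prime], legendreSym r q = (-1) ^ (η + 1)
  qs : ∀ [Fact s.Prime], legendreSym s q = (-1) ^ (η + 1)
  rs : ∀ [Fact s.Prime], legendreSym s r = 1

theorem leg_one {p : ℕ} [hp : Fact p.Prime] {x : ℤ} (h0 : ¬ (p : ℤ) ∣ x) :
    legendreSym p x ^ 2 = 1 := by
  have : (x : ZMod p) ≠ 0 := by rwa [Ne, ZMod.intCast_zmod_eq_zero_iff_dvd]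
  exact legendreSym.sq_one p this

theorem leg_neg {p : ℕ} [hp : Fact p.Prime] (hp4 : p % 4 = 1) {e : ℤ} (he : e = 1 ∨ e = -1) :
    legendreSym p e = 1 := by
  rcases he with rfl | rfl
  · exact legendreSym.at_one p
  · rw [legendreSym.at_neg_one (by intro h; rw [h] at hp4; omega), ZMod.χ₄_nat_one_mod_four hp4]

theorem leg_congr {p : ℕ} [hp : Fact p.Prime] {x y : ℤ} (h : (p : ℤ) ∣ x - y) :
    legendreSym p x = legendreSym p y := by
  rw [legendreSym.mod p x, legendreSym.mod p y]
  congr 1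
  exact Int.emod_eq_emod_iff_emod_sub_eq_zero.2 (Int.emod_eq_zero_of_dvd h)

theorem leg_descent {p : ℕ} [hp : Fact p.Prime] (hp4 : p % 4 = 1) {D1 b : ℤ}
    (hD1 : ¬ (p : ℤ) ∣ D1) (hb : ¬ (p : ℤ) ∣ b) {e : ℤ} (he : e = 1 ∨ e = -1) :
    ∀ N : ℕ, ∀ X Y Z : ℤ, Z.natAbs ≤ N → Z ≠ 0 →
      b * Z ^ 2 = e * (X ^ 2 - (p * D1) * Y ^ 2) → legendreSym p b = 1 := by
  have hpp : Prime (p : ℤ) := Nat.prime_iff_prime_int.1 hp.out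
  have hp0 : (p : ℤ) ≠ 0 := hpp.ne_zero
  have hee : e * e = 1 := by rcases he with rfl | rfl <;> norm_num
  intro N
  induction N with
  | zero => intro X Y Z h1 h2; omega
  | succ N ih =>
    intro X Y Z hN hZ h
    by_cases hpZ : (p : ℤ) ∣ Z
    · obtain ⟨z, rfl⟩ := hpZ
      have hX : (p : ℤ) ∣ X := by
        apply hpp.dvd_of_dvd_pow (n := 2)
        refine ⟨e * b * p * z ^ 2 + D1 * Y ^ 2, ?_⟩
        linear_combination -e * h - (X ^ 2 - (p * D1) * Y ^ 2) * hee
      obtain ⟨x, rfl⟩ := hX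
      have hY : (p : ℤ) ∣ Y := by
        have : (p : ℤ) ∣ D1 * Y ^ 2 := by
          refine ⟨x ^ 2 - e * b * z ^ 2, ?_⟩
          apply mul_left_cancel₀ hp0
          linear_combination e * h + ((p * x) ^ 2 - (p * D1) * Y ^ 2) * hee
        rcases hpp.dvd_or_dvd this with h | h
        · exact absurd h hD1
        · exact hpp.dvd_of_dvd_pow h
      obtain ⟨y, rfl⟩ := hY
      have hz : z ≠ 0 := right_ne_zero_of_mul hZ
      refine ih x y z ?_ hz ?_
      · rw [Int.natAbs_mul, Int.natAbs_natCast] at hN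
        have h2 := hp.out.two_le
        have h3 : 0 < z.natAbs := Int.natAbs_pos.2 hz
        nlinarith
      · apply mul_left_cancel₀ (pow_ne_zero 2 hp0)
        linear_combination h
    · have h1 : legendreSym p (b * Z ^ 2) = legendreSym p (e * X ^ 2) := by
        apply leg_congr
        refine ⟨- e * D1 * Y ^ 2, ?_⟩
        linear_combination h
      rw [legendreSym.mul, legendreSym.mul, leg_neg hp4 he, sq, sq, legendreSym.mul,
        legendreSym.mul, ← sq, leg_one hpZ, mul_one, one_mul] at h1
      have h2 := leg_one hb
      have h3 : legendreSym p b = 1 ∨ legendreSym p b = -1 := by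
        rw [sq] at h2; exact mul_self_eq_one_iff.1 h2
      rcases h3 with h3 | h3
      · exact h3
      · rw [h3] at h1; nlinarith [sq_nonneg (legendreSym p X)]

theorem leg_main {p : ℕ} [hp : Fact p.Prime] (hp4 : p % 4 = 1) {D D1 b n : ℤ} {k : ℕ}
    (hk : k ≤ 1) (hD : D = p * D1) (hn : n = p ^ k * b)
    (hD1 : ¬ (p : ℤ) ∣ D1) (hb : ¬ (p : ℤ) ∣ b) {e : ℤ} (he : e = 1 ∨ e = -1)
    {X Y Z : ℤ} (hZ : Z ≠ 0) (h : n * Z ^ 2 = e * (X ^ 2 - D * Y ^ 2)) :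
    legendreSym p b * legendreSym p D1 ^ k = 1 := by
  have hpp : Prime (p : ℤ) := Nat.prime_iff_prime_int.1 hp.out
  have hp0 : (p : ℤ) ≠ 0 := hpp.ne_zero
  have hee : e * e = 1 := by rcases he with rfl | rfl <;> norm_num
  subst hD hn
  interval_cases k
  · simp only [pow_zero, mul_one, one_mul] at *
    exact leg_descent hp4 hD1 hb he _ X Y Z le_rfl hZ h
  · simp only [pow_one] at *
    have hX : (p : ℤ) ∣ X := by
      apply hpp.dvd_of_dvd_pow (n := 2)
      refine ⟨e * b * Z ^ 2 + D1 * Y ^ 2, ?_⟩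
      linear_combination -e * h - (X ^ 2 - (p * D1) * Y ^ 2) * hee
    obtain ⟨x, rfl⟩ := hX
    rw [← legendreSym.mul]
    refine leg_descent (D1 := D1) hp4 hD1 (fun h => ?_) (e := -e) ?_ _ (D1 * Y) x Z le_rfl hZ ?_
    · rcases hpp.dvd_or_dvd h with h | h
      · exact hb h
      · exact hD1 h
    · rcases he with rfl | rfl <;> simp
    · apply mul_left_cancel₀ hp0
      linear_combination D1 * h

theorem leg_two {p : ℕ} [hp : Fact p.Prime] (hp8 : p % 8 = 5) : legendreSym p 2 = -1 := by
  have h2 : p ≠ 2 := by intro h; rw [h] at hp8; omega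
  rw [legendreSym.at_two h2, ZMod.χ₈_nat_eq_if_mod_eight]
  have : p % 2 ≠ 0 := by omega
  simp [this, hp8]

end Leg


namespace Hyp

variable {η η' q r s : ℕ} {Q d d' : ℤ}

theorem rs_ne (h : Hyp η η' q r s Q d d') : r ≠ s := by
  rintro rfl
  have := Fact.mk h.hr
  have h1 := h.rs
  have h2 : legendreSym r r = 0 := by
    rw [legendreSym.eq_zero_iff]; simp
  omega

theorem qr_ne (h : Hyp η η' q r s Q d d') : q ≠ r := by
  have := h.hq4; have := h.hr8; omega

theorem qs_ne (h : Hyp η η' q r s Q d d') : q ≠ s := by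
  have := h.hq4; have := h.hs8; omega

/-- The symmetry exchanging `r` and `s`. -/
theorem swap (h : Hyp η η' q r s Q d d') : Hyp η η' q s r Q d d' where
  hq := h.hq
  hr := h.hs
  hs := h.hr
  hη := h.hη
  hq4 := h.hq4
  hr8 := h.hs8
  hs8 := h.hr8
  hQ := h.hQ
  hd := by rw [h.hd]; ring
  hd' := by rw [h.hd']; ring
  qr := h.qs
  qs := h.qr
  rs := by
    intro _
    have := Fact.mk h.hs
    have := h.hr8; have := h.hs8
    rw [legendreSym.quadratic_reciprocity_one_mod_four (by omega) (by omega)]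
    exact h.rs

theorem ndvd {a b : ℕ} (ha : a.Prime) (hb : b.Prime) (hab : a ≠ b) : ¬ (a : ℤ) ∣ (b : ℤ) := by
  rw [Int.natCast_dvd_natCast, Nat.prime_dvd_prime_iff_eq ha hb]; exact hab

theorem ndvd2 (h : Hyp η η' q r s Q d d') : ¬ (r : ℤ) ∣ 2 := by
  have := h.hr8
  exact ndvd (b := 2) h.hr Nat.prime_two (by omega)

theorem rprime (h : Hyp η η' q r s Q d d') : Prime (r : ℤ) := Nat.prime_iff_prime_int.1 h.hr

theorem qprime (h : Hyp η η' q r s Q d d') : Prime (q : ℤ) := Nat.prime_iff_prime_int.1 h.hq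

theorem ndvdη (h : Hyp η η' q r s Q d d') : ¬ (r : ℤ) ∣ η := by
  rcases h.hη with ⟨rfl, rfl⟩ | ⟨rfl, rfl⟩
  · simpa using h.rprime.not_dvd_one
  · exact h.ndvd2

theorem ndvdη' (h : Hyp η η' q r s Q d d') : ¬ (r : ℤ) ∣ η' := by
  rcases h.hη with ⟨rfl, rfl⟩ | ⟨rfl, rfl⟩
  · exact h.ndvd2
  · simpa using h.rprime.not_dvd_one

theorem ndvd_q (h : Hyp η η' q r s Q d d') : ¬ (r : ℤ) ∣ q := ndvd h.hr h.hq h.qr_ne.symm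

theorem ndvd_s (h : Hyp η η' q r s Q d d') : ¬ (r : ℤ) ∣ s := ndvd h.hr h.hs h.rs_ne

theorem leg_Q (h : Hyp η η' q r s Q d d') [Fact r.Prime] : legendreSym r Q = 1 := by
  rw [h.hQ, legendreSym.mul, h.qr]
  rcases h.hη with ⟨rfl, rfl⟩ | ⟨rfl, rfl⟩
  · simp [legendreSym.at_one]
  · have := leg_two h.hr8
    simp [this]

theorem leg_η' (h : Hyp η η' q r s Q d d') [Fact r.Prime] : legendreSym r (η' * q) = -1 := by
  rw [legendreSym.mul, h.qr]
  rcases h.hη with ⟨rfl, rfl⟩ | ⟨rfl, rfl⟩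
  · have := leg_two h.hr8
    simp [this]
  · simp [legendreSym.at_one]

theorem not_dvd_mul (h : Hyp η η' q r s Q d d') {a b : ℤ} (ha : ¬ (r : ℤ) ∣ a) (hb : ¬ (r : ℤ) ∣ b) : ¬ (r : ℤ) ∣ a * b := by
  intro hh
  rcases h.rprime.dvd_or_dvd hh with hh | hh
  · exact ha hh
  · exact hb hh

theorem not_dvd_pow (h : Hyp η η' q r s Q d d') {a : ℤ} (ha : ¬ (r : ℤ) ∣ a) (n : ℕ) : ¬ (r : ℤ) ∣ a ^ n :=
  fun hh => ha (h.rprime.dvd_of_dvd_pow hh)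

theorem leg_val (h : Hyp η η' q r s Q d d') [Fact r.Prime] {i j l : ℕ} {c : ℤ} :
    legendreSym r (2 ^ i * q ^ j * s ^ l * c) =
      (-1) ^ i * ((-1) ^ (η + 1)) ^ j * legendreSym r c := by
  have := Fact.mk h.hs
  have h1 : ∀ (a : ℤ) (n : ℕ), legendreSym r (a ^ n) = legendreSym r a ^ n := by
    intro a n; exact map_pow (legendreSym.hom r) a n
  rw [legendreSym.mul, legendreSym.mul, legendreSym.mul, h1, h1, h1, h.qr, h.swap.rs,
    leg_two h.hr8, one_pow, mul_one]

theorem legd_r (h : Hyp η η' q r s Q d d') {i j k l : ℕ} (hk : k ≤ 1) {c : ℤ} (hc : ¬ (r : ℤ) ∣ c) [Fact r.Prime]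
    {e : ℤ} (he : e = 1 ∨ e = -1)
    {X Y Z : ℤ} (hZ : Z ≠ 0)
    (hh : (2 ^ i * q ^ j * r ^ k * s ^ l * c) * Z ^ 2 = e * (X ^ 2 - d * Y ^ 2)) :
    (-1) ^ i * ((-1) ^ (η + 1)) ^ j * legendreSym r c = 1 := by
  have := h.hr8
  have := Fact.mk h.hs
  have h1 := leg_main (p := r) (by omega) hk (D := d) (D1 := Q * s)
    (b := 2 ^ i * q ^ j * s ^ l * c) (by rw [h.hd]; ring) (by ring)
    (by rw [h.hQ]; exact h.not_dvd_mul (h.not_dvd_mul h.ndvdη h.ndvd_q) h.ndvd_s)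
    (h.not_dvd_mul (h.not_dvd_mul (h.not_dvd_mul (h.not_dvd_pow h.ndvd2 _)
      (h.not_dvd_pow h.ndvd_q _)) (h.not_dvd_pow h.ndvd_s _)) hc) he hZ hh
  rw [h.leg_val, legendreSym.mul, h.leg_Q, h.swap.rs, one_mul, one_pow, mul_one] at h1
  exact h1

theorem legd'_r (h : Hyp η η' q r s Q d d') {i j k l : ℕ} (hk : k ≤ 1) {c : ℤ} (hc : ¬ (r : ℤ) ∣ c) [Fact r.Prime]
    {e : ℤ} (he : e = 1 ∨ e = -1)
    {X Y Z : ℤ} (hZ : Z ≠ 0)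
    (hh : (2 ^ i * q ^ j * r ^ k * s ^ l * c) * Z ^ 2 = e * (X ^ 2 - d' * Y ^ 2)) :
    (-1) ^ i * ((-1) ^ (η + 1)) ^ j * legendreSym r c * (-1) ^ k = 1 := by
  have := h.hr8
  have := Fact.mk h.hs
  have h1 := leg_main (p := r) (by omega) hk (D := d') (D1 := η' * q * s)
    (b := 2 ^ i * q ^ j * s ^ l * c) (by rw [h.hd']; ring) (by ring)
    (h.not_dvd_mul (h.not_dvd_mul h.ndvdη' h.ndvd_q) h.ndvd_s)
    (h.not_dvd_mul (h.not_dvd_mul (h.not_dvd_mul (h.not_dvd_pow h.ndvd2 _)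
      (h.not_dvd_pow h.ndvd_q _)) (h.not_dvd_pow h.ndvd_s _)) hc) he hZ hh
  rw [h.leg_val, legendreSym.mul, h.leg_η', h.swap.rs, mul_one] at h1
  exact h1

theorem legd_s (h : Hyp η η' q r s Q d d') {i j k l : ℕ} (hl : l ≤ 1) {c : ℤ} (hc : ¬ (s : ℤ) ∣ c) [Fact s.Prime]
    {e : ℤ} (he : e = 1 ∨ e = -1)
    {X Y Z : ℤ} (hZ : Z ≠ 0)
    (hh : (2 ^ i * q ^ j * r ^ k * s ^ l * c) * Z ^ 2 = e * (X ^ 2 - d * Y ^ 2)) :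
    (-1) ^ i * ((-1) ^ (η + 1)) ^ j * legendreSym s c = 1 :=
  h.swap.legd_r (i := i) (j := j) (k := l) (l := k) hl hc he hZ (by rw [← hh]; ring)

theorem legd'_s (h : Hyp η η' q r s Q d d') {i j k l : ℕ} (hl : l ≤ 1) {c : ℤ} (hc : ¬ (s : ℤ) ∣ c) [Fact s.Prime]
    {e : ℤ} (he : e = 1 ∨ e = -1)
    {X Y Z : ℤ} (hZ : Z ≠ 0)
    (hh : (2 ^ i * q ^ j * r ^ k * s ^ l * c) * Z ^ 2 = e * (X ^ 2 - d' * Y ^ 2)) :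
    (-1) ^ i * ((-1) ^ (η + 1)) ^ j * legendreSym s c * (-1) ^ l = 1 :=
  h.swap.legd'_r (i := i) (j := j) (k := l) (l := k) hl hc he hZ (by rw [← hh]; ring)

theorem no_neg_aux (h : Hyp η η' q r s Q d d') {D1 b : ℤ} (hD1 : ¬ (q : ℤ) ∣ D1)
    (hb : ∀ [Fact q.Prime], legendreSym q b = 1) :
    ∀ N : ℕ, ∀ X Y Z : ℤ, Z.natAbs ≤ N → Z ≠ 0 →
      X ^ 2 - (q * D1) * Y ^ 2 = - b * Z ^ 2 → False := by
  have hpp := h.qprime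
  have hp0 : (q : ℤ) ≠ 0 := hpp.ne_zero
  have := Fact.mk h.hq
  intro N
  induction N with
  | zero => intro X Y Z h1 h2; omega
  | succ N ih =>
    intro X Y Z hN hZ hh
    by_cases hpZ : (q : ℤ) ∣ Z
    · obtain ⟨z, rfl⟩ := hpZ
      have hX : (q : ℤ) ∣ X := by
        apply hpp.dvd_of_dvd_pow (n := 2)
        exact ⟨- b * q * z ^ 2 + D1 * Y ^ 2, by linear_combination hh⟩
      obtain ⟨x, rfl⟩ := hX
      have hY : (q : ℤ) ∣ Y := by
        have : (q : ℤ) ∣ D1 * Y ^ 2 := by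
          refine ⟨x ^ 2 + b * z ^ 2, ?_⟩
          apply mul_left_cancel₀ hp0
          linear_combination - hh
        rcases hpp.dvd_or_dvd this with h | h
        · exact absurd h hD1
        · exact hpp.dvd_of_dvd_pow h
      obtain ⟨y, rfl⟩ := hY
      have hz : z ≠ 0 := right_ne_zero_of_mul hZ
      refine ih x y z ?_ hz ?_
      · rw [Int.natAbs_mul, Int.natAbs_natCast] at hN
        have h2 := h.hq.two_le
        have h3 : 0 < z.natAbs := Int.natAbs_pos.2 hz
        nlinarith
      · apply mul_left_cancel₀ (pow_ne_zero 2 hp0)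
        linear_combination hh
    · have h1 : legendreSym q (X ^ 2) = legendreSym q (-1 * b * Z ^ 2) :=
        leg_congr ⟨D1 * Y ^ 2, by linear_combination hh⟩
      have h4 := h.hq4
      have h2 : legendreSym q (-1) = -1 := by
        rw [legendreSym.at_neg_one (by intro hq; omega), ZMod.χ₄_nat_three_mod_four h4]
      rw [legendreSym.mul, legendreSym.mul, h2, sq, sq, legendreSym.mul, legendreSym.mul, ← sq,
        ← sq, leg_one hpZ, hb] at h1
      nlinarith [sq_nonneg (legendreSym q X)]

theorem hdq' (h : Hyp η η' q r s Q d d') : d' = q * (η' * r * s) := by rw [h.hd']; ring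
theorem hdq (h : Hyp η η' q r s Q d d') : d = q * (η * r * s) := by rw [h.hd, h.hQ]; ring
theorem d_rel (h : Hyp η η' q r s Q d d') : 2 * d = η ^ 2 * d' := by
  rw [h.hd, h.hd', h.hQ]
  rcases h.hη with ⟨rfl, rfl⟩ | ⟨rfl, rfl⟩ <;> push_cast <;> ring
theorem q_pos (h : Hyp η η' q r s Q d d') : (0 : ℤ) < q := by exact_mod_cast h.hq.pos
theorem r_pos (h : Hyp η η' q r s Q d d') : (0 : ℤ) < r := by exact_mod_cast h.hr.pos
theorem s_pos (h : Hyp η η' q r s Q d d') : (0 : ℤ) < s := by exact_mod_cast h.hs.pos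
theorem η_pos (h : Hyp η η' q r s Q d d') : (0 : ℤ) < η := by rcases h.hη with ⟨rfl, rfl⟩ | ⟨rfl, rfl⟩ <;> norm_num
theorem η'_pos (h : Hyp η η' q r s Q d d') : (0 : ℤ) < η' := by rcases h.hη with ⟨rfl, rfl⟩ | ⟨rfl, rfl⟩ <;> norm_num
theorem Q_pos (h : Hyp η η' q r s Q d d') : 0 < Q := by rw [h.hQ]; exact mul_pos h.η_pos h.q_pos
theorem d_pos (h : Hyp η η' q r s Q d d') : 0 < d := by rw [h.hd]; exact mul_pos (mul_pos h.Q_pos h.r_pos) h.s_pos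
theorem d'_pos (h : Hyp η η' q r s Q d d') : 0 < d' := by
  rw [h.hd']; exact mul_pos (mul_pos (mul_pos h.η'_pos h.q_pos) h.r_pos) h.s_pos



theorem q_ndvd (h : Hyp η η' q r s Q d d') {a : ℕ} (ha : a = 1 ∨ a = 2) :
    ¬ (q : ℤ) ∣ a * r * s := by
  have h4 := h.hq4
  intro hh
  rcases h.qprime.dvd_or_dvd hh with hh | hh
  · rcases h.qprime.dvd_or_dvd hh with hh | hh
    · rw [Int.natCast_dvd_natCast] at hh
      have := Nat.le_of_dvd (by omega) hh
      have h2 := h.hq.two_le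
      omega
    · exact ndvd h.hq h.hr h.qr_ne hh
  · exact ndvd h.hq h.hs h.qs_ne hh

theorem η_or (h : Hyp η η' q r s Q d d') : η = 1 ∨ η = 2 := by
  have := h.hη; omega

theorem η'_or (h : Hyp η η' q r s Q d d') : η' = 1 ∨ η' = 2 := by
  have := h.hη; omega

theorem leg_q_rs (h : Hyp η η' q r s Q d d') [Fact q.Prime] :
    legendreSym q (r * s) = 1 := by
  have := Fact.mk h.hr
  have := Fact.mk h.hs
  have h4 := h.hq4
  have hr := h.hr8
  have hs := h.hs8
  rw [legendreSym.mul, legendreSym.quadratic_reciprocity_one_mod_four (by omega) (by omega),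
    legendreSym.quadratic_reciprocity_one_mod_four (p := s) (by omega) (by omega), h.qr, h.qs,
    ← mul_pow]
  simp

theorem no_neg_d (h : Hyp η η' q r s Q d d') {X Y Z : ℤ} (hZ : Z ≠ 0)
    (hh : X ^ 2 - d * Y ^ 2 = - Z ^ 2) : False := by
  rw [h.hdq] at hh
  exact h.no_neg_aux (b := 1) (h.q_ndvd h.η_or) (by simp) _ X Y Z le_rfl hZ
    (by linear_combination hh)

theorem no_neg_d' (h : Hyp η η' q r s Q d d') {X Y Z : ℤ} (hZ : Z ≠ 0)
    (hh : X ^ 2 - d' * Y ^ 2 = - Z ^ 2) : False := by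
  rw [h.hdq'] at hh
  exact h.no_neg_aux (b := 1) (h.q_ndvd h.η'_or) (by simp) _ X Y Z le_rfl hZ
    (by linear_combination hh)

theorem no_neg_rs (h : Hyp η η' q r s Q d d') {X Y Z : ℤ} (hZ : Z ≠ 0)
    (hh : X ^ 2 - d * Y ^ 2 = - (r * s) * Z ^ 2) : False := by
  rw [h.hdq] at hh
  exact h.no_neg_aux (b := r * s) (h.q_ndvd h.η_or) h.leg_q_rs _ X Y Z le_rfl hZ
    (by linear_combination hh)

theorem comb' (h : Hyp η η' q r s Q d d') {i j k l : ℕ} (hi : i ≤ 1) (hj : j ≤ 1) (hk : k ≤ 1)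
    (hl : l ≤ 1) (h1 : (-1 : ℤ) ^ i * ((-1) ^ (η + 1)) ^ j * (-1) ^ k = 1)
    (h2 : (-1 : ℤ) ^ i * ((-1) ^ (η + 1)) ^ j * (-1) ^ l = 1) :
    ∃ e f : ℕ, e ≤ 1 ∧ f ≤ 1 ∧ ∃ K : ℤ, K ≠ 0 ∧
      2 ^ i * q ^ j * r ^ k * s ^ l * Q ^ e * d' ^ f = K ^ 2 := by
  have hq := h.q_pos.ne'
  have hr := h.r_pos.ne'
  have hs := h.s_pos.ne'
  rw [h.hQ, h.hd']
  rcases h.hη with ⟨rfl, rfl⟩ | ⟨rfl, rfl⟩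
  · interval_cases i <;> interval_cases j <;> interval_cases k <;> interval_cases l <;>
      (try (exfalso; revert h1; norm_num; done)) <;> (try (exfalso; revert h2; norm_num; done))
    · exact ⟨0, 0, by simp, by simp, 1, by simp, by norm_num⟩
    · exact ⟨1, 0, by simp, by simp, q, hq, by push_cast; ring⟩
    · exact ⟨1, 1, by simp, by simp, 2 * q * r * s, by positivity, by push_cast; ring⟩
    · exact ⟨0, 1, by simp, by simp, 2 * q * r * s, by positivity, by push_cast; ring⟩
  · interval_cases i <;> interval_cases j <;> interval_cases k <;> interval_cases l <;>
      (try (exfalso; revert h1; norm_num; done)) <;> (try (exfalso; revert h2; norm_num; done))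
    · exact ⟨0, 0, by simp, by simp, 1, by simp, by norm_num⟩
    · exact ⟨0, 1, by simp, by simp, q * r * s, by positivity, by push_cast; ring⟩
    · exact ⟨1, 1, by simp, by simp, 2 * q * r * s, by positivity, by push_cast; ring⟩
    · exact ⟨1, 0, by simp, by simp, 2 * q, by positivity, by push_cast; ring⟩

theorem comb (h : Hyp η η' q r s Q d d') {i j : ℕ} (hi : i ≤ 1) (hj : j ≤ 1)
    (h1 : (-1 : ℤ) ^ i * ((-1) ^ (η + 1)) ^ j = 1) :
    ∃ e : ℕ, e ≤ 1 ∧ (2 : ℤ) ^ i * q ^ j = Q ^ e := by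
  rw [h.hQ]
  rcases h.hη with ⟨rfl, rfl⟩ | ⟨rfl, rfl⟩
  · interval_cases i <;> interval_cases j <;> (try (exfalso; revert h1; norm_num; done))
    · exact ⟨0, by simp, by simp⟩
    · exact ⟨1, by simp, by simp⟩
  · interval_cases i <;> interval_cases j <;> (try (exfalso; revert h1; norm_num; done))
    · exact ⟨0, by simp, by simp⟩
    · exact ⟨1, by simp, by simp⟩

theorem primes_d (h : Hyp η η' q r s Q d d') {p : ℕ} (hp : p.Prime) (hh : (p : ℤ) ∣ 2 * d) :
    p = 2 ∨ p = q ∨ p = r ∨ p = s := by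
  have e : 2 * d = ((2 * (η * q * r * s) : ℕ) : ℤ) := by rw [h.hd, h.hQ]; push_cast; ring
  rw [e, Int.natCast_dvd_natCast] at hh
  rcases h.hη with ⟨rfl, rfl⟩ | ⟨rfl, rfl⟩
  all_goals
    simp only [hp.dvd_mul, Nat.prime_dvd_prime_iff_eq hp h.hq, Nat.prime_dvd_prime_iff_eq hp h.hr,
      Nat.prime_dvd_prime_iff_eq hp h.hs, Nat.prime_dvd_prime_iff_eq hp Nat.prime_two,
      Nat.dvd_one] at hh
    have := hp.one_lt
    omega

theorem primes_d' (h : Hyp η η' q r s Q d d') {p : ℕ} (hp : p.Prime) (hh : (p : ℤ) ∣ 2 * d') :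
    p = 2 ∨ p = q ∨ p = r ∨ p = s := by
  apply h.primes_d hp
  have : (p : ℤ) ∣ 2 * (2 * d) := by rw [h.d_rel]; exact hh.trans ⟨η ^ 2, by ring⟩
  rcases (Nat.prime_iff_prime_int.1 hp).dvd_or_dvd this with h1 | h1
  · exact h1.mul_right _
  · exact h1

end Hyp


namespace Zs

variable {D : ℤ}

/-- Conjugation on `ℤ√D`. -/
def conj (D : ℤ) : ℤ√D ≃+* ℤ√D where
  toFun x := star x
  invFun x := star x
  left_inv x := star_star x
  right_inv x := star_star x
  map_mul' x y := by rw [star_mul, mul_comm]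
  map_add' x y := star_add x y

theorem conj_apply (x : ℤ√D) : conj D x = star x := rfl

theorem conj_conj (x : ℤ√D) : conj D (conj D x) = x := star_star x

theorem conj_fix (x : ℤ√D) (h : conj D x = x) : ∃ a : ℤ, Int.castRingHom (ℤ√D) a = x := by
  refine ⟨x.re, ?_⟩
  have h2 := congrArg Zsqrtd.im h
  rw [conj_apply, Zsqrtd.im_star] at h2
  ext
  · simp
  · simp; omega

theorem conj_intCast (n : ℤ) : conj D n = n := map_intCast (conj D) n
theorem conj_natCast (n : ℕ) : conj D n = n := map_natCast (conj D) n

theorem mul_conj (x : ℤ√D) : x * conj D x = (x.norm : ℤ√D) := by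
  rw [conj_apply, Zsqrtd.norm_eq_mul_conj]

theorem norm_expl (x : ℤ√D) : x.norm = x.re ^ 2 - D * x.im ^ 2 := by
  rw [Zsqrtd.norm_def]; ring

theorem idnorm [IsDedekindDomain (ℤ√D)] (I : Ideal (ℤ√D)) :
    ∃ n : ℕ, I * I.map (conj D : ℤ√D →+* ℤ√D) = Ideal.span {(n : ℤ√D)} := by
  obtain ⟨J, hJ⟩ := ideal_norm_ext (Int.castRingHom (ℤ√D)) (conj D) conj_conj conj_fix I
  obtain ⟨a, rfl⟩ := (IsPrincipalIdealRing.principal J).1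
  refine ⟨a.natAbs, ?_⟩
  rw [hJ]
  change Ideal.map _ (Ideal.span {a}) = _
  rw [Ideal.map_span, Set.image_singleton]
  rcases Int.natAbs_eq a with h | h
  · conv_lhs => rw [h]
    simp
  · conv_lhs => rw [h]
    rw [map_neg, Ideal.span_singleton_neg]
    simp

theorem int_dvd {a b : ℤ} (h : (a : ℤ√D) ∣ b) : a ∣ b := (Zsqrtd.intCast_dvd_intCast a b).1 h

theorem span_le_int {a b : ℤ} (h : Ideal.span {(a : ℤ√D)} ≤ Ideal.span {(b : ℤ√D)}) : b ∣ a :=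
  int_dvd (Ideal.span_singleton_le_span_singleton.1 h)

theorem span_int {a b : ℤ} (h : Ideal.span {(a : ℤ√D)} = Ideal.span {(b : ℤ√D)}) :
    a = b ∨ a = -b :=
  Int.natAbs_eq_natAbs_iff.1 (Int.natAbs_eq_of_dvd_dvd (span_le_int h.ge) (span_le_int h.le))

theorem natCast_ne {n : ℕ} (h : n ≠ 0) : (n : ℤ√D) ≠ 0 := by
  intro hh
  have := congrArg Zsqrtd.re hh
  simp at this; exact h this

theorem intCast_ne {n : ℤ} (h : n ≠ 0) : (n : ℤ√D) ≠ 0 := by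
  intro hh
  have := congrArg Zsqrtd.re hh
  simp at this; exact h this

theorem span_nat {a b : ℕ} (h : Ideal.span {(a : ℤ√D)} = Ideal.span {(b : ℤ√D)}) : a = b := by
  have : Ideal.span {((a : ℤ) : ℤ√D)} = Ideal.span {((b : ℤ) : ℤ√D)} := by exact_mod_cast h
  rcases span_int this with h | h <;> omega

theorem sqrtd_sq : (Zsqrtd.sqrtd : ℤ√D) ^ 2 = (D : ℤ√D) := by
  rw [sq, Zsqrtd.dmuld]

theorem ram_aux [IsDedekindDomain (ℤ√D)] {p : ℕ} (hp : p.Prime) (hp2 : ¬ (p : ℤ) ∣ 2 * D)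
    {R : Ideal (ℤ√D)} {b : ℕ} (hb : Squarefree b) (hR : R ^ 2 = Ideal.span {(b : ℤ√D)}) :
    ¬ p ∣ b := by
  intro hpb
  have hpp : Prime (p : ℤ) := Nat.prime_iff_prime_int.1 hp
  have hle : R ≤ Ideal.span {((p : ℤ) : ℤ√D)} := by
    intro z hz
    have h1 : z ^ 2 ∈ Ideal.span {((p : ℤ) : ℤ√D)} := by
      have : z ^ 2 ∈ R ^ 2 := Ideal.pow_mem_pow hz 2
      rw [hR] at this
      refine Ideal.span_singleton_le_span_singleton.2 ?_ this
      obtain ⟨c, rfl⟩ := hpb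
      exact ⟨c, by push_cast; ring⟩
    rw [Ideal.mem_span_singleton, Zsqrtd.intCast_dvd] at h1 ⊢
    have e1 : (z ^ 2).re = z.re ^ 2 + D * z.im ^ 2 := by rw [sq, Zsqrtd.re_mul]; ring
    have e2 : (z ^ 2).im = 2 * (z.re * z.im) := by rw [sq, Zsqrtd.im_mul]; ring
    rw [e1, e2] at h1
    have h2 : ¬ (p : ℤ) ∣ 2 := fun h => hp2 (h.mul_right _)
    have hD : ¬ (p : ℤ) ∣ D := fun h => hp2 (h.mul_left _)
    have h3 := (hpp.dvd_or_dvd h1.2).resolve_left h2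
    rcases hpp.dvd_or_dvd h3 with h4 | h4
    · refine ⟨h4, ?_⟩
      have : (p : ℤ) ∣ D * z.im ^ 2 := by
        have := dvd_sub h1.1 (dvd_pow h4 two_ne_zero)
        simpa using this
      exact hpp.dvd_of_dvd_pow ((hpp.dvd_or_dvd this).resolve_left hD)
    · refine ⟨?_, h4⟩
      have : (p : ℤ) ∣ z.re ^ 2 := by
        have := dvd_sub h1.1 ((dvd_pow h4 two_ne_zero).mul_left D)
        simpa using this
      exact hpp.dvd_of_dvd_pow this
  have h5 : Ideal.span {((b : ℤ) : ℤ√D)} ≤ Ideal.span {(((p : ℤ) * p : ℤ) : ℤ√D)} := by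
    have : R ^ 2 ≤ Ideal.span {((p : ℤ) : ℤ√D)} ^ 2 := Ideal.pow_right_mono hle 2
    rw [hR, Ideal.span_singleton_pow] at this
    have e : ((p : ℤ) : ℤ√D) ^ 2 = (((p : ℤ) * p : ℤ) : ℤ√D) := by push_cast; ring
    rw [e] at this
    exact_mod_cast this
  have h6 := span_le_int h5
  have h7 : p * p ∣ b := by exact_mod_cast h6
  have := hb p h7
  exact hp.one_lt.ne' (Nat.isUnit_iff.1 this)

theorem peel {b p : ℕ} (hp : p.Prime) (hb : Squarefree b) :
    ∃ i ≤ 1, ∃ b', b = p ^ i * b' ∧ Squarefree b' ∧ ¬ p ∣ b' := by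
  by_cases h : p ∣ b
  · obtain ⟨c, rfl⟩ := h
    refine ⟨1, le_rfl, c, by rw [pow_one], hb.squarefree_of_dvd (dvd_mul_left c p), ?_⟩
    rintro ⟨e, rfl⟩
    have := hb p ⟨e, by ring⟩
    exact hp.one_lt.ne' (Nat.isUnit_iff.1 this)
  · exact ⟨0, by simp, b, by simp, hb, h⟩

theorem ram [IsDedekindDomain (ℤ√D)] {q r s : ℕ} (hq : q.Prime) (hr : r.Prime) (hs : s.Prime)
    (hD : ∀ p : ℕ, p.Prime → (p : ℤ) ∣ 2 * D → p = 2 ∨ p = q ∨ p = r ∨ p = s)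
    {I : Ideal (ℤ√D)} {n : ℕ} (hn : n ≠ 0) (hI : I ^ 2 = Ideal.span {(n : ℤ√D)}) :
    ∃ i j k l m : ℕ, i ≤ 1 ∧ j ≤ 1 ∧ k ≤ 1 ∧ l ≤ 1 ∧ m ≠ 0 ∧
      n = 2 ^ i * q ^ j * r ^ k * s ^ l * m ^ 2 := by
  obtain ⟨b, m, hbm, hb⟩ := Nat.sq_mul_squarefree n
  have hm : m ≠ 0 := by rintro rfl; simp at hbm; exact hn hbm.symm
  have h1 : Ideal.span {(m : ℤ√D)} ∣ I := by
    rw [← UniqueFactorizationMonoid.pow_dvd_pow_iff_dvd two_ne_zero, hI,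
      Ideal.span_singleton_pow]
    refine ⟨Ideal.span {(b : ℤ√D)}, ?_⟩
    rw [Ideal.span_singleton_mul_span_singleton, ← hbm]
    push_cast; rfl
  obtain ⟨R, rfl⟩ := h1
  have hR : R ^ 2 = Ideal.span {(b : ℤ√D)} := by
    have h2 : Ideal.span {(m : ℤ√D)} ^ 2 ≠ 0 := by
      apply pow_ne_zero
      intro h
      exact natCast_ne (D := D) hm (by simpa using h)
    apply mul_left_cancel₀ h2
    rw [← mul_pow, hI, Ideal.span_singleton_pow, Ideal.span_singleton_mul_span_singleton, ← hbm]
    push_cast; rfl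
  have hbp : ∀ p : ℕ, p.Prime → p ∣ b → p = 2 ∨ p = q ∨ p = r ∨ p = s := by
    intro p hp hpb
    by_contra hcon
    exact ram_aux hp (fun h => hcon (hD p hp h)) hb hR hpb
  obtain ⟨i, hi, b1, rfl, hb1, n1⟩ := peel Nat.prime_two hb
  obtain ⟨j, hj, b2, rfl, hb2, n2⟩ := peel hq hb1
  obtain ⟨k, hk, b3, rfl, hb3, n3⟩ := peel hr hb2
  obtain ⟨l, hl, b4, rfl, hb4, n4⟩ := peel hs hb3
  have : b4 = 1 := by
    by_contra hne
    obtain ⟨p, hp, hpb⟩ := Nat.exists_prime_and_dvd hne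
    have d3 : p ∣ s ^ l * b4 := hpb.mul_left _
    have d2 := d3.mul_left (r ^ k)
    have d1 := d2.mul_left (q ^ j)
    rcases hbp p hp (d1.mul_left _) with rfl | rfl | rfl | rfl
    · exact n1 d1
    · exact n2 d2
    · exact n3 d3
    · exact n4 hpb
  subst this
  exact ⟨i, j, k, l, m, hi, hj, hk, hl, hm, by rw [← hbm]; ring⟩

/-- square-root extraction used for units -/
theorem extract [IsDedekindDomain (ℤ√D)] {x y w E : ℤ√D} (hx : x ≠ 0) 
    (h : y ^ 2 = x ^ 2 * (w * E)) : ∃ g, g ^ 2 = w * E := by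
  have : x ^ 2 ∣ y ^ 2 := ⟨_, h⟩
  rw [IsIntegrallyClosed.pow_dvd_pow_iff two_ne_zero] at this
  obtain ⟨g, rfl⟩ := this
  refine ⟨g, mul_left_cancel₀ (pow_ne_zero 2 hx) ?_⟩
  rw [← h]; ring

theorem idnorm_sq [IsDedekindDomain (ℤ√D)] {I : Ideal (ℤ√D)} {n : ℕ}
    (hI : I ^ 2 = Ideal.span {(n : ℤ√D)}) :
    I * I.map (conj D : ℤ√D →+* ℤ√D) = Ideal.span {(n : ℤ√D)} := by
  apply ideal_sq_inj
  rw [mul_pow, ← Ideal.map_pow, hI, Ideal.map_span, Set.image_singleton, sq]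
  simp

/-- two-torsion classes -/
theorem two_torsion [IsDedekindDomain (ℤ√D)]
    (hneg : ∀ X Y Z : ℤ, Z ≠ 0 → X ^ 2 - D * Y ^ 2 = - Z ^ 2 → False)
    {z : ClassGroup (ℤ√D)} (hz : z ^ 2 = 1) :
    ∃ I : Ideal (ℤ√D), I ≠ ⊥ ∧ cl I = z ∧ ∃ n : ℕ, n ≠ 0 ∧ I ^ 2 = Ideal.span {(n : ℤ√D)} := by
  obtain ⟨𝔞, h0, rfl⟩ := cl_surj z
  rw [← cl_pow h0, cl_eq_one_iff (pow_ne_zero 2 h0)] at hz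
  obtain ⟨α, hα0, hα⟩ := hz
  obtain ⟨n, hn⟩ := idnorm 𝔞
  have hmap0 : 𝔞.map (conj D : ℤ√D →+* ℤ√D) ≠ ⊥ := map_ne_bot (conj D).injective h0
  have hn0 : n ≠ 0 := by
    rintro rfl
    have : 𝔞 * 𝔞.map (conj D : ℤ√D →+* ℤ√D) = 0 := by rw [hn]; simp
    rcases mul_eq_zero.1 this with h | h
    · exact h0 h
    · exact hmap0 h
  have hN : Ideal.span {(α.norm : ℤ√D)} = Ideal.span {(((n : ℤ) ^ 2 : ℤ) : ℤ√D)} := by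
    have h1 : (𝔞 * 𝔞.map (conj D : ℤ√D →+* ℤ√D)) ^ 2 = Ideal.span {(n : ℤ√D)} ^ 2 := by rw [hn]
    rw [mul_pow, ← Ideal.map_pow, hα, Ideal.map_span, Set.image_singleton,
      Ideal.span_singleton_mul_span_singleton, Ideal.span_singleton_pow] at h1
    rw [← mul_conj]
    push_cast
    exact h1
  have hnn : (n : ℤ) ≠ 0 := by exact_mod_cast hn0
  have hpos : α.norm = (n : ℤ) ^ 2 := by
    rcases span_int hN with h | h
    · exact h
    · exact (hneg α.re α.im n hnn (by rw [← norm_expl, h])).elim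
  by_cases hc : α + n = 0
  · refine ⟨𝔞, h0, rfl, n, hn0, ?_⟩
    rw [hα, eq_neg_of_add_eq_zero_left hc, Ideal.span_singleton_neg]
  · set c := α + n with hcdef
    have hcc : conj D c ≠ 0 := by
      intro h; exact hc ((conj D).injective (by rw [h, map_zero]))
    have hkey : conj D c ^ 2 * α = ((n * c.norm : ℤ) : ℤ√D) := by
      push_cast
      rw [← mul_conj]
      have : α * conj D α = (n : ℤ√D) ^ 2 := by rw [mul_conj, hpos]; push_cast; ring
      have e : conj D c = conj D α + n := by rw [hcdef, map_add, conj_natCast]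
      rw [e, hcdef]
      linear_combination (conj D α + n) * this
    have hNc : c.norm ≠ 0 := by
      intro h
      have := mul_conj c
      rw [h, Int.cast_zero] at this
      rcases mul_eq_zero.1 this with h | h
      · exact hc h
      · exact hcc h
    refine ⟨Ideal.span {conj D c} * 𝔞, ?_, ?_, (n * c.norm : ℤ).natAbs, ?_, ?_⟩
    · exact mul_ne_zero (by simpa using hcc) h0
    · rw [cl_mul (by simpa using hcc) h0, cl_span, one_mul]
    · rw [Int.natAbs_ne_zero]; exact mul_ne_zero hnn hNc
    · rw [mul_pow, hα, Ideal.span_singleton_pow, Ideal.span_singleton_mul_span_singleton, hkey]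
      have e : ((n * c.norm : ℤ).natAbs : ℤ√D) = (((n * c.norm : ℤ).natAbs : ℤ) : ℤ√D) := by
        simp
      rw [e]
      rcases Int.natAbs_eq (n * c.norm : ℤ) with h | h
      · rw [← h]
      · conv_lhs => rw [h]
        rw [Int.cast_neg, Ideal.span_singleton_neg]

/-- comparing norms of equivalent ideals -/
theorem norm_compare [IsDedekindDomain (ℤ√D)] {I J : Ideal (ℤ√D)} (hI : I ≠ ⊥) (hJ : J ≠ ⊥)
    {a n : ℕ} (ha : I * I.map (conj D : ℤ√D →+* ℤ√D) = Ideal.span {(a : ℤ√D)})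
    (hn : J * J.map (conj D : ℤ√D →+* ℤ√D) = Ideal.span {(n : ℤ√D)}) (h : cl I = cl J) :
    ∃ X Y Z e : ℤ, (e = 1 ∨ e = -1) ∧ Z ≠ 0 ∧
      (n : ℤ) * a * Z ^ 2 = e * (X ^ 2 - D * Y ^ 2) := by
  obtain ⟨x, y, hx, hy, hxy⟩ := (cl_eq_iff hI hJ).1 h
  have hny : y.norm ≠ 0 := by
    intro h
    have := mul_conj y
    rw [h, Int.cast_zero] at this
    rcases mul_eq_zero.1 this with h | h
    · exact hy h
    · exact hy ((conj D).injective (by rw [h, map_zero]))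
  have h1 : Ideal.span {((x.norm * a : ℤ) : ℤ√D)} = Ideal.span {((y.norm * n : ℤ) : ℤ√D)} := by
    have e : ∀ (w : ℤ√D) (K : Ideal (ℤ√D)) (m : ℕ),
        K * K.map (conj D : ℤ√D →+* ℤ√D) = Ideal.span {(m : ℤ√D)} →
        (Ideal.span {w} * K) * (Ideal.span {w} * K).map (conj D : ℤ√D →+* ℤ√D) =
          Ideal.span {((w.norm * m : ℤ) : ℤ√D)} := by
      intro w K m hK
      rw [Ideal.map_mul, mul_mul_mul_comm, hK, Ideal.map_span, Set.image_singleton,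
        Ideal.span_singleton_mul_span_singleton, Ideal.span_singleton_mul_span_singleton]
      push_cast
      rw [← mul_conj]
    rw [← e x I a ha, ← e y J n hn, hxy]
  have hnat : ∀ w v : ℤ√D, (w * v).norm = w.norm * v.norm := Zsqrtd.norm_mul
  have key : ∀ w : ℤ√D, (a * w).norm = a ^ 2 * w.norm := by
    intro w
    rw [hnat]
    have : ((a : ℤ√D)).norm = (a : ℤ) ^ 2 := by
      rw [norm_expl]; simp
    rw [this]
  refine ⟨(a * (x * y)).re, (a * (x * y)).im, y.norm, ?_⟩
  rw [← norm_expl, key, hnat]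
  rcases span_int h1 with h | h
  · exact ⟨1, Or.inl rfl, hny, by linear_combination - a * y.norm * h⟩
  · exact ⟨-1, Or.inr rfl, hny, by linear_combination a * y.norm * h⟩

end Zs


namespace Zs

variable {D : ℤ}

theorem norm_unit {u : (ℤ√D)ˣ} : (u : ℤ√D).norm = 1 ∨ (u : ℤ√D).norm = -1 := by
  have : IsUnit (u : ℤ√D).norm := Zsqrtd.isUnit_iff_norm_isUnit _ |>.1 u.isUnit
  exact Int.isUnit_iff.1 this

/-- the unit of a Pell solution -/
def solU : Pell.Solution₁ D →* (ℤ√D)ˣ := Unitary.toUnits (R := ℤ√D)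

theorem solU_val (a : Pell.Solution₁ D) : (solU a : ℤ√D) = ⟨a.x, a.y⟩ := rfl

theorem solU_neg (a : Pell.Solution₁ D) : solU (-a) = - solU a := by
  ext <;> simp [solU_val]

theorem units_one {a : Pell.Solution₁ D} (ha : Pell.IsFundamental a) (u : (ℤ√D)ˣ)
    (hu : (u : ℤ√D).norm = 1) : ∃ k : ℤ, u = solU a ^ k ∨ u = - solU a ^ k := by
  rw [norm_expl] at hu
  obtain ⟨k, hk⟩ := ha.eq_zpow_or_neg_zpow (Pell.Solution₁.mk _ _ hu)
  have e : solU (Pell.Solution₁.mk _ _ hu) = u := by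
    ext <;> simp [solU_val]
  refine ⟨k, ?_⟩
  rcases hk with hk | hk
  · left; rw [← e, hk, map_zpow]
  · right; rw [← e, hk, solU_neg, map_zpow]

theorem fund_nonsq {a : Pell.Solution₁ D} (ha : Pell.IsFundamental a) 
    (hneg : ∀ X Y Z : ℤ, Z ≠ 0 → X ^ 2 - D * Y ^ 2 = - Z ^ 2 → False) (g : ℤ√D)
    (hg : g ^ 2 = solU a) : False := by
  have h1 : IsUnit g := by
    have : IsUnit (g ^ 2) := by rw [hg]; exact (solU a).isUnit
    exact (isUnit_pow_iff two_ne_zero).1 this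
  obtain ⟨u, rfl⟩ := h1
  have hu : (u : ℤ√D).norm = 1 := by
    rcases norm_unit (u := u) with h | h
    · exact h
    · rw [norm_expl] at h
      exact (hneg _ _ 1 one_ne_zero h).elim
  rw [norm_expl] at hu
  set b := Pell.Solution₁.mk _ _ hu with hb
  have e : solU b = u := by
    ext <;> simp [solU_val, hb]
  have hinj : Function.Injective (solU (D := D)) := Unitary.toUnits_injective
  have h2 : b ^ 2 = a := by
    apply hinj
    rw [map_pow, e]
    ext1
    rw [Units.val_pow_eq_pow_val, hg]
  obtain ⟨k, hk⟩ := ha.eq_zpow_or_neg_zpow b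
  have h3 : a ^ (2 * k - 1) = 1 := by
    have : a ^ (2 * k) = a := by
      rw [mul_comm, zpow_mul]
      rcases hk with hk | hk
      · rw [← hk]; exact_mod_cast h2
      · rw [← neg_eq_iff_eq_neg.2 hk]
        have : (-b) ^ (2 : ℤ) = b ^ 2 := by
          rw [show (2 : ℤ) = ((2 : ℕ) : ℤ) from rfl, zpow_natCast, neg_sq]
        rw [this, h2]
    rw [zpow_sub, this, zpow_one, mul_inv_cancel]
  rw [ha.zpow_eq_one_iff] at h3
  omega

theorem fund_sub_sq (a : Pell.Solution₁ D) :
    ((solU a : ℤ√D) - 1) ^ 2 = ((2 * (a.x - 1) : ℤ) : ℤ√D) * solU a := by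
  have := a.prop
  ext
  · simp [solU_val, sq]; linear_combination -this
  · simp [solU_val, sq]; ring

theorem fund_sub_norm (a : Pell.Solution₁ D) :
    (2 * (a.x - 1)) * 1 ^ 2 = (-1) * ((a.x - 1) ^ 2 - D * a.y ^ 2) := by
  have := a.prop
  linear_combination this

theorem split {l k : ℤ} (hl : IsCoprime l (2 * k)) (hk : l ∣ k ^ 2 - D) :
    let I : Ideal (ℤ√D) := Ideal.span {(l : ℤ√D), (k : ℤ√D) - Zsqrtd.sqrtd}
    let J := I.map (conj D : ℤ√D →+* ℤ√D)
    I * J = Ideal.span {(l : ℤ√D)} ∧ I ⊔ J = ⊤ := by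
  intro I J
  set w : ℤ√D := Zsqrtd.sqrtd with hw
  have hJ : J = Ideal.span {(l : ℤ√D), (k : ℤ√D) + w} := by
    have e : conj D ((k : ℤ√D) - w) = (k : ℤ√D) + w := by
      ext <;> simp [conj_apply, hw]
    change Ideal.map _ (Ideal.span _) = _
    rw [Ideal.map_span, Set.image_pair]
    change Ideal.span {conj D l, conj D ((k : ℤ√D) - w)} = _
    rw [conj_intCast, e]
  obtain ⟨m, hm⟩ := hk
  obtain ⟨a, b, hab⟩ := hl
  have hm' : ((k : ℤ√D) - w) * (k + w) = l * m := by
    have : ((k ^ 2 - D : ℤ) : ℤ√D) = ((l * m : ℤ) : ℤ√D) := by rw [hm]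
    push_cast at this
    linear_combination this - sqrtd_sq (D := D)
  have hab' : (a : ℤ√D) * l + b * (2 * k) = 1 := by exact_mod_cast congrArg (Int.cast : ℤ → ℤ√D) hab
  have i1 : (l : ℤ√D) ∈ I := Ideal.subset_span (by simp)
  have i2 : (k : ℤ√D) - w ∈ I := Ideal.subset_span (by simp [hw])
  have j1 : (l : ℤ√D) ∈ J := by rw [hJ]; exact Ideal.subset_span (by simp)
  have j2 : (k : ℤ√D) + w ∈ J := by rw [hJ]; exact Ideal.subset_span (by simp)
  constructor
  · apply le_antisymm
    · rw [hJ, Ideal.span_pair_mul_span_pair, Ideal.span_le]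
      intro x hx
      simp only [Set.mem_insert_iff, Set.mem_singleton_iff] at hx
      rw [SetLike.mem_coe, Ideal.mem_span_singleton]
      rcases hx with rfl | rfl | rfl | rfl
      · exact dvd_mul_right _ _
      · exact dvd_mul_right _ _
      · exact dvd_mul_left _ _
      · rw [hm']; exact dvd_mul_right _ _
    · rw [Ideal.span_singleton_le_iff_mem]
      have e : (l : ℤ√D) = a * (l * l) + b * (l * (k + w) + (k - w) * l) := by
        linear_combination - l * hab'
      rw [e]
      exact add_mem (Ideal.mul_mem_left _ _ (Ideal.mul_mem_mul i1 j1))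
        (Ideal.mul_mem_left _ _ (add_mem (Ideal.mul_mem_mul i1 j2) (Ideal.mul_mem_mul i2 j1)))
  · rw [Ideal.eq_top_iff_one]
    have e : (1 : ℤ√D) = a * l + b * ((k - w) + (k + w)) := by
      linear_combination - hab'
    rw [e]
    refine add_mem (Ideal.mul_mem_left _ _ (Ideal.mem_sup_left i1)) (Ideal.mul_mem_left _ _
      (add_mem (Ideal.mem_sup_left i2) (Ideal.mem_sup_right j2)))

theorem euclid2 (a b : ℤ√2) (hb : b ≠ 0) : ∃ q : ℤ√2, (a - b * q).norm.natAbs < b.norm.natAbs := by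
  have hn : b.norm ≠ 0 := by
    intro h
    have h2 : b.re * b.re = 2 * b.im * b.im := by
      rw [Zsqrtd.norm_def] at h; linarith
    apply hb
    by_contra hcon
    have him : b.im ≠ 0 := by
      intro h0
      rw [h0] at h2
      apply hcon
      have : b.re = 0 := by simpa using h2
      ext <;> simp [h0, this]
    have hs : IsSquare (2 : ℤ) := by
      have h5 : b.im ^ 2 ∣ b.re ^ 2 := ⟨2, by linear_combination h2⟩
      rw [Int.pow_dvd_pow_iff two_ne_zero] at h5
      obtain ⟨c, hc⟩ := h5
      refine ⟨c, ?_⟩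
      apply mul_left_cancel₀ (pow_ne_zero 2 him)
      rw [hc] at h2
      linear_combination - h2
    exact Int.prime_two.irreducible.not_isSquare hs
  set n := b.norm with hndef
  set t := a * star b with ht
  obtain ⟨u0, hu⟩ : ∃ u0 : ℤ, |2 * (t.re - n * u0)| ≤ |n| := by
    have hm := Int.emod_nonneg t.re hn
    have hm2 := Int.emod_lt_abs t.re hn
    have hm3 := Int.emod_add_mul_ediv t.re n
    by_cases hc : 2 * (t.re % n) ≤ |n|
    · refine ⟨t.re / n, ?_⟩
      rw [abs_le]; constructor <;> linarith
    · refine ⟨t.re / n + n.sign, ?_⟩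
      have : n * n.sign = |n| := by rw [mul_comm]; exact Int.sign_mul_self_eq_abs n
      rw [mul_add, this, abs_le]; constructor <;> linarith
  obtain ⟨v0, hv⟩ : ∃ u0 : ℤ, |2 * (t.im - n * u0)| ≤ |n| := by
    have hm := Int.emod_nonneg t.im hn
    have hm2 := Int.emod_lt_abs t.im hn
    have hm3 := Int.emod_add_mul_ediv t.im n
    by_cases hc : 2 * (t.im % n) ≤ |n|
    · refine ⟨t.im / n, ?_⟩
      rw [abs_le]; constructor <;> linarith
    · refine ⟨t.im / n + n.sign, ?_⟩
      have : n * n.sign = |n| := by rw [mul_comm]; exact Int.sign_mul_self_eq_abs n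
      rw [mul_add, this, abs_le]; constructor <;> linarith
  refine ⟨⟨u0, v0⟩, ?_⟩
  set w := a - b * ⟨u0, v0⟩ with hw
  have h1 : w * star b = ⟨t.re - n * u0, t.im - n * v0⟩ := by
    have : b * star b = (n : ℤ√2) := (Zsqrtd.norm_eq_mul_conj b).symm
    have e : w * star b = t - n * ⟨u0, v0⟩ := by
      rw [hw, ht]; linear_combination - (⟨u0, v0⟩ : ℤ√2) * this
    rw [e]; ext <;> simp
  have h2 : w.norm * n = (t.re - n * u0) ^ 2 - 2 * (t.im - n * v0) ^ 2 := by
    have := congrArg Zsqrtd.norm h1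
    rw [Zsqrtd.norm_mul, Zsqrtd.norm_conj, norm_expl (⟨t.re - n * u0, t.im - n * v0⟩ : ℤ√2)] at this
    exact this
  have h3 : |w.norm| * |n| < |n| * |n| := by
    rw [← abs_mul, h2]
    have hu2 := sq_le_sq.2 (show |2 * (t.re - n * u0)| ≤ |(|n|)| by rwa [abs_abs])
    have hv2 := sq_le_sq.2 (show |2 * (t.im - n * v0)| ≤ |(|n|)| by rwa [abs_abs])
    have hpos : 0 < |n| := abs_pos.2 hn
    rw [abs_lt]
    constructor <;> nlinarith
  have h4 : |w.norm| < |n| := lt_of_mul_lt_mul_right h3 (abs_nonneg n)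
  rw [Int.abs_eq_natAbs, Int.abs_eq_natAbs] at h4
  exact_mod_cast h4

theorem pir2 : IsPrincipalIdealRing (ℤ√2) := by
  constructor
  intro I
  by_cases hI : I = ⊥
  · rw [hI]; infer_instance
  obtain ⟨x, hx, hx0⟩ := Submodule.exists_mem_ne_zero_of_ne_bot hI
  have hex : ∃ n : ℕ, ∃ x ∈ I, x ≠ 0 ∧ x.norm.natAbs = n := ⟨_, x, hx, hx0, rfl⟩
  classical
  obtain ⟨b, hb, hb0, hbn⟩ := Nat.find_spec hex
  refine ⟨b, ?_⟩
  apply le_antisymm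
  · intro a ha
    obtain ⟨q, hq⟩ := euclid2 a b hb0
    have : a - b * q = 0 := by
      by_contra hne
      rw [hbn] at hq
      exact Nat.find_min hex hq ⟨_, sub_mem ha (Ideal.mul_mem_right _ _ hb), hne, rfl⟩
    change a ∈ Ideal.span {b}
    rw [Ideal.mem_span_singleton]
    exact ⟨q, sub_eq_zero.1 this⟩
  · change Ideal.span {b} ≤ I
    rwa [Ideal.span_singleton_le_iff_mem]

/-- the unit `1 + √2` -/
def E2 : (ℤ√2)ˣ where
  val := ⟨1, 1⟩
  inv := ⟨-1, 1⟩
  val_inv := by decide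
  inv_val := by decide

theorem units2 (u : (ℤ√2)ˣ) : ∃ k : ℤ, u = E2 ^ k ∨ u = - E2 ^ k := by
  let a : Pell.Solution₁ 2 := Pell.Solution₁.mk 3 2 (by norm_num)
  have ha : Pell.IsFundamental a := by
    refine ⟨by simp [a], by simp [a], ?_⟩
    intro b hb
    change 3 ≤ b.x
    have := b.prop
    by_contra hc
    have h2 : b.x = 2 := by omega
    rw [h2] at this
    omega
  have e : solU a = E2 ^ 2 := by
    ext1
    rw [solU_val]
    rfl
  rcases norm_unit (u := u) with h | h
  · obtain ⟨k, hk⟩ := units_one ha u h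
    rw [e, ← zpow_natCast, ← zpow_mul] at hk
    exact ⟨_, hk⟩
  · obtain ⟨k, hk⟩ := units_one ha (u * E2) (by
      rw [Units.val_mul, Zsqrtd.norm_mul, h]; rfl)
    rw [e, ← zpow_natCast, ← zpow_mul] at hk
    refine ⟨((2 : ℕ) : ℤ) * k - 1, ?_⟩
    rw [zpow_sub_one]
    rcases hk with hk | hk
    · left; rw [← hk, mul_inv_cancel_right]
    · right; rw [← neg_mul, ← hk, mul_inv_cancel_right]

end Zs


namespace Hyp

open Zs

variable {η η' q r s : ℕ} {Q d d' : ℤ}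

theorem nonsq_aux (h : Hyp η η' q r s Q d d') {D1 : ℤ} (hD1 : ¬ (q : ℤ) ∣ D1) :
    ¬ IsSquare (q * D1) := by
  rintro ⟨c, hc⟩
  have h1 : (q : ℤ) ∣ c := by
    rcases h.qprime.dvd_or_dvd (⟨D1, hc.symm⟩ : (q : ℤ) ∣ c * c) with h | h <;> exact h
  obtain ⟨e, rfl⟩ := h1
  apply hD1
  refine ⟨e * e, ?_⟩
  apply mul_left_cancel₀ h.qprime.ne_zero
  linear_combination hc

theorem d_nonsq (h : Hyp η η' q r s Q d d') : ¬ IsSquare d := by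
  rw [h.hdq]; exact h.nonsq_aux (h.q_ndvd h.η_or)

theorem d'_nonsq (h : Hyp η η' q r s Q d d') : ¬ IsSquare d' := by
  rw [h.hdq']; exact h.nonsq_aux (h.q_ndvd h.η'_or)

theorem ram_d (h : Hyp η η' q r s Q d d') [IsDedekindDomain (ℤ√d)] {I : Ideal (ℤ√d)} {n : ℕ}
    (hn : n ≠ 0) (hI : I ^ 2 = Ideal.span {(n : ℤ√d)}) :
    ∃ i j k l m : ℕ, i ≤ 1 ∧ j ≤ 1 ∧ k ≤ 1 ∧ l ≤ 1 ∧ m ≠ 0 ∧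
      n = 2 ^ i * q ^ j * r ^ k * s ^ l * m ^ 2 :=
  ram h.hq h.hr h.hs (fun _ hp hh => h.primes_d hp hh) hn hI

theorem ram_d' (h : Hyp η η' q r s Q d d') [IsDedekindDomain (ℤ√d')] {I : Ideal (ℤ√d')} {n : ℕ}
    (hn : n ≠ 0) (hI : I ^ 2 = Ideal.span {(n : ℤ√d')}) :
    ∃ i j k l m : ℕ, i ≤ 1 ∧ j ≤ 1 ∧ k ≤ 1 ∧ l ≤ 1 ∧ m ≠ 0 ∧
      n = 2 ^ i * q ^ j * r ^ k * s ^ l * m ^ 2 :=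
  ram h.hq h.hr h.hs (fun _ hp hh => h.primes_d' hp hh) hn hI

theorem fund_ideal {D : ℤ} {a : Pell.Solution₁ D} (ha : Pell.IsFundamental a) :
    ∃ n : ℕ, n ≠ 0 ∧ (n : ℤ) = 2 * (a.x - 1) ∧
      Ideal.span {(solU a : ℤ√D) - 1} ^ 2 = Ideal.span {(n : ℤ√D)} := by
  have := ha.1
  refine ⟨(2 * (a.x - 1)).toNat, by omega, by omega, ?_⟩
  rw [Ideal.span_singleton_pow, fund_sub_sq, ← Ideal.span_singleton_mul_span_singleton,
    Ideal.span_singleton_eq_top.2 (solU a).isUnit, Ideal.mul_top]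
  congr 2
  have e : (((2 * (a.x - 1)).toNat : ℤ) : ℤ√D) = ((2 * (a.x - 1) : ℤ) : ℤ√D) := by
    congr 1; omega
  rw [← e, Int.cast_natCast]

theorem units_all {D : ℤ} (hneg : ∀ X Y Z : ℤ, Z ≠ 0 → X ^ 2 - D * Y ^ 2 = - Z ^ 2 → False)
    (u : (ℤ√D)ˣ) : (u : ℤ√D).norm = 1 := by
  rcases norm_unit (u := u) with h1 | h1
  · exact h1
  · rw [norm_expl] at h1
    exact (hneg _ _ 1 one_ne_zero h1).elim

theorem combK (h : Hyp η η' q r s Q d d') {i j k l : ℕ} (hi : i ≤ 1) (hj : j ≤ 1) (hk : k ≤ 1)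
    (hl : l ≤ 1) {m n : ℕ} (hm : m ≠ 0) (hn : n = 2 ^ i * q ^ j * r ^ k * s ^ l * m ^ 2)
    {e X Y Z : ℤ} (he : e = 1 ∨ e = -1) (hZ : Z ≠ 0)
    (hh : (n : ℤ) * Z ^ 2 = e * (X ^ 2 - d' * Y ^ 2)) :
    ∃ e f : ℕ, e ≤ 1 ∧ f ≤ 1 ∧ ∃ K : ℤ, K ≠ 0 ∧ n * Q ^ e * d' ^ f = K ^ 2 := by
  have := Fact.mk h.hr
  have := Fact.mk h.hs
  have hm' : (m : ℤ) ≠ 0 := by exact_mod_cast hm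
  have hh2 : (2 ^ i * q ^ j * r ^ k * s ^ l * 1) * (m * Z) ^ 2 = e * (X ^ 2 - d' * Y ^ 2) := by
    rw [← hh, hn]; push_cast; ring
  have h1 := h.legd'_r hk (h.rprime.not_dvd_one) he (mul_ne_zero hm' hZ) hh2
  have h2 := h.legd'_s hl (h.swap.rprime.not_dvd_one) he (mul_ne_zero hm' hZ) hh2
  rw [legendreSym.at_one, mul_one] at h1 h2
  obtain ⟨e, f, he, hf, K, hK, hK2⟩ := h.comb' hi hj hk hl h1 h2
  refine ⟨e, f, he, hf, K * m, mul_ne_zero hK hm', ?_⟩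
  rw [hn]; push_cast
  linear_combination m ^ 2 * hK2

theorem alpha' (h : Hyp η η' q r s Q d d') [IsDedekindDomain (ℤ√d')] :
    ∃ (E : (ℤ√d')ˣ) (α : ℤ√d'), α ^ 2 = Q * E ∧ (∀ u : (ℤ√d')ˣ, ∃ k : ℤ, u = E ^ k ∨ u = - E ^ k) ∧
      (α * conj d' α = Q ∨ α * conj d' α = - (Q : ℤ√d')) := by
  have hneg : ∀ X Y Z : ℤ, Z ≠ 0 → X ^ 2 - d' * Y ^ 2 = - Z ^ 2 → False :=
    fun _ _ _ => h.no_neg_d'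
  obtain ⟨a, ha⟩ := Pell.IsFundamental.exists_of_not_isSquare h.d'_pos h.d'_nonsq
  obtain ⟨n, hn0, hn, hI⟩ := fund_ideal ha
  obtain ⟨i, j, k, l, m, hi, hj, hk, hl, hm, hnn⟩ := h.ram_d' hn0 hI
  obtain ⟨e, f, he, hf, K, hK, hK2⟩ := h.combK hi hj hk hl hm hnn (Or.inr rfl) one_ne_zero
    (by rw [hn]; exact fund_sub_norm a)
  have h1 : (Zsqrtd.sqrtd ^ f * (Q : ℤ√d') ^ e * ((solU a : ℤ√d') - 1)) ^ 2 =
      (K : ℤ√d') ^ 2 * ((Q : ℤ√d') ^ e * (solU a : ℤ√d')) := by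
    have e1 : ((n : ℤ) : ℤ√d') * Q ^ e * d' ^ f = (K : ℤ√d') ^ 2 := by
      rw [hn] at hK2 ⊢
      exact_mod_cast congrArg (Int.cast : ℤ → ℤ√d') hK2
    rw [mul_pow, mul_pow, fund_sub_sq, ← hn, ← e1, ← pow_mul, mul_comm f 2, pow_mul, sqrtd_sq]
    ring
  obtain ⟨g, hg⟩ := extract (intCast_ne hK) h1
  have hE : (solU a : ℤ√d').norm = 1 := units_all hneg _
  have he1 : e = 1 := by
    by_contra hne
    have : e = 0 := by omega
    rw [this, pow_zero, one_mul] at hg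
    exact fund_nonsq ha hneg g hg
  rw [he1, pow_one] at hg
  refine ⟨solU a, g, hg, fun u => units_one ha u (units_all hneg u), ?_⟩
  have h2 : g.norm ^ 2 = Q ^ 2 := by
    rw [sq, ← Zsqrtd.norm_mul, ← sq, hg, Zsqrtd.norm_mul, hE, Zsqrtd.norm_intCast]; ring
  rw [mul_conj]
  rcases sq_eq_sq_iff_eq_or_eq_neg.1 h2 with h3 | h3
  · left; rw [h3]
  · right; rw [h3]; simp

theorem isFund (h : Hyp η η' q r s Q d d') {γ γ' : ℤ} (hγ : 0 < γ) (hγ' : 0 < γ')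
    (hPell : γ ^ 2 - d * γ' ^ 2 = 1)
    (hfund : ∀ a b : ℤ, 0 < a → 0 < b → a ^ 2 - d * b ^ 2 = 1 → γ ≤ a) :
    Pell.IsFundamental (Pell.Solution₁.mk γ γ' hPell) := by
  have hd := h.d_pos
  refine ⟨?_, hγ', ?_⟩
  · rw [Pell.Solution₁.x_mk]
    by_contra hc
    have : γ = 1 := by omega
    rw [this] at hPell
    have : 0 < d * γ' ^ 2 := by positivity
    omega
  · intro b hb
    have h0 := Pell.Solution₁.y_ne_zero_of_one_lt_x hb
    exact hfund b.x |b.y| (by omega) (abs_pos.2 h0) (by rw [sq_abs]; exact b.prop)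

theorem alpha (h : Hyp η η' q r s Q d d') [IsDedekindDomain (ℤ√d)] {a : Pell.Solution₁ d}
    (ha : Pell.IsFundamental a) :
    ∃ (E : (ℤ√d)ˣ), (∀ u : (ℤ√d)ˣ, ∃ k : ℤ, u = E ^ k ∨ u = - E ^ k) ∧
      (IsSquare (Q * (2 * (a.x - 1))) ∧ (∃ α : ℤ√d, α ^ 2 = Q * E) ∨
        ¬ IsSquare (Q * (2 * (a.x - 1))) ∧
          ∃ α : ℤ√d, α ^ 2 = (r : ℤ√d) * E ∨ α ^ 2 = (s : ℤ√d) * E) := by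
  have hneg : ∀ X Y Z : ℤ, Z ≠ 0 → X ^ 2 - d * Y ^ 2 = - Z ^ 2 → False :=
    fun _ _ _ => h.no_neg_d
  obtain ⟨n, hn0, hn, hI⟩ := fund_ideal ha
  refine ⟨solU a, fun u => units_one ha u (units_all hneg u), ?_⟩
  have hQ0 := h.Q_pos.ne'
  have hr0 := h.r_pos.ne'
  have hs0 := h.s_pos.ne'
  have main : ∀ (c b K : ℤ) (δ : ℤ√d), K ≠ 0 → δ ^ 2 = (c : ℤ√d) → 
      b * c * (2 * (a.x - 1)) = K ^ 2 → ∃ g : ℤ√d, g ^ 2 = (b : ℤ√d) * solU a := by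
    intro c b K δ hK hδ hb
    refine extract (x := (K : ℤ√d)) (y := δ * b * ((solU a : ℤ√d) - 1)) (intCast_ne hK) ?_
    have e1 : (b : ℤ√d) * c * ((2 * (a.x - 1) : ℤ) : ℤ√d) = (K : ℤ√d) ^ 2 := by
      exact_mod_cast congrArg (Int.cast : ℤ → ℤ√d) hb
    rw [mul_pow, mul_pow, fund_sub_sq, ← e1, hδ]
    ring
  by_cases hsq : IsSquare (Q * (2 * (a.x - 1)))
  · left
    refine ⟨hsq, ?_⟩
    obtain ⟨K, hK⟩ := hsq
    refine main 1 Q K 1 ?_ (by simp) (by linear_combination hK)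
    rintro rfl
    rw [← hn] at hK
    have : (n : ℤ) ≠ 0 := by exact_mod_cast hn0
    exact mul_ne_zero hQ0 this hK
  · right
    refine ⟨hsq, ?_⟩
    obtain ⟨i, j, k, l, m, hi, hj, hk, hl, hm, hnn⟩ := h.ram_d hn0 hI
    have hm' : (m : ℤ) ≠ 0 := by exact_mod_cast hm
    have := Fact.mk h.hr
    have hno := fund_sub_norm a
    rw [← hn] at hno
    have h1 := h.legd_r (i := i) (j := j) (l := l) (c := 1) (e := -1) (Z := m) hk
      (h.rprime.not_dvd_one) (Or.inr rfl) hm'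
      (by rw [← hno, hnn]; push_cast; ring)
    rw [legendreSym.at_one, mul_one] at h1
    obtain ⟨e, he, hQe⟩ := h.comb hi hj h1
    have hnn2 : 2 * (a.x - 1) = Q ^ e * r ^ k * s ^ l * m ^ 2 := by
      rw [← hn, hnn]; push_cast
      linear_combination r ^ k * s ^ l * m ^ 2 * hQe
    have hδ : (Zsqrtd.sqrtd : ℤ√d) ^ 2 = ((d : ℤ) : ℤ√d) := sqrtd_sq
    rw [hnn2] at main hsq
    rw [hn, hnn2] at hno
    have hd := h.hd
    have hb1 : ¬ ∃ g : ℤ√d, g ^ 2 = (((1 : ℤ)) : ℤ√d) * solU a := by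
      rintro ⟨g, hg⟩
      exact fund_nonsq ha hneg g (by simpa using hg)
    interval_cases e <;> interval_cases k <;> interval_cases l
    · exact absurd (main 1 1 m 1 hm' (by simp) (by ring)) hb1
    · obtain ⟨g, hg⟩ := main 1 s (s * m) 1 (by positivity) (by simp) (by ring)
      exact ⟨g, Or.inr (by simpa using hg)⟩
    · obtain ⟨g, hg⟩ := main 1 r (r * m) 1 (by positivity) (by simp) (by ring)
      exact ⟨g, Or.inl (by simpa using hg)⟩
    · exact (h.no_neg_rs (X := a.x - 1) (Y := a.y) hm' (by linear_combination hno)).elim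
    · exact absurd ⟨Q * m, by ring⟩ hsq
    · obtain ⟨g, hg⟩ := main d r (Q * r * s * m) _ (by positivity) hδ (by rw [hd]; ring)
      exact ⟨g, Or.inl (by simpa using hg)⟩
    · obtain ⟨g, hg⟩ := main d s (Q * r * s * m) _ (by positivity) hδ (by rw [hd]; ring)
      exact ⟨g, Or.inr (by simpa using hg)⟩
    · exact absurd (main d 1 (Q * r * s * m) _ (by positivity) hδ (by rw [hd]; ring)) hb1

theorem four_torsion (h : Hyp η η' q r s Q d d') [IsDedekindDomain (ℤ√d')]
    {z : ClassGroup (ℤ√d')} (hz : z ^ 4 = 1) : z ^ 2 = 1 := by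
  have hneg : ∀ X Y Z : ℤ, Z ≠ 0 → X ^ 2 - d' * Y ^ 2 = - Z ^ 2 → False :=
    fun _ _ _ => h.no_neg_d'
  obtain ⟨I, hI0, hI, n, hn0, hn⟩ := two_torsion hneg (z := z ^ 2) (by rw [← pow_mul]; exact hz)
  obtain ⟨E, α, hα, -, -⟩ := h.alpha'
  obtain ⟨𝔞, ha0, rfl⟩ := cl_surj z
  obtain ⟨a, ha⟩ := idnorm 𝔞
  rw [← cl_pow ha0] at hI
  obtain ⟨X, Y, Z, e, he, hZ, hXY⟩ := norm_compare (pow_ne_zero 2 ha0) hI0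
    (a := a ^ 2) (n := n) (by
      rw [Ideal.map_pow, ← mul_pow, ha, Ideal.span_singleton_pow]; push_cast; rfl)
    (idnorm_sq hn) hI.symm
  have ha' : (a : ℤ) ≠ 0 := by
    intro h0
    have : 𝔞 * 𝔞.map (conj d' : ℤ√d' →+* ℤ√d') = 0 := by
      rw [ha]; have : a = 0 := by exact_mod_cast h0
      rw [this]; simp
    rcases mul_eq_zero.1 this with h | h
    · exact ha0 h
    · exact map_ne_bot (conj d').injective ha0 h
  obtain ⟨i, j, k, l, m, hi, hj, hk, hl, hm, hnn⟩ := h.ram_d' hn0 hn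
  obtain ⟨e, f, -, -, K, hK, hK2⟩ := h.combK hi hj hk hl hm hnn he (mul_ne_zero ha' hZ)
    (X := X) (Y := Y) (by rw [← hXY]; push_cast; ring)
  have hα0 : α ≠ 0 := by
    rintro rfl
    have : (Q : ℤ√d') ≠ 0 := intCast_ne h.Q_pos.ne'
    rw [zero_pow two_ne_zero] at hα
    exact mul_ne_zero this E.ne_zero hα.symm
  have hθ0 : (Zsqrtd.sqrtd : ℤ√d') ≠ 0 := by
    intro h0
    have := congrArg Zsqrtd.im h0
    simp at this
  have hm0 : Ideal.span {α ^ e * Zsqrtd.sqrtd ^ f} ≠ ⊥ := by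
    rw [Ne, Ideal.span_singleton_eq_bot]
    exact mul_ne_zero (pow_ne_zero _ hα0) (pow_ne_zero _ hθ0)
  have hp : Ideal.span {α ^ e * Zsqrtd.sqrtd ^ f} * I = Ideal.span {(K : ℤ√d')} := by
    apply ideal_sq_inj
    rw [mul_pow, hn, Ideal.span_singleton_pow, Ideal.span_singleton_pow,
      Ideal.span_singleton_mul_span_singleton]
    have e1 : (n : ℤ√d') * Q ^ e * d' ^ f = (K : ℤ√d') ^ 2 := by
      have := congrArg (Int.cast : ℤ → ℤ√d') hK2
      push_cast at this
      exact this
    have e2 : (α ^ e * Zsqrtd.sqrtd ^ f) ^ 2 * (n : ℤ√d') = (K : ℤ√d') ^ 2 * (E : ℤ√d') ^ e := by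
      rw [mul_pow, ← pow_mul, ← pow_mul, mul_comm e 2, mul_comm f 2, pow_mul, pow_mul, hα,
        sqrtd_sq, ← e1]
      ring
    rw [e2, ← Ideal.span_singleton_mul_span_singleton,
      Ideal.span_singleton_eq_top.2 (E.isUnit.pow e), Ideal.mul_top]
  have := cl_mul hm0 hI0
  rw [hp, cl_span, cl_span, one_mul, hI] at this
  rw [← cl_pow ha0, this]

theorem pow_torsion (h : Hyp η η' q r s Q d d') [IsDedekindDomain (ℤ√d')]
    (a : ℕ) (z : ClassGroup (ℤ√d')) (hz : z ^ 2 ^ a = 1) : z ^ 2 = 1 := by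
  induction a generalizing z with
  | zero => rw [pow_zero, pow_one] at hz; rw [hz, one_pow]
  | succ a ih =>
    apply h.four_torsion
    rw [show 4 = 2 * 2 from rfl, pow_mul]
    apply ih
    rw [← pow_mul]; rw [pow_succ, mul_comm] at hz; exact hz

theorem odd_exp (h : Hyp η η' q r s Q d d') [IsDedekindDomain (ℤ√d')]
    [Finite (ClassGroup (ℤ√d'))] :
    ∃ m : ℕ, Odd m ∧ ∀ z : ClassGroup (ℤ√d'), (z ^ m) ^ 2 = 1 := by
  have hN : Nat.card (ClassGroup (ℤ√d')) ≠ 0 := Nat.card_pos.ne'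
  obtain ⟨a, m, hm, hN2⟩ := Nat.exists_eq_two_pow_mul_odd hN
  refine ⟨m, hm, fun z => h.pow_torsion a _ ?_⟩
  rw [← pow_mul, mul_comm, ← hN2, pow_card_eq_one']

end Hyp


namespace Hyp

open Zs

variable {η η' q r s : ℕ} {Q d d' : ℤ}

theorem exists_prime (h : Hyp η η' q r s Q d d') :
    ∃ l : ℕ, l.Prime ∧ 8 * q * r * s < l ∧ l % 8 = 1 ∧ (q : ℤ) ∣ l - (-1) ∧ (r : ℤ) ∣ l - 1 ∧
      ∀ [Fact s.Prime], legendreSym s l = -1 := by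
  have hr := Fact.mk h.hr
  have hs := Fact.mk h.hs
  have hq := Fact.mk h.hq
  have hs8 := h.hs8
  have hr8 := h.hr8
  have hq4 := h.hq4
  obtain ⟨t, ht⟩ := FiniteField.exists_nonsquare (F := ZMod s) (by
    rw [ZMod.ringChar_zmod_n]; intro h2; rw [h2] at hs8; omega)
  have c8 : ∀ p : ℕ, p.Prime → p % 2 = 1 → Nat.Coprime 8 p := by
    intro p hp h2
    rw [show 8 = 2 ^ 3 by norm_num]
    apply Nat.Coprime.pow_left
    rw [Nat.coprime_primes Nat.prime_two hp]; omega
  have cqr : Nat.Coprime q r := (Nat.coprime_primes h.hq h.hr).2 h.qr_ne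
  have cqs : Nat.Coprime q s := (Nat.coprime_primes h.hq h.hs).2 h.qs_ne
  have crs : Nat.Coprime r s := (Nat.coprime_primes h.hr h.hs).2 h.rs_ne
  have c1 : Nat.Coprime 8 q := c8 q h.hq (by omega)
  have c2 : Nat.Coprime (8 * q) r := Nat.Coprime.mul_left (c8 r h.hr (by omega)) cqr
  have c3 : Nat.Coprime (8 * q * r) s :=
    Nat.Coprime.mul_left (Nat.Coprime.mul_left (c8 s h.hs (by omega)) cqs) crs
  obtain ⟨x1, h11, h12⟩ := Nat.chineseRemainder c1 1 (q - 1)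
  obtain ⟨x2, h21, h22⟩ := Nat.chineseRemainder c2 x1 1
  obtain ⟨x, h31, h32⟩ := Nat.chineseRemainder c3 x2 t.val
  have hx8 : x ≡ 1 [MOD 8] :=
    ((h31.of_mul_right r).of_mul_right q).trans ((h21.of_mul_right q).trans h11)
  have hxq : x ≡ q - 1 [MOD q] :=
    ((h31.of_mul_right r).of_mul_left 8).trans ((h21.of_mul_left 8).trans h12)
  have hxr : x ≡ 1 [MOD r] := (h31.of_mul_left (8 * q)).trans h22
  have ht0 : t ≠ 0 := by rintro rfl; exact ht ⟨0, by simp⟩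
  have cop : Nat.Coprime x (8 * q * r * s) := by
    refine Nat.Coprime.mul_right (Nat.Coprime.mul_right (Nat.Coprime.mul_right ?_ ?_) ?_) ?_
    · rw [Nat.Coprime, hx8.gcd_eq]; simp
    · rw [Nat.Coprime, hxq.gcd_eq]
      have := Nat.coprime_self_sub_right (n := q) (m := 1) (by omega)
      rw [← Nat.Coprime, Nat.coprime_comm, this]; simp
    · rw [Nat.Coprime, hxr.gcd_eq]; simp
    · rw [Nat.Coprime, h32.gcd_eq, ← Nat.Coprime, ← ZMod.isUnit_iff_coprime]
      simpa using ht0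
  have : NeZero (8 * q * r * s) := ⟨by have := h.hq.pos; have := h.hr.pos; have := h.hs.pos; positivity⟩
  obtain ⟨l, hl, hlp, hlx⟩ := Nat.forall_exists_prime_gt_and_eq_mod
    ((ZMod.isUnit_iff_coprime x (8 * q * r * s)).2 cop) (8 * q * r * s)
  have hlx : l ≡ x [MOD 8 * q * r * s] := (ZMod.natCast_eq_natCast_iff _ _ _).1 hlx
  refine ⟨l, hlp, hl, ?_, ?_, ?_, ?_⟩
  · have := (((hlx.of_mul_right s).of_mul_right r).of_mul_right q).trans hx8
    exact this
  · have := (((hlx.of_mul_right s).of_mul_right r).of_mul_left 8).trans hxq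
    have h2 := (Nat.modEq_iff_dvd.1 this.symm)
    have hq1 : 1 ≤ q := by omega
    push_cast [Nat.cast_sub hq1] at h2
    obtain ⟨c, hc⟩ := h2
    exact ⟨c + 1, by linear_combination hc⟩
  · have := ((hlx.of_mul_right s).of_mul_left (8 * q)).trans hxr
    exact_mod_cast (Nat.modEq_iff_dvd.1 this.symm)
  · intro _
    have := (hlx.of_mul_left (8 * q * r)).trans h32
    have h2 : ((l : ℤ) : ZMod s) = t := by
      have := (ZMod.natCast_eq_natCast_iff _ _ _).2 this
      rw [Int.cast_natCast, this]; simp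
    rw [legendreSym.eq_neg_one_iff, h2]
    exact ht

theorem quad_aux {l : ℕ} (hl : l.Prime) (hl8 : l % 8 = 1) {D : ℤ}
    (hD : ∀ [Fact l.Prime], legendreSym l D = 1) :
    ∃ k : ℤ, IsCoprime (l : ℤ) (2 * k) ∧ (l : ℤ) ∣ k ^ 2 - D := by
  have := Fact.mk hl
  have hlp := Nat.prime_iff_prime_int.1 hl
  have h1 := hD
  have hD0 : (D : ZMod l) ≠ 0 := by
    intro h0
    rw [(legendreSym.eq_zero_iff l D).2 h0] at h1
    exact zero_ne_one h1
  obtain ⟨c, hc⟩ := (legendreSym.eq_one_iff l hD0).1 h1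
  have hk : (l : ℤ) ∣ (c.val : ℤ) ^ 2 - D := by
    rw [← ZMod.intCast_zmod_eq_zero_iff_dvd]
    push_cast
    rw [ZMod.natCast_zmod_val, hc]; ring
  refine ⟨c.val, ?_, hk⟩
  rw [hlp.irreducible.coprime_iff_not_dvd]
  intro h2
  rcases hlp.dvd_or_dvd h2 with h2 | h2
  · have := Int.le_of_dvd (by norm_num) h2
    have : l ≤ 2 := by exact_mod_cast this
    have := hl.two_le
    omega
  · apply hD0
    rw [ZMod.intCast_zmod_eq_zero_iff_dvd]
    have := dvd_sub (dvd_pow h2 two_ne_zero) hk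
    simpa using this

theorem exists_l (h : Hyp η η' q r s Q d d') [IsDedekindDomain (ℤ√d')] {m : ℕ} (hm : Odd m)
    (hz : ∀ z : ClassGroup (ℤ√d'), (z ^ m) ^ 2 = 1) :
    ∃ (l : ℤ) (𝔩 I : Ideal (ℤ√d')) (n : ℕ) (π : ℤ√2) (i j k l' m0 : ℕ) (X Y Z e : ℤ),
      l ≠ 0 ∧ 𝔩 * 𝔩.map (conj d' : ℤ√d' →+* ℤ√d') = Ideal.span {(l : ℤ√d')} ∧
      𝔩 ⊔ 𝔩.map (conj d' : ℤ√d' →+* ℤ√d') = ⊤ ∧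
      (π * conj 2 π = l ∨ π * conj 2 π = -(l : ℤ√2)) ∧
      I ≠ ⊥ ∧ cl 𝔩 ^ m = cl I ∧ I ^ 2 = Ideal.span {(n : ℤ√d')} ∧ n ≠ 0 ∧
      i ≤ 1 ∧ j ≤ 1 ∧ k + l' = 1 ∧ m0 ≠ 0 ∧ n = 2 ^ i * q ^ j * r ^ k * s ^ l' * m0 ^ 2 ∧
      (e = 1 ∨ e = -1) ∧ Z ≠ 0 ∧ (n : ℤ) * l * Z ^ 2 = e * (X ^ 2 - d' * Y ^ 2) := by
  obtain ⟨l, hl, hlb, hl8, hlq, hlr, hls⟩ := h.exists_prime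
  have hFr := Fact.mk h.hr
  have hFs := Fact.mk h.hs
  have hFq := Fact.mk h.hq
  have hFl := Fact.mk hl
  have hr8 := h.hr8
  have hs8 := h.hs8
  have hl0 : (l : ℤ) ≠ 0 := by exact_mod_cast hl.ne_zero
  have hqp := h.hq.pos
  have hrp := h.hr.pos
  have hsp := h.hs.pos
  have hlr' : legendreSym r l = 1 := by rw [leg_congr hlr, legendreSym.at_one]
  have hl2 : legendreSym l 2 = 1 := by
    rw [legendreSym.at_two (by rintro rfl; omega), ZMod.χ₈_nat_eq_if_mod_eight]
    have : l % 2 ≠ 0 := by omega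
    simp [this, hl8]
  have hlQ : legendreSym l q = -1 := by
    rw [← legendreSym.quadratic_reciprocity_one_mod_four (p := l) (q := q) (by omega)
      (by rintro rfl; have := h.hq4; omega), leg_congr hlq,
      legendreSym.at_neg_one (by rintro rfl; have := h.hq4; omega),
      ZMod.χ₄_nat_three_mod_four h.hq4]
  have hlR : legendreSym l r = 1 := by
    rw [← legendreSym.quadratic_reciprocity_one_mod_four (p := l) (q := r) (by omega)
      (by rintro rfl; omega), hlr']
  have hlS : legendreSym l s = -1 := by
    rw [← legendreSym.quadratic_reciprocity_one_mod_four (p := l) (q := s) (by omega)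
      (by rintro rfl; omega), hls]
  have hlη : legendreSym l η' = 1 := by
    rcases h.hη with ⟨-, rfl⟩ | ⟨-, rfl⟩
    · exact hl2
    · simp
  have hld : legendreSym l d' = 1 := by
    rw [h.hd', legendreSym.mul, legendreSym.mul, legendreSym.mul, hlη, hlQ, hlR, hlS]; norm_num
  obtain ⟨k1, hk1, hk1'⟩ := quad_aux hl hl8 (D := d') hld
  obtain ⟨k2, hk2, hk2'⟩ := quad_aux hl hl8 (D := 2) hl2
  obtain ⟨hs1, hs2⟩ := split hk1 hk1'
  obtain ⟨ht1, ht2⟩ := split hk2 hk2'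
  set 𝔩 : Ideal (ℤ√d') := Ideal.span {((l : ℤ) : ℤ√d'), (k1 : ℤ√d') - Zsqrtd.sqrtd} with h𝔩
  set 𝔪 : Ideal (ℤ√2) := Ideal.span {((l : ℤ) : ℤ√2), (k2 : ℤ√2) - Zsqrtd.sqrtd} with h𝔪
  have h𝔩0 : 𝔩 ≠ ⊥ := by
    intro h0
    rw [h0, Ideal.bot_mul, eq_comm, Ideal.span_singleton_eq_bot] at hs1
    exact intCast_ne hl0 hs1
  have := pir2
  obtain ⟨π, hπ⟩ := (IsPrincipalIdealRing.principal 𝔪).principal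
  have hπ' : 𝔪 = Ideal.span {π} := hπ
  have hππ : π * conj 2 π = (l : ℤ) ∨ π * conj 2 π = -((l : ℤ) : ℤ√2) := by
    rw [hπ', Ideal.map_span, Set.image_singleton, Ideal.span_singleton_mul_span_singleton] at ht1
    have e1 : ((π.norm : ℤ) : ℤ√2) = π * conj 2 π := (mul_conj π).symm
    have ht1' : Ideal.span {((π.norm : ℤ) : ℤ√2)} = Ideal.span {((l : ℤ) : ℤ√2)} := by
      rw [e1]; exact ht1
    have a1 := int_dvd (Ideal.mem_span_singleton.1 (ht1' ▸ Ideal.mem_span_singleton_self ((π.norm : ℤ) : ℤ√2)))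
    have a2 := int_dvd (Ideal.mem_span_singleton.1 (ht1'.symm ▸ Ideal.mem_span_singleton_self ((l : ℤ) : ℤ√2)))
    rw [← e1]
    rcases Int.associated_iff.1 (associated_of_dvd_dvd a1 a2) with h3 | h3
    · left; rw [h3]
    · right; rw [h3]; push_cast; rw [neg_neg]
  have hneg : ∀ X Y Z : ℤ, Z ≠ 0 → X ^ 2 - d' * Y ^ 2 = - Z ^ 2 → False :=
    fun _ _ _ => h.no_neg_d'
  obtain ⟨I, hI0, hI, n, hn0, hn⟩ := two_torsion hneg (hz (cl 𝔩))
  obtain ⟨t, rfl⟩ := hm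
  rw [← cl_pow h𝔩0] at hI
  obtain ⟨X, Y, Z, e, he, hZ, hXY⟩ := norm_compare (pow_ne_zero (2 * t + 1) h𝔩0) hI0
    (a := l ^ (2 * t + 1)) (n := n) (by
      rw [Ideal.map_pow, ← mul_pow, hs1, Ideal.span_singleton_pow]; push_cast; rfl)
    (idnorm_sq hn) hI.symm
  obtain ⟨i, j, k, l', m0, hi, hj, hk, hl', hm0, hnn⟩ := h.ram_d' hn0 hn
  have hXY' : (n : ℤ) * l * (l ^ t * Z) ^ 2 = e * (X ^ 2 - d' * Y ^ 2) := by
    rw [← hXY]; push_cast; ring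
  have hZ' : (l : ℤ) ^ t * Z ≠ 0 := mul_ne_zero (pow_ne_zero _ hl0) hZ
  have hm0' : (m0 : ℤ) ≠ 0 := by exact_mod_cast hm0
  have hXY2 : (2 ^ i * q ^ j * r ^ k * s ^ l' * l : ℤ) * (m0 * (l ^ t * Z)) ^ 2 =
      e * (X ^ 2 - d' * Y ^ 2) := by
    rw [← hXY', hnn]; push_cast; ring
  have lr : ¬ (r : ℤ) ∣ l := ndvd h.hr hl (by rintro rfl; omega)
  have ls : ¬ (s : ℤ) ∣ l := ndvd h.hs hl (by rintro rfl; omega)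
  have a1 := h.legd'_r hk lr he (mul_ne_zero hm0' hZ') hXY2
  have a2 := h.legd'_s hl' ls he (mul_ne_zero hm0' hZ') hXY2
  rw [hlr'] at a1
  rw [hls] at a2
  refine ⟨l, 𝔩, I, n, π, i, j, k, l', m0, X, Y, _, e, hl0, hs1, hs2, hππ, hI0, ?_, hn, hn0, hi, hj,
    ?_, hm0, hnn, he, hZ', hXY'⟩
  · rw [hI, cl_pow h𝔩0]
  · generalize (-1 : ℤ) ^ i * ((-1) ^ (η + 1)) ^ j = c at a1 a2
    interval_cases k <;> interval_cases l' <;> simp at a1 a2 ⊢ <;> omega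

/-- No elements of norm `±2`, `±2 * Q` in `ℤ√d`. -/
theorem no_two (h : Hyp η η' q r s Q d d') (x : ℤ√d) (e : ℕ) (he : e ≤ 1) :
    x.norm.natAbs ≠ 2 * (Q ^ e).natAbs := by
  intro hx
  have hFr := Fact.mk h.hr
  have hQ := h.Q_pos
  have : 2 * Q ^ e = x.norm ∨ 2 * Q ^ e = - x.norm := by
    have : (0 : ℤ) < Q ^ e := by positivity
    omega
  obtain ⟨ε, hε, hε2⟩ : ∃ ε : ℤ, (ε = 1 ∨ ε = -1) ∧ 2 * Q ^ e = ε * (x.re ^ 2 - d * x.im ^ 2) := by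
    rcases this with h1 | h1
    · exact ⟨1, Or.inl rfl, by rw [h1, norm_expl]; ring⟩
    · exact ⟨-1, Or.inr rfl, by rw [h1, norm_expl]; ring⟩
  have hQ2 := h.hQ
  have key : ∀ i j : ℕ, ∀ Z : ℤ, Z ≠ 0 → 2 * Q ^ e = 2 ^ i * q ^ j * Z ^ 2 →
      (-1 : ℤ) ^ i * ((-1) ^ (η + 1)) ^ j = 1 := by
    intro i j Z hZ hij
    have := h.legd_r (i := i) (j := j) (k := 0) (l := 0) (c := 1) (Nat.zero_le 1)
      h.rprime.not_dvd_one hε hZ (by rw [← hε2, hij]; ring)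
    rwa [legendreSym.at_one, mul_one] at this
  rcases h.hη with ⟨rfl, rfl⟩ | ⟨rfl, rfl⟩ <;> interval_cases e
  · have := key 1 0 1 one_ne_zero (by ring)
    norm_num at this
  · have := key 1 1 1 one_ne_zero (by rw [hQ2]; push_cast; ring)
    norm_num at this
  · have := key 1 0 1 one_ne_zero (by ring)
    norm_num at this
  · have := key 0 1 2 two_ne_zero (by rw [hQ2]; push_cast; ring)
    norm_num at this

end Hyp


open Zs

set_option linter.unusedSectionVars false

/-- The biquadratic ring `B` over its three quadratic subrings. -/
structure Core (d d' : ℤ) (B : Type) [CommRing B] where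
  σ : B ≃+* B
  τ : B ≃+* B
  jA : ℤ√d →+* B
  jD : ℤ√d' →+* B
  j1 : ℤ√2 →+* B
  ι : B →+* ℝ
  P : Ideal B
  σσ : ∀ x, σ (σ x) = x
  ττ : ∀ x, τ (τ x) = x
  στ : ∀ x, σ (τ x) = τ (σ x)
  iA : Function.Injective jA
  iD : Function.Injective jD
  i1 : Function.Injective j1
  σA : ∀ a, σ (jA a) = jA a
  τA : ∀ a, τ (jA a) = jA (conj d a)
  σD : ∀ a, σ (jD a) = jD (conj d' a)
  τD : ∀ a, τ (jD a) = jD (conj d' a)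
  σ1 : ∀ a, σ (j1 a) = j1 (conj 2 a)
  τ1 : ∀ a, τ (j1 a) = j1 a
  fA : ∀ x, σ x = x → ∃ a, jA a = x
  f1 : ∀ x, τ x = x → ∃ a, j1 a = x
  fD : ∀ x, σ (τ x) = x → ∃ a, jD a = x
  P2 : P ^ 2 = Ideal.span {j1 Zsqrtd.sqrtd}
  Pp : P.IsPrime

namespace Core

variable {d d' : ℤ} {B : Type} [CommRing B] [IsDedekindDomain B]

/-- `√2`. -/
def ω (c : Core d d' B) : B := c.j1 Zsqrtd.sqrtd

/-- The third involution. -/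
def ρ (c : Core d d' B) : B ≃+* B := c.τ.trans c.σ

theorem ρ_apply (c : Core d d' B) (x : B) : c.ρ x = c.σ (c.τ x) := rfl

theorem ρρ (c : Core d d' B) (x : B) : c.ρ (c.ρ x) = x := by
  rw [ρ_apply, ρ_apply, ← c.στ, c.ττ, c.σσ]

theorem ω_sq (c : Core d d' B) : c.ω ^ 2 = 2 := by
  rw [ω, ← map_pow, sqrtd_sq, map_intCast]; simp

theorem σω (c : Core d d' B) : c.σ c.ω = - c.ω := by
  rw [ω, c.σ1, ← map_neg]
  congr 1

theorem intCast_ne (c : Core d d' B) {n : ℤ} (hn : n ≠ 0) : (n : B) ≠ 0 := by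
  intro h
  have := congrArg c.ι h
  rw [map_intCast, map_zero] at this
  exact hn (by exact_mod_cast this)

theorem two_ne (c : Core d d' B) : (2 : B) ≠ 0 := by
  have := c.intCast_ne (n := 2) (by norm_num)
  exact_mod_cast this

theorem ω_ne (c : Core d d' B) : c.ω ≠ 0 := by
  intro h
  have := c.ω_sq
  rw [h, zero_pow two_ne_zero] at this
  exact c.two_ne this.symm

theorem two_cancel (c : Core d d' B) {x : B} (h : x + x = 0) : x = 0 := by
  have : 2 * x = 0 := by rw [two_mul, h]
  exact (mul_eq_zero.1 this).resolve_left c.two_ne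

theorem conj_neg_eq {D : ℤ} {a : ℤ√D} (h : conj D a = - a) : a = (a.im : ℤ√D) * Zsqrtd.sqrtd := by
  have := congrArg Zsqrtd.re h
  rw [conj_apply] at this
  simp at this
  ext
  · simp; omega
  · simp

/-- Squares of elements of `B` that are rational integers. -/
theorem sq_int (c : Core d d' B) {x : B} {n : ℤ} (h : x ^ 2 = n) :
    ∃ m : ℤ, n = m ^ 2 ∨ n = 2 * m ^ 2 ∨ n = d * m ^ 2 ∨ n = d' * m ^ 2 := by
  have cast : ∀ m k : ℤ, (m : B) = k → m = k := by
    intro m k hmk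
    by_contra hne
    exact c.intCast_ne (sub_ne_zero.2 hne) (by push_cast; rw [hmk, sub_self])
  have key : ∀ f : B ≃+* B, f x = x ∨ f x = - x := by
    intro f
    rw [← sq_eq_sq_iff_eq_or_eq_neg, ← map_pow, h, map_intCast]
  rcases key c.σ with h1 | h1 <;> rcases key c.τ with h2 | h2
  · obtain ⟨a, rfl⟩ := c.fA x h1
    rw [c.τA] at h2
    have := conj_fix _ (c.iA h2)
    obtain ⟨m, rfl⟩ := this
    refine ⟨m, Or.inl (cast _ _ ?_)⟩
    rw [← h]; push_cast; simp
  · obtain ⟨a, rfl⟩ := c.fA x h1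
    rw [c.τA, ← map_neg] at h2
    have := conj_neg_eq (c.iA h2)
    refine ⟨a.im, Or.inr (Or.inr (Or.inl (cast _ _ ?_)))⟩
    rw [← h, this, map_mul, mul_pow, ← map_pow _ Zsqrtd.sqrtd, sqrtd_sq]
    push_cast; simp; ring
  · obtain ⟨a, rfl⟩ := c.f1 x h2
    rw [c.σ1, ← map_neg] at h1
    have := conj_neg_eq (c.i1 h1)
    refine ⟨a.im, Or.inr (Or.inl (cast _ _ ?_))⟩
    rw [← h, this, map_mul, mul_pow, ← map_pow _ Zsqrtd.sqrtd, sqrtd_sq]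
    push_cast; simp [map_ofNat c.j1 2]; ring
  · obtain ⟨a, rfl⟩ := c.fD x (by rw [h2, map_neg, h1, neg_neg])
    rw [c.σD, ← map_neg] at h1
    have := conj_neg_eq (c.iD h1)
    refine ⟨a.im, Or.inr (Or.inr (Or.inr (cast _ _ ?_)))⟩
    rw [← h, this, map_mul, mul_pow, ← map_pow _ Zsqrtd.sqrtd, sqrtd_sq]
    push_cast; simp; ring

/-- Integers which cannot become squares in `B`. -/
def Good (d d' N : ℤ) : Prop :=
  0 < N ∧ ∃ p x M : ℤ, Prime p ∧ ¬ p ∣ 2 ∧ N = p * M ∧ ¬ p ∣ M ∧ x ∣ d ∧ x ∣ d' ∧ ¬ x ∣ N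

theorem not_sq_of_good (c : Core d d' B) {N : ℤ} (hN : Good d d' N) (x : B) : x ^ 2 ≠ N := by
  intro h
  obtain ⟨hN0, p, y, M, hp, hp2, hNM, hpM, hyd, hyd', hyN⟩ := hN
  have h2 : ∀ m e : ℤ, ¬ p ∣ e → N = e * m ^ 2 → False := by
    intro m e he hm
    have h1 : p ∣ e * m ^ 2 := by rw [← hm, hNM]; exact dvd_mul_right _ _
    have h1 := hp.dvd_of_dvd_pow ((hp.dvd_or_dvd h1).resolve_left he)
    obtain ⟨k, rfl⟩ := h1
    apply hpM
    refine ⟨e * k ^ 2, ?_⟩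
    apply mul_left_cancel₀ hp.ne_zero
    rw [← hNM, hm]; ring
  obtain ⟨m, hm | hm | hm | hm⟩ := c.sq_int h
  · exact h2 m 1 hp.not_dvd_one (by rw [hm]; ring)
  · exact h2 m 2 hp2 hm
  · exact hyN (hm ▸ (dvd_mul_of_dvd_left hyd _))
  · exact hyN (hm ▸ (dvd_mul_of_dvd_left hyd' _))

/-- The unit `1+√2` of `B`. -/
def E1 (c : Core d d' B) : Bˣ := Units.map (c.j1 : ℤ√2 →* B) E2

theorem τE1 (c : Core d d' B) : c.τ c.E1 = c.E1 := c.τ1 _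

theorem σE1 (c : Core d d' B) : c.E1 * c.σ c.E1 = -1 := by
  change c.j1 E2 * c.σ (c.j1 E2) = -1
  rw [c.σ1, ← map_mul, mul_conj]
  have : (E2 : ℤ√2).norm = -1 := by
    rw [norm_expl]; simp [E2]
  rw [this]; simp

/-- A unit fixed by `τ` is `± E1^k`. -/
theorem unit_τ (c : Core d d' B) {u : Bˣ} (h : c.τ u = u) : ∃ k : ℤ, u = c.E1 ^ k ∨ u = - c.E1 ^ k := by
  obtain ⟨a, ha⟩ := c.f1 _ h
  obtain ⟨b, hb⟩ := c.f1 ((u⁻¹ : Bˣ) : B) (by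
    have h1 : (u : B) * (u⁻¹ : Bˣ) = 1 := u.mul_inv
    have h2 := congrArg c.τ h1
    rw [map_mul, h, map_one] at h2
    calc c.τ (u⁻¹ : Bˣ) = (u⁻¹ : Bˣ) * (u * c.τ (u⁻¹ : Bˣ)) := by rw [← mul_assoc, u.inv_mul, one_mul]
      _ = _ := by rw [h2, mul_one])
  have hab : a * b = 1 := c.i1 (by rw [map_mul, ha, hb, u.mul_inv, map_one])
  let v : (ℤ√2)ˣ := ⟨a, b, hab, by rw [mul_comm, hab]⟩
  have hv : Units.map (c.j1 : ℤ√2 →* B) v = u := Units.ext ha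
  obtain ⟨k, hk | hk⟩ := units2 v
  · exact ⟨k, Or.inl (by rw [← hv, hk, map_zpow]; rfl)⟩
  · refine ⟨k, Or.inr ?_⟩
    rw [← hv, hk]
    ext
    simp [E1]

theorem unit_A (c : Core d d' B) {u : Bˣ} (h : c.σ u = u) :
    ∃ v : (ℤ√d)ˣ, Units.map (c.jA : ℤ√d →* B) v = u := by
  obtain ⟨a, ha⟩ := c.fA _ h
  obtain ⟨b, hb⟩ := c.fA ((u⁻¹ : Bˣ) : B) (by
    have h1 : (u : B) * (u⁻¹ : Bˣ) = 1 := u.mul_inv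
    have h2 := congrArg c.σ h1
    rw [map_mul, h, map_one] at h2
    calc c.σ (u⁻¹ : Bˣ) = (u⁻¹ : Bˣ) * (u * c.σ (u⁻¹ : Bˣ)) := by rw [← mul_assoc, u.inv_mul, one_mul]
      _ = _ := by rw [h2, mul_one])
  have hab : a * b = 1 := c.iA (by rw [map_mul, ha, hb, u.mul_inv, map_one])
  exact ⟨⟨a, b, hab, by rw [mul_comm, hab]⟩, Units.ext ha⟩

theorem unit_D (c : Core d d' B) {u : Bˣ} (h : c.ρ u = u) :
    ∃ v : (ℤ√d')ˣ, Units.map (c.jD : ℤ√d' →* B) v = u := by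
  obtain ⟨a, ha⟩ := c.fD _ h
  obtain ⟨b, hb⟩ := c.fD ((u⁻¹ : Bˣ) : B) (by
    have h1 : (u : B) * (u⁻¹ : Bˣ) = 1 := u.mul_inv
    have h2 := congrArg c.ρ h1
    rw [map_mul, h, map_one] at h2
    calc c.ρ (u⁻¹ : Bˣ) = (u⁻¹ : Bˣ) * (u * c.ρ (u⁻¹ : Bˣ)) := by rw [← mul_assoc, u.inv_mul, one_mul]
      _ = _ := by rw [h2, mul_one])
  have hab : a * b = 1 := c.iD (by rw [map_mul, ha, hb, u.mul_inv, map_one])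
  exact ⟨⟨a, b, hab, by rw [mul_comm, hab]⟩, Units.ext ha⟩

/-- `c.s u = σ u` on units. -/
def sU (c : Core d d' B) : Bˣ →* Bˣ := Units.map (c.σ : B →* B)

theorem sU_val (c : Core d d' B) (u : Bˣ) : (c.sU u : B) = c.σ u := rfl

theorem sE1 (c : Core d d' B) : c.E1 * c.sU c.E1 = -1 := Units.ext c.σE1

theorem sE1_zpow (c : Core d d' B) (k : ℤ) : c.E1 ^ k * c.sU (c.E1 ^ k) = (-1) ^ k := by
  rw [map_zpow, ← mul_zpow, c.sE1]

theorem sq_nonneg' (c : Core d d' B) (x : B) : 0 ≤ c.ι (x ^ 2) := by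
  rw [map_pow]; positivity

theorem neg_one_ne (c : Core d d' B) : (-1 : Bˣ) ≠ 1 := by
  intro h
  have := congrArg (fun u : Bˣ => c.ι u) h
  simp at this
  norm_num at this

/-- if `y² = N w`, `w` a unit fixed by `τ`, then `N` is a square. -/
theorem NS (c : Core d d' B) {N : ℤ} (hN : Good d d' N) {w : Bˣ} (hw : c.τ w = w) {y : B}
    (h : y ^ 2 = N * w) : False := by
  have hN0 : (0 : ℝ) < N := by exact_mod_cast hN.1
  obtain ⟨k, hk⟩ := c.unit_τ hw
  rcases Int.even_or_odd k with ⟨t, ht⟩ | ⟨t, ht⟩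
  · have h1 : (y * (c.E1 ^ (-t) : Bˣ)) ^ 2 = N * ((c.E1 ^ (-t) * c.E1 ^ (-t) * w : Bˣ) : B) := by
      rw [mul_pow, h]; push_cast; ring
    rcases hk with hk | hk
    · rw [hk, ht, ← zpow_add, ← zpow_add] at h1
      simp at h1
      exact c.not_sq_of_good hN _ h1
    · rw [hk, ht, mul_neg, ← zpow_add, ← zpow_add] at h1
      simp at h1
      have h2 := congrArg c.ι h1
      rw [map_neg, map_intCast] at h2
      have := c.sq_nonneg' (y * (c.E1 ^ t : Bˣ)⁻¹)
      simp at this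
      simp at h2
      linarith
  · have h1 : (y * c.σ y) ^ 2 = N ^ 2 * ((w * c.sU w : Bˣ) : B) := by
      rw [mul_pow, ← map_pow, h, map_mul, map_intCast]; push_cast [sU_val]; ring
    have h2 : w * c.sU w = -1 := by
      have e : (-1 : Bˣ) ^ k = -1 := by
        rw [ht]; exact Odd.neg_one_zpow ⟨t, rfl⟩
      rcases hk with hk | hk
      · rw [hk, c.sE1_zpow, e]
      · have : c.sU (-1) = -1 := by ext; simp [sU_val]
        rw [hk, neg_eq_neg_one_mul, map_mul, this, mul_mul_mul_comm, c.sE1_zpow, e]; simp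
    rw [h2] at h1
    have h3 := congrArg c.ι h1
    have := c.sq_nonneg' (y * c.σ y)
    rw [h3] at this
    simp at this
    rw [this] at hN0
    simp at hN0

end Core


open Zs

set_option linter.unusedSectionVars false

namespace Core

variable {d d' : ℤ} {B : Type} [CommRing B] [IsDedekindDomain B]

/-- Arithmetic data in `B`. -/
structure Ar (c : Core d d' B) (Q r s : ℤ) (E : Bˣ) (α : B) : Prop where
  hα : α ^ 2 = Q * E
  hασ : α * c.σ α = Q ∨ α * c.σ α = -Q
  units : ∀ u : Bˣ, c.ρ u = u → ∃ k : ℤ, u = E ^ k ∨ u = - E ^ k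
  hE : E * c.sU E = 1
  normA : ∀ u : Bˣ, c.σ u = u → (u : B) * c.τ u = 1
  gQ : Good d d' Q
  gr : Good d d' r
  gs : Good d d' s
  gQr : Good d d' (Q * r)
  gQs : Good d d' (Q * s)
  hd : d = Q * r * s

theorem pm_mul {R : Type} [Monoid R] [HasDistribNeg R] {x y x' y' : R} (h : x = y ∨ x = -y)
    (h' : x' = y' ∨ x' = -y') : x * x' = y * y' ∨ x * x' = -(y * y') := by
  rcases h with rfl | rfl <;> rcases h' with rfl | rfl <;> simp

theorem pm_one {R : Type} [Group R] [HasDistribNeg R] (k : ℤ) :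
    (-1 : R) ^ k = 1 ∨ (-1 : R) ^ k = -1 := by
  rcases Int.even_or_odd k with h | h
  · left; exact Even.neg_one_zpow h
  · right; exact Odd.neg_one_zpow h

/-- `τ` on units. -/
def tU (c : Core d d' B) : Bˣ →* Bˣ := Units.map (c.τ : B →* B)

theorem tU_val (c : Core d d' B) (u : Bˣ) : (c.tU u : B) = c.τ u := rfl

theorem tU_tU (c : Core d d' B) (u : Bˣ) : c.tU (c.tU u) = u := Units.ext (c.ττ u)

theorem sU_sU (c : Core d d' B) (u : Bˣ) : c.sU (c.sU u) = u := Units.ext (c.σσ u)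

theorem sU_tU (c : Core d d' B) (u : Bˣ) : c.sU (c.tU u) = c.tU (c.sU u) := Units.ext (c.στ u)

theorem sU_neg (c : Core d d' B) (u : Bˣ) : c.sU (-u) = - c.sU u := by
  ext; simp [sU_val]

theorem tU_neg (c : Core d d' B) (u : Bˣ) : c.tU (-u) = - c.tU u := by
  ext; simp [tU_val]

theorem sU_E1 (c : Core d d' B) (m : ℤ) :
    (c.E1 ^ m) ^ 2 * c.sU (c.E1 ^ m) = c.E1 ^ m ∨ (c.E1 ^ m) ^ 2 * c.sU (c.E1 ^ m) = - c.E1 ^ m := by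
  rw [sq, mul_assoc, c.sE1_zpow]
  rcases pm_one (R := Bˣ) m with h | h <;> rw [h] <;> simp

theorem neg_one_zpow_eq (c : Core d d' B) {k : ℤ} (h : (-1 : Bˣ) ^ k = 1) : Even k := by
  by_contra h1
  rw [Int.not_even_iff_odd] at h1
  rw [Odd.neg_one_zpow h1] at h
  exact c.neg_one_ne h

theorem unit_sq_ne (c : Core d d' B) (u : Bˣ) : u ^ 2 ≠ -1 := by
  intro h
  have h1 := congrArg (fun v : Bˣ => c.ι v) h
  have h2 := c.sq_nonneg' (u : B)
  simp at h1 h2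
  rw [h1] at h2
  norm_num at h2

namespace Ar

variable {c : Core d d' B} {Q r s : ℤ} {E : Bˣ} {α : B}

theorem hE_zpow (A : Ar c Q r s E α) (k : ℤ) : E ^ k * c.sU (E ^ k) = 1 := by
  rw [map_zpow, ← mul_zpow, A.hE, one_zpow]

theorem Q_ne (A : Ar c Q r s E α) : (Q : B) ≠ 0 := c.intCast_ne A.gQ.1.ne'

theorem α_ne (A : Ar c Q r s E α) : α ≠ 0 := by
  intro h0
  have := A.hα
  rw [h0, zero_pow two_ne_zero] at this
  exact mul_ne_zero A.Q_ne E.ne_zero this.symm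

theorem Eα (A : Ar c Q r s E α) : (E : B) * c.σ α = α ∨ (E : B) * c.σ α = - α := by
  rcases A.hασ with h | h
  · left
    apply mul_left_cancel₀ A.α_ne
    rw [mul_left_comm, h, ← sq, A.hα]; ring
  · right
    apply mul_left_cancel₀ A.α_ne
    rw [mul_left_comm, h, mul_neg, mul_neg, ← sq, A.hα]; ring

/-- Hilbert 90 for units. -/
theorem H1 (A : Ar c Q r s E α) {u : Bˣ} (hu : u * c.sU u = 1) :
    ∃ (w : Bˣ) (i j : ℕ), i ≤ 1 ∧ j ≤ 1 ∧
      (w * α ^ i * c.ω ^ j : B) = u * c.σ (w * α ^ i * c.ω ^ j) := by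
  set v1 := u * c.tU u with hv1
  set v' := u * c.sU (c.tU u) with hv'
  have h1 : c.tU v1 = v1 := by rw [hv1, map_mul, tU_tU, mul_comm]
  have h2 : c.sU (c.tU v') = v' := by
    rw [hv', map_mul, map_mul, ← sU_tU, tU_tU, sU_sU, mul_comm]
  have hN : c.tU u * c.sU (c.tU u) = 1 := by
    rw [sU_tU, ← map_mul, hu, map_one]
  have huu : u ^ 2 = v1 * v' := by
    rw [hv1, hv', mul_mul_mul_comm, hN, mul_one, sq]
  have hn1 : v1 * c.sU v1 = 1 := by
    rw [hv1, map_mul, mul_mul_mul_comm, hu, hN, one_mul]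
  obtain ⟨k', hk'⟩ := A.units v' (congrArg Units.val h2)
  obtain ⟨k, hk⟩ := c.unit_τ (congrArg Units.val h1)
  rcases Int.even_or_odd k' with ⟨t, ht⟩ | ⟨t, ht⟩
  swap
  · exfalso
    have key : ∀ w : Bˣ, u ^ 2 = w * E ^ k' → c.tU w = w → False := by
      intro w hw hww
      refine c.NS A.gQ (w := w) (congrArg Units.val hww) (y := u * α * (E ^ (-t - 1) : Bˣ)) ?_
      have : u ^ 2 * E * (E ^ (-t - 1)) ^ 2 = w := by
        rw [hw, ht, mul_assoc, mul_assoc, ← zpow_natCast (E ^ (-t - 1)), ← zpow_mul, ← zpow_one_add, ← zpow_add]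
        have : 2 * t + 1 + (1 + (-t - 1) * (2 : ℕ)) = 0 := by push_cast; ring
        rw [this, zpow_zero, mul_one]
      rw [mul_pow, mul_pow, A.hα, ← this]; push_cast; ring
    rcases hk' with hk' | hk'
    · exact key v1 (by rw [huu, hk']) h1
    · exact key (-v1) (by rw [huu, hk']; simp) (by rw [tU_neg, h1])
  have hke : Even k := by
    apply c.neg_one_zpow_eq
    rw [← c.sE1_zpow]
    rcases hk with hk | hk
    · rw [← hk, hn1]
    · rw [hk, sU_neg, neg_mul_neg] at hn1; exact hn1
  obtain ⟨m, hm⟩ := hke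
  have hu2 : u ^ 2 = (c.E1 ^ m * E ^ t) ^ 2 ∨ u ^ 2 = - (c.E1 ^ m * E ^ t) ^ 2 := by
    rw [huu]
    have := pm_mul hk hk'
    rw [hm, ht, zpow_add, zpow_add, mul_mul_mul_comm (c.E1 ^ m), ← sq] at this
    exact this
  have hu3 : u = c.E1 ^ m * E ^ t ∨ u = - (c.E1 ^ m * E ^ t) := by
    rcases hu2 with h | h
    · have h3 := congrArg Units.val h
      push_cast at h3
      rcases sq_eq_sq_iff_eq_or_eq_neg.1 h3 with h4 | h4
      · left; ext; push_cast; exact h4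
      · right; ext; push_cast; exact h4
    · exfalso
      apply c.unit_sq_ne (u * (c.E1 ^ m * E ^ t)⁻¹)
      rw [mul_pow, h, neg_mul, ← mul_pow]; simp
  have hme : Even m := by
    apply c.neg_one_zpow_eq
    rw [← c.sE1_zpow]
    have : (c.E1 ^ m * E ^ t) * c.sU (c.E1 ^ m * E ^ t) = 1 := by
      rcases hu3 with h | h
      · rw [← h, hu]
      · rw [h, sU_neg, neg_mul_neg] at hu; exact hu
    rwa [map_mul, mul_mul_mul_comm, A.hE_zpow, mul_one] at this
  obtain ⟨m', hm'⟩ := hme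
  obtain ⟨n, i, hi, hni⟩ : ∃ (n : ℤ) (i : ℕ), i ≤ 1 ∧ t = n + n + i := by
    rcases Int.even_or_odd t with ⟨n, hn⟩ | ⟨n, hn⟩
    · exact ⟨n, 0, by norm_num, by simpa using hn⟩
    · exact ⟨n, 1, le_rfl, by push_cast; omega⟩
  have e1 : ((c.E1 ^ m' : Bˣ) : B) ^ 2 * c.σ (c.E1 ^ m' : Bˣ) = (c.E1 ^ m' : Bˣ) ∨
      ((c.E1 ^ m' : Bˣ) : B) ^ 2 * c.σ (c.E1 ^ m' : Bˣ) = - (c.E1 ^ m' : Bˣ) := by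
    rcases c.sU_E1 m' with h | h
    · left; have := congrArg Units.val h; push_cast [sU_val] at this ⊢; exact this
    · right; have := congrArg Units.val h; push_cast [sU_val] at this ⊢; exact this
  have e2 : ((E ^ n : Bˣ) : B) ^ 2 * c.σ (E ^ n : Bˣ) = (E ^ n : Bˣ) := by
    have := congrArg Units.val (A.hE_zpow n)
    push_cast [sU_val] at this ⊢
    rw [sq, mul_assoc, this, mul_one]
  have e3 : (E : B) ^ i * c.σ (α ^ i) = α ^ i ∨ (E : B) ^ i * c.σ (α ^ i) = - α ^ i := by
    interval_cases i
    · left; simp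
    · simpa using A.Eα
  have e4 : (u : B) = ((c.E1 ^ m' : Bˣ) : B) ^ 2 * ((E ^ n : Bˣ) : B) ^ 2 * (E : B) ^ i ∨
      (u : B) = - (((c.E1 ^ m' : Bˣ) : B) ^ 2 * ((E ^ n : Bˣ) : B) ^ 2 * (E : B) ^ i) := by
    have : c.E1 ^ m * E ^ t = (c.E1 ^ m') ^ 2 * (E ^ n) ^ 2 * E ^ i := by
      rw [hm', hni, zpow_add, zpow_add, zpow_add, zpow_natCast, sq, sq]
      simp only [mul_assoc]
    rw [this] at hu3
    rcases hu3 with h | h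
    · left; rw [h]; push_cast; ring
    · right; rw [h]; push_cast; ring
  set C0 : B := ((c.E1 ^ m' * E ^ n : Bˣ) : B) * α ^ i with hC0
  have e5 : (u : B) * c.σ C0 = C0 ∨ (u : B) * c.σ C0 = - C0 := by
    have e6 := pm_mul (pm_mul e1 (Or.inl e2 : _ ∨ _ = - ((E ^ n : Bˣ) : B))) e3
    have e7 : c.σ C0 = c.σ (c.E1 ^ m' : Bˣ) * c.σ (E ^ n : Bˣ) * c.σ (α ^ i) := by
      rw [hC0, Units.val_mul, map_mul, map_mul]
    have e8 : C0 = ((c.E1 ^ m' : Bˣ) : B) * ((E ^ n : Bˣ) : B) * α ^ i := by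
      rw [hC0, Units.val_mul]
    rw [← e8] at e6
    rcases e4 with h | h <;> rcases e6 with h' | h'
    · left; rw [h, e7]; linear_combination h'
    · right; rw [h, e7]; linear_combination h'
    · right; rw [h, e7]; linear_combination - h'
    · left; rw [h, e7]; linear_combination - h'
  rcases e5 with h | h
  · exact ⟨c.E1 ^ m' * E ^ n, i, 0, hi, by norm_num, by rw [pow_zero, mul_one]; exact h.symm⟩
  · refine ⟨c.E1 ^ m' * E ^ n, i, 1, hi, le_rfl, ?_⟩
    rw [pow_one, map_mul, c.σω, ← hC0, mul_neg, mul_neg, ← mul_assoc, h]; ring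

/-- `y² = N w E^k` is impossible for `N ∈ {r, s}`. -/
theorem NSL (A : Ar c Q r s E α) {N : ℤ} (h1 : Good d d' N) (h2 : Good d d' (Q * N)) {w : Bˣ}
    (hw : c.tU w = w) {k : ℤ} {y : B} (h : y ^ 2 = N * ((w * E ^ k : Bˣ) : B)) : False := by
  rcases Int.even_or_odd k with ⟨t, ht⟩ | ⟨t, ht⟩
  · refine c.NS h1 (w := w) (congrArg Units.val hw) (y := y * (E ^ (-t) : Bˣ)) ?_
    have : w * E ^ k * (E ^ (-t)) ^ 2 = w := by
      rw [ht, mul_assoc, ← zpow_natCast, ← zpow_mul, ← zpow_add]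
      have : t + t + -t * (2 : ℕ) = 0 := by push_cast; ring
      rw [this, zpow_zero, mul_one]
    rw [mul_pow, h, ← Units.val_pow_eq_pow_val, mul_assoc, ← Units.val_mul, this]
  · refine c.NS h2 (w := w) (congrArg Units.val hw) (y := y * α * (E ^ (-t - 1) : Bˣ)) ?_
    have : w * E ^ k * E * (E ^ (-t - 1)) ^ 2 = w := by
      rw [ht, mul_assoc, mul_assoc, ← zpow_natCast (E ^ (-t - 1)), ← zpow_mul, ← zpow_one_add,
        ← zpow_add]
      have : 2 * t + 1 + (1 + (-t - 1) * (2 : ℕ)) = 0 := by push_cast; ring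
      rw [this, zpow_zero, mul_one]
    rw [mul_pow, mul_pow, A.hα, h, ← Units.val_pow_eq_pow_val]
    calc _ = (Q * N : B) * ((w * E ^ k * E * (E ^ (-t - 1)) ^ 2 : Bˣ) : B) := by
          push_cast; ring
      _ = _ := by rw [this]; push_cast; ring

end Ar

end Core


open Zs

set_option linter.unusedSectionVars false

/-- `H ∪ p⁻¹H` for `p² ∈ H`. -/
def dbl {G : Type} [CommGroup G] (H : Subgroup G) (p : G) (hp : p * p ∈ H) : Subgroup G where
  carrier := {c | c ∈ H ∨ p * c ∈ H}
  one_mem' := Or.inl H.one_mem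
  mul_mem' := by
    rintro a b (ha | ha) (hb | hb)
    · exact Or.inl (H.mul_mem ha hb)
    · right
      have := H.mul_mem ha hb
      rwa [mul_left_comm] at this
    · right
      have := H.mul_mem ha hb
      rwa [mul_assoc] at this
    · left
      have := H.mul_mem (H.inv_mem hp) (H.mul_mem ha hb)
      rwa [show (p * p)⁻¹ * (p * a * (p * b)) = a * b by
        rw [mul_mul_mul_comm, inv_mul_cancel_left]] at this
  inv_mem' := by
    rintro a (ha | ha)
    · exact Or.inl (H.inv_mem ha)
    · right
      have := H.mul_mem hp (H.inv_mem ha)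
      rwa [show p * p * (p * a)⁻¹ = p * a⁻¹ by rw [mul_inv]; group] at this

theorem mem_dbl {G : Type} [CommGroup G] {H : Subgroup G} {p : G} {hp : p * p ∈ H} {c : G} :
    c ∈ dbl H p hp ↔ c ∈ H ∨ p * c ∈ H := Iff.rfl

theorem card_dbl {G : Type} [CommGroup G] [Finite G] (H A : Subgroup G) (p : G) (hp : p ∉ H)
    (hA : ∀ c, c ∈ A ↔ c ∈ H ∨ p * c ∈ H) : Nat.card A = 2 * Nat.card H := by
  have hle : H ≤ A := fun x hx => (hA x).2 (Or.inl hx)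
  have hpA : p⁻¹ ∈ A := (hA _).2 (Or.inr (by simp))
  have hpA : p ∈ A := by simpa using A.inv_mem hpA
  have h2 : p * p ∈ H := ((hA p).1 hpA).resolve_left hp
  have : H.relIndex A = 2 := by
    rw [Subgroup.relIndex_eq_two_iff]
    refine ⟨p, hpA, ?_⟩
    intro b hb
    rw [xor_iff_or_and_not_and]
    refine ⟨?_, ?_⟩
    · rw [mul_comm b p]; exact ((hA b).1 hb).symm
    · rintro ⟨h3, h4⟩
      exact hp (by simpa using H.mul_mem (H.inv_mem h4) h3)
  rw [← this, mul_comm, ← Subgroup.card_mul_index (H.subgroupOf A)]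
  rw [Subgroup.relIndex, Nat.card_congr (Subgroup.subgroupOfEquivOfLe hle).toEquiv]

namespace Core

variable {d d' : ℤ} {B : Type} [CommRing B] [IsDedekindDomain B]

theorem P_ne (c : Core d d' B) : c.P ≠ ⊥ := by
  intro h
  have := c.P2
  rw [h] at this
  have h2 : Ideal.span {c.ω} = ⊥ := by
    rw [ω, ← this, Ideal.bot_pow two_ne_zero]
  rw [Ideal.span_singleton_eq_bot] at h2
  exact c.ω_ne h2

theorem P2' (c : Core d d' B) : c.P ^ 2 = Ideal.span {c.ω} := c.P2

theorem P4 (c : Core d d' B) : c.P ^ 4 = Ideal.span {(2 : B)} := by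
  rw [show 4 = 2 * 2 from rfl, pow_mul, c.P2', Ideal.span_singleton_pow, c.ω_sq]

theorem P6 (c : Core d d' B) : c.P ^ 6 = Ideal.span {2 * c.ω} := by
  rw [show 6 = 4 + 2 from rfl, pow_add, c.P4, c.P2', Ideal.span_singleton_mul_span_singleton]

theorem map_span1 {R S : Type} [CommRing R] [CommRing S] (f : R →+* S) (x : R) :
    (Ideal.span {x}).map f = Ideal.span {f x} := by
  rw [Ideal.map_span, Set.image_singleton]

theorem map_span_e (f : B ≃+* B) (x : B) :
    (Ideal.span {x}).map (f : B →+* B) = Ideal.span {f x} := by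
  rw [Ideal.map_span, Set.image_singleton]; rfl

theorem σP (c : Core d d' B) : c.P.map (c.σ : B →+* B) = c.P := by
  apply ideal_sq_inj
  rw [← Ideal.map_pow, c.P2', map_span_e, c.σω, Ideal.span_singleton_neg]

theorem σmapA (c : Core d d' B) (J : Ideal (ℤ√d)) :
    (J.map c.jA).map (c.σ : B →+* B) = J.map c.jA := by
  rw [Ideal.map_map]
  congr 1
  exact RingHom.ext c.σA

theorem inv_ideal (c : Core d d' B) {I : Ideal B} (hI : I ≠ ⊥)
    (hinv : I.map (c.σ : B →+* B) = I) :
    ∃ (J : Ideal (ℤ√d)) (k : ℕ), J ≠ ⊥ ∧ J.map c.jA = I * c.P ^ k := by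
  set J := I.comap c.jA with hJ
  have hJI : J.map c.jA ≤ I := Ideal.map_comap_le
  have hσ : ∀ x ∈ I, c.σ x ∈ I := by
    intro x hx
    have := Ideal.mem_map_of_mem (c.σ : B →+* B) hx
    rwa [hinv] at this
  have hF : ∀ x ∈ I, c.σ x = x → x ∈ J.map c.jA := by
    intro x hx h
    obtain ⟨a, rfl⟩ := c.fA x h
    exact Ideal.mem_map_of_mem _ hx
  have h1 : Ideal.span {2 * c.ω} * I ≤ J.map c.jA := by
    rw [Ideal.span_singleton_mul_le_iff]
    intro x hx
    have e1 := hF (x + c.σ x) (add_mem hx (hσ x hx)) (by rw [map_add, c.σσ, add_comm])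
    have e2 := hF (c.ω * (x - c.σ x)) (Ideal.mul_mem_left _ _ (sub_mem hx (hσ x hx)))
      (by rw [map_mul, map_sub, c.σσ, c.σω]; ring)
    have := add_mem (Ideal.mul_mem_left _ c.ω e1) e2
    convert this using 1
    ring
  obtain ⟨K, hK⟩ : I ∣ J.map c.jA := Ideal.dvd_iff_le.2 hJI
  have h2 : I * K ∣ I * c.P ^ 6 := by
    rw [← hK, c.P6, mul_comm I]; exact Ideal.dvd_iff_le.2 h1
  have h3 := (mul_dvd_mul_iff_left (show I ≠ 0 from hI)).1 h2
  have hPp : Prime c.P := Ideal.prime_of_isPrime c.P_ne c.Pp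
  obtain ⟨k, _, hk⟩ := (dvd_prime_pow hPp 6).1 h3
  have hk : K = c.P ^ k := associated_iff_eq.1 hk
  refine ⟨J, k, ?_, by rw [hK, hk]⟩
  rintro h0
  rw [h0, Ideal.map_bot] at hK
  exact mul_ne_zero (show I ≠ 0 from hI) (hk ▸ pow_ne_zero k c.P_ne) hK.symm

variable [IsDedekindDomain (ℤ√d)]

/-- Image of the class group of the real quadratic subfield. -/
noncomputable def H (c : Core d d' B) : Subgroup (ClassGroup B) := (clHom c.jA c.iA).range

/-- Class of the prime above two. -/
noncomputable def p0 (c : Core d d' B) : ClassGroup B := cl c.P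

theorem p0_sq (c : Core d d' B) : c.p0 * c.p0 = 1 := by
  rw [p0, ← cl_mul c.P_ne c.P_ne, ← sq, c.P2', cl_span]

/-- The classes of invariant ideals. -/
noncomputable def K (c : Core d d' B) : Subgroup (ClassGroup B) :=
  dbl c.H c.p0 (c.p0_sq ▸ c.H.one_mem)

theorem mem_K (c : Core d d' B) {x : ClassGroup B} : x ∈ c.K ↔ x ∈ c.H ∨ c.p0 * x ∈ c.H := Iff.rfl

theorem inv_mem_K (c : Core d d' B) {I : Ideal B} (hI : I ≠ ⊥)
    (hinv : I.map (c.σ : B →+* B) = I) : cl I ∈ c.K := by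
  obtain ⟨J, k, hJ, h⟩ := c.inv_ideal hI hinv
  have h1 : cl I * c.p0 ^ k ∈ c.H := by
    rw [p0, ← cl_pow c.P_ne, ← cl_mul hI (pow_ne_zero k c.P_ne), ← h]
    exact ⟨cl J, clHom_cl _ _ hJ⟩
  rw [mem_K]
  rcases Nat.even_or_odd' k with ⟨n, rfl | rfl⟩
  · left
    rwa [pow_mul, sq, c.p0_sq, one_pow, mul_one] at h1
  · right
    rwa [pow_succ, pow_mul, sq, c.p0_sq, one_pow, one_mul, mul_comm] at h1

theorem unit_of_span (_c : Core d d' B) {x y : B} (h : Ideal.span {x} = Ideal.span {y}) :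
    ∃ u : Bˣ, x = u * y := by
  rw [Ideal.span_singleton_eq_span_singleton] at h
  obtain ⟨u, hu⟩ := h.symm
  exact ⟨u, by rw [← hu, mul_comm]⟩

namespace Ar

variable {c : Core d d' B} {Q r s : ℤ} {E : Bˣ} {α : B}

theorem span_α (A : Ar c Q r s E α) {RQ : Ideal (ℤ√d)} (hRQ : RQ ^ 2 = Ideal.span {(Q : ℤ√d)}) :
    Ideal.span {α} = RQ.map c.jA := by
  apply ideal_sq_inj
  rw [← Ideal.map_pow, hRQ, Ideal.span_singleton_pow, A.hα, map_span1, map_intCast,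
    ← Ideal.span_singleton_mul_span_singleton, Ideal.span_singleton_eq_top.2 E.isUnit]
  exact Ideal.mul_top _

theorem span_ω (c : Core d d' B) {R2 : Ideal (ℤ√d)} (hR2 : R2 ^ 2 = Ideal.span {(2 : ℤ√d)}) :
    Ideal.span {c.ω} = R2.map c.jA := by
  apply ideal_sq_inj
  rw [← Ideal.map_pow, hR2, Ideal.span_singleton_pow, c.ω_sq, map_span1, map_ofNat]

theorem descend (A : Ar c Q r s E α) {RQ R2 : Ideal (ℤ√d)}
    (hRQ : RQ ^ 2 = Ideal.span {(Q : ℤ√d)}) (hR2 : R2 ^ 2 = Ideal.span {(2 : ℤ√d)})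
    {x : B} {u : Bˣ} (hx0 : x ≠ 0) (hx : x = u * c.σ x) :
    ∃ (δ : ℤ√d) (i j : ℕ), i ≤ 1 ∧ j ≤ 1 ∧ δ ≠ 0 ∧
      Ideal.span {c.jA δ} = Ideal.span {x} * (RQ ^ i * R2 ^ j).map c.jA := by
  have hσx : c.σ x ≠ 0 := by simpa using hx0
  have hu : u * c.sU u = 1 := by
    ext
    rw [Units.val_mul, sU_val]
    have h1 := congrArg c.σ hx
    rw [map_mul, c.σσ] at h1
    apply mul_right_cancel₀ hx0
    rw [Units.val_one, one_mul, mul_assoc, ← h1, ← hx]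
  obtain ⟨w, i, j, hi, hj, hw⟩ := A.H1 hu
  set C : B := w * α ^ i * c.ω ^ j with hC
  have hfix : c.σ (x * c.σ C) = x * c.σ C := by
    rw [map_mul, c.σσ]
    conv_lhs => rw [hw]
    conv_rhs => rw [hx]
    ring
  obtain ⟨δ, hδ⟩ := c.fA _ hfix
  have hC0 : C ≠ 0 := mul_ne_zero (mul_ne_zero w.ne_zero (pow_ne_zero _ A.α_ne))
    (pow_ne_zero _ c.ω_ne)
  refine ⟨δ, i, j, hi, hj, ?_, ?_⟩
  · rintro rfl
    rw [map_zero] at hδ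
    exact mul_ne_zero hx0 (by simpa using hC0) hδ.symm
  · rw [hδ, ← Ideal.span_singleton_mul_span_singleton, ← map_span_e]
    rw [hC, ← Ideal.span_singleton_mul_span_singleton, ← Ideal.span_singleton_mul_span_singleton,
      Ideal.span_singleton_eq_top.2 w.isUnit, Ideal.top_mul, ← Ideal.span_singleton_pow,
      ← Ideal.span_singleton_pow, A.span_α hRQ, span_ω c hR2, ← Ideal.map_pow, ← Ideal.map_pow,
      ← Ideal.map_mul, c.σmapA]

theorem p0_notin (A : Ar c Q r s E α) {RQ R2 : Ideal (ℤ√d)}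
    (hRQ : RQ ^ 2 = Ideal.span {(Q : ℤ√d)}) (hR2 : R2 ^ 2 = Ideal.span {(2 : ℤ√d)}) :
    c.p0 ∉ c.H := by
  rintro ⟨z, hz⟩
  obtain ⟨S, hS, rfl⟩ := cl_surj z
  rw [clHom_cl _ _ hS, p0, eq_comm, cl_eq_iff c.P_ne (map_ne_bot c.iA hS)] at hz
  obtain ⟨x, y, hx, hy, h⟩ := hz
  have hσ := congrArg (Ideal.map (c.σ : B →+* B)) h
  rw [Ideal.map_mul, Ideal.map_mul, c.σP, c.σmapA, map_span_e, map_span_e] at hσ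
  have hSB := map_ne_bot c.iA hS
  have h1 : Ideal.span {x * c.σ y} = Ideal.span {c.σ (x * c.σ y)} := by
    rw [map_mul, c.σσ, ← Ideal.span_singleton_mul_span_singleton,
      ← Ideal.span_singleton_mul_span_singleton]
    apply mul_right_cancel₀ (mul_ne_zero c.P_ne hSB)
    calc Ideal.span {x} * Ideal.span {c.σ y} * (c.P * S.map c.jA)
        = (Ideal.span {x} * c.P) * (Ideal.span {c.σ y} * S.map c.jA) := by ring
      _ = (Ideal.span {y} * S.map c.jA) * (Ideal.span {c.σ x} * c.P) := by rw [h, hσ]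
      _ = _ := by ring
  obtain ⟨u, hu⟩ := c.unit_of_span h1
  obtain ⟨δ, i, j, -, -, hδ, hh⟩ := A.descend hRQ hR2 (mul_ne_zero hx (by simpa using hy)) hu
  obtain ⟨n, hn⟩ := c.fA (y * c.σ y) (by rw [map_mul, c.σσ, mul_comm])
  have h2 : Ideal.span {c.jA δ} * c.P = (Ideal.span {n} * S * (RQ ^ i * R2 ^ j)).map c.jA := by
    rw [hh, ← Ideal.span_singleton_mul_span_singleton, Ideal.map_mul _ _ (RQ ^ i * R2 ^ j),
      Ideal.map_mul _ _ S, map_span1, hn,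
      ← Ideal.span_singleton_mul_span_singleton]
    calc _ = (Ideal.span {x} * c.P) * Ideal.span {c.σ y} * (RQ ^ i * R2 ^ j).map c.jA := by ring
      _ = _ := by rw [h]; ring
  set V := Ideal.span {n} * S * (RQ ^ i * R2 ^ j) with hV
  have h3 : (Ideal.span {δ} ^ 2 * R2) ^ 2 = (V ^ 2) ^ 2 := by
    apply ideal_map_inj c.jA c.iA c.σ c.σA c.fA
    rw [← pow_mul, Ideal.map_pow _ V, ← h2, mul_pow, mul_pow, c.P4, hR2, Ideal.map_mul, map_span1,
      map_ofNat, ← pow_mul, Ideal.map_pow, map_span1]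
  have h4 := ideal_sq_inj h3
  obtain ⟨v, hv⟩ := idnorm V
  have h2n := idnorm_sq (n := 2) (I := R2) (by exact_mod_cast hR2)
  have h5 : Ideal.span {((v ^ 2 : ℤ) : ℤ√d)} = Ideal.span {((2 * δ.norm ^ 2 : ℤ) : ℤ√d)} := by
    have e1 : (V * V.map (conj d : ℤ√d →+* ℤ√d)) ^ 2 =
      (Ideal.span {δ} * Ideal.span {conj d δ}) ^ 2 * (R2 * R2.map (conj d : ℤ√d →+* ℤ√d)) := by
      rw [mul_pow, ← Ideal.map_pow, ← h4, Ideal.map_mul, Ideal.map_pow, map_span1]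
      change _ * (Ideal.span {conj d δ} ^ 2 * _) = _
      ring
    rw [hv, h2n, Ideal.span_singleton_mul_span_singleton, mul_conj, Ideal.span_singleton_pow,
      Ideal.span_singleton_pow, Ideal.span_singleton_mul_span_singleton] at e1
    push_cast at e1 ⊢
    rw [e1, mul_comm]
  have hN : δ.norm ≠ 0 := by
    intro h0
    have := mul_conj δ
    rw [h0, Int.cast_zero] at this
    rcases mul_eq_zero.1 this with h6 | h6
    · exact hδ h6
    · exact hδ (by simpa using h6)
  have h6 : (v : ℤ) ^ 2 = 2 * δ.norm ^ 2 := by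
    rcases span_int h5 with h6 | h6
    · exact h6
    · nlinarith [sq_nonneg (v : ℤ), sq_nonneg δ.norm, sq_pos_of_ne_zero hN]
  have h7 : ¬ IsSquare (2 : ℚ) := by
    rw [show (2 : ℚ) = ((2 : ℕ) : ℚ) by norm_num, Rat.isSquare_natCast_iff]
    exact Nat.Prime.prime Nat.prime_two |>.irreducible.not_isSquare
  apply h7
  have hN' : (δ.norm : ℚ) ≠ 0 := by exact_mod_cast hN
  refine ⟨v / δ.norm, ?_⟩
  have : (v : ℚ) ^ 2 = 2 * (δ.norm : ℚ) ^ 2 := by exact_mod_cast h6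
  field_simp
  linarith

theorem card_K (A : Ar c Q r s E α) {RQ R2 : Ideal (ℤ√d)} [Finite (ClassGroup B)]
    (hRQ : RQ ^ 2 = Ideal.span {(Q : ℤ√d)}) (hR2 : R2 ^ 2 = Ideal.span {(2 : ℤ√d)}) :
    Nat.card c.K = 2 * Nat.card c.H :=
  card_dbl c.H c.K c.p0 (A.p0_notin hRQ hR2) (fun _ => Iff.rfl)

/-- capitulation -/
theorem capit (A : Ar c Q r s E α) {RQ R2 : Ideal (ℤ√d)}
    (hRQ : RQ ^ 2 = Ideal.span {(Q : ℤ√d)}) (hR2 : R2 ^ 2 = Ideal.span {(2 : ℤ√d)})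
    {z : ClassGroup (ℤ√d)} (hz : clHom c.jA c.iA z = 1) :
    ∃ i j : ℕ, i ≤ 1 ∧ j ≤ 1 ∧ z * (cl RQ ^ i * cl R2 ^ j) = 1 := by
  have hRQ0 : RQ ≠ ⊥ := by
    rintro rfl
    rw [Ideal.bot_pow two_ne_zero, eq_comm, Ideal.span_singleton_eq_bot] at hRQ
    exact Zs.intCast_ne A.gQ.1.ne' hRQ
  have hR20 : R2 ≠ ⊥ := by
    rintro rfl
    rw [Ideal.bot_pow two_ne_zero, eq_comm, Ideal.span_singleton_eq_bot] at hR2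
    exact Zs.intCast_ne (D := d) (n := 2) (by norm_num) (by exact_mod_cast hR2)
  obtain ⟨S, hS, rfl⟩ := cl_surj z
  rw [clHom_cl _ _ hS, cl_eq_one_iff (map_ne_bot c.iA hS)] at hz
  obtain ⟨x, hx, h⟩ := hz
  have h1 : Ideal.span {x} = Ideal.span {c.σ x} := by
    rw [← map_span_e, ← h, c.σmapA]
  obtain ⟨u, hu⟩ := c.unit_of_span h1
  obtain ⟨δ, i, j, hi, hj, hδ, hh⟩ := A.descend hRQ hR2 hx hu
  refine ⟨i, j, hi, hj, ?_⟩
  rw [← h, ← Ideal.map_mul, ← map_span1] at hh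
  have := ideal_map_inj c.jA c.iA c.σ c.σA c.fA hh
  rw [← cl_pow hRQ0, ← cl_pow hR20, ← cl_mul (pow_ne_zero i hRQ0) (pow_ne_zero j hR20),
    ← cl_mul hS (mul_ne_zero (pow_ne_zero i hRQ0) (pow_ne_zero j hR20)), ← this, cl_span]

theorem capit_R2 (A : Ar c Q r s E α) {R2 : Ideal (ℤ√d)}
    (hR2 : R2 ^ 2 = Ideal.span {(2 : ℤ√d)}) : clHom c.jA c.iA (cl R2) = 1 := by
  have hR20 : R2 ≠ ⊥ := by
    rintro rfl
    rw [Ideal.bot_pow two_ne_zero, eq_comm, Ideal.span_singleton_eq_bot] at hR2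
    exact Zs.intCast_ne (D := d) (n := 2) (by norm_num) (by exact_mod_cast hR2)
  rw [clHom_cl _ _ hR20, ← span_ω c hR2, cl_span]

theorem capit_RQ (A : Ar c Q r s E α) {RQ : Ideal (ℤ√d)}
    (hRQ : RQ ^ 2 = Ideal.span {(Q : ℤ√d)}) : clHom c.jA c.iA (cl RQ) = 1 := by
  have hRQ0 : RQ ≠ ⊥ := by
    rintro rfl
    rw [Ideal.bot_pow two_ne_zero, eq_comm, Ideal.span_singleton_eq_bot] at hRQ
    exact Zs.intCast_ne A.gQ.1.ne' hRQ
  rw [clHom_cl _ _ hRQ0, ← A.span_α hRQ, cl_span]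

end Ar

end Core


open Zs

set_option linter.unusedSectionVars false

namespace Core

variable {d d' : ℤ} {B : Type} [CommRing B] [IsDedekindDomain B]

theorem inj_e (f : B ≃+* B) : Function.Injective (f : B →+* B) := f.injective

/-- `σ` on classes. -/
noncomputable def sg (c : Core d d' B) : ClassGroup B →* ClassGroup B :=
  clHom (c.σ : B →+* B) (inj_e c.σ)

/-- `x ↦ x / σ x` on classes. -/
noncomputable def phi (c : Core d d' B) : ClassGroup B →* ClassGroup B :=
  MonoidHom.id _ / c.sg

theorem phi_apply (c : Core d d' B) (x : ClassGroup B) : c.phi x = x / c.sg x := rfl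

theorem sg_cl (c : Core d d' B) {I : Ideal B} (hI : I ≠ ⊥) :
    c.sg (cl I) = cl (I.map (c.σ : B →+* B)) := clHom_cl _ _ hI

theorem mem_A0 (c : Core d d' B) {x : ClassGroup B} : x ∈ c.phi.ker ↔ x = c.sg x := by
  rw [MonoidHom.mem_ker, phi_apply, div_eq_one]

theorem map_σσ (c : Core d d' B) (I : Ideal B) :
    (I.map (c.σ : B →+* B)).map (c.σ : B →+* B) = I := by
  rw [Ideal.map_map]
  convert Ideal.map_id I
  exact RingHom.ext c.σσ

theorem map_σ_ne (c : Core d d' B) {I : Ideal B} (hI : I ≠ ⊥) : I.map (c.σ : B →+* B) ≠ ⊥ :=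
  map_ne_bot (inj_e c.σ) hI

theorem σ_ne (c : Core d d' B) {x : B} (hx : x ≠ 0) : c.σ x ≠ 0 := by simpa using hx

/-- Ambiguous class with its norm symbol. -/
def PP (c : Core d d' B) (x : ClassGroup B) (t : Bˣ) : Prop :=
  ∃ I : Ideal B, I ≠ ⊥ ∧ cl I = x ∧ ∃ a b : B, a ≠ 0 ∧ b ≠ 0 ∧
    Ideal.span {a} * I = Ideal.span {b} * I.map (c.σ : B →+* B) ∧
    a * c.σ a = t * (b * c.σ b)

theorem PP_exists (c : Core d d' B) {x : ClassGroup B} (hx : x ∈ c.phi.ker) :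
    ∃ t : Bˣ, c.σ t = t ∧ c.PP x t := by
  rw [mem_A0] at hx
  obtain ⟨I, hI, rfl⟩ := cl_surj x
  rw [c.sg_cl hI, cl_eq_iff hI (c.map_σ_ne hI)] at hx
  obtain ⟨a, b, ha, hb, h⟩ := hx
  have hσ := congrArg (Ideal.map (c.σ : B →+* B)) h
  rw [Ideal.map_mul, Ideal.map_mul, map_span_e, map_span_e, c.map_σσ] at hσ
  have h1 : Ideal.span {a * c.σ a} = Ideal.span {b * c.σ b} := by
    rw [← Ideal.span_singleton_mul_span_singleton, ← Ideal.span_singleton_mul_span_singleton]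
    apply mul_right_cancel₀ (mul_ne_zero hI (c.map_σ_ne hI))
    calc _ = (Ideal.span {a} * I) * (Ideal.span {c.σ a} * I.map (c.σ : B →+* B)) := by ring
      _ = (Ideal.span {b} * I.map (c.σ : B →+* B)) * (Ideal.span {c.σ b} * I) := by rw [h, hσ]
      _ = _ := by ring
  rw [Ideal.span_singleton_eq_span_singleton] at h1
  obtain ⟨t, ht⟩ := h1.symm
  refine ⟨t, ?_, I, hI, rfl, a, b, ha, hb, h, by rw [← ht, mul_comm]⟩
  have h2 := congrArg c.σ ht
  rw [map_mul, map_mul, map_mul, c.σσ, c.σσ, mul_comm (c.σ a), ← ht, mul_comm (c.σ b)] at h2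
  exact mul_left_cancel₀ (mul_ne_zero hb (c.σ_ne hb)) h2

theorem PP_mem (c : Core d d' B) {x : ClassGroup B} {t : Bˣ} (h : c.PP x t) : x ∈ c.phi.ker := by
  obtain ⟨I, hI, rfl, a, b, ha, hb, h, -⟩ := h
  rw [mem_A0, c.sg_cl hI, cl_eq_iff hI (c.map_σ_ne hI)]
  exact ⟨a, b, ha, hb, h⟩

theorem PP_mul (c : Core d d' B) {x y : ClassGroup B} {t t' : Bˣ} (h : c.PP x t)
    (h' : c.PP y t') : c.PP (x * y) (t * t') := by
  obtain ⟨I, hI, rfl, a, b, ha, hb, h, h2⟩ := h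
  obtain ⟨J, hJ, rfl, a', b', ha', hb', h', h2'⟩ := h'
  refine ⟨I * J, mul_ne_zero hI hJ, cl_mul hI hJ, a * a', b * b', mul_ne_zero ha ha',
    mul_ne_zero hb hb', ?_, ?_⟩
  · rw [← Ideal.span_singleton_mul_span_singleton, ← Ideal.span_singleton_mul_span_singleton,
      mul_mul_mul_comm, h, h', Ideal.map_mul, mul_mul_mul_comm]
  · rw [map_mul, map_mul, mul_mul_mul_comm, h2, h2', Units.val_mul]; ring

variable [IsDedekindDomain (ℤ√d)]

theorem PP_K (c : Core d d' B) {x : ClassGroup B} {u : Bˣ} (h : c.PP x (u * c.sU u)) :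
    x ∈ c.K := by
  obtain ⟨I, hI, rfl, a, b, ha, hb, h, h2⟩ := h
  obtain ⟨b', hb'⟩ : ∃ b' : B, b' = u * b := ⟨_, rfl⟩
  have hb0 : b' ≠ 0 := hb' ▸ mul_ne_zero u.ne_zero hb
  have e1 : Ideal.span {b'} = Ideal.span {b} := by
    rw [hb', ← Ideal.span_singleton_mul_span_singleton, Ideal.span_singleton_eq_top.2 u.isUnit,
      Ideal.top_mul]
  rw [← e1] at h
  have e2 : a * c.σ a = b' * c.σ b' := by
    rw [h2, hb', Units.val_mul, sU_val, map_mul]; ring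
  by_cases h0 : a + b' = 0
  · rw [eq_neg_of_add_eq_zero_left h0, Ideal.span_singleton_neg] at h
    have := mul_left_cancel₀ (a := Ideal.span {b'}) (by simpa using hb0) h
    exact c.inv_mem_K hI this.symm
  · set e := (a + b') * c.σ b' with he
    have he0 : e ≠ 0 := mul_ne_zero h0 (c.σ_ne hb0)
    have e3 : b' * e = a * c.σ e := by
      rw [he, map_mul, map_add, c.σσ]
      linear_combination (- b') * e2
    have hne : Ideal.span {e} * I ≠ ⊥ := mul_ne_zero (by simpa using he0) hI
    have := c.inv_mem_K hne (by
      rw [Ideal.map_mul, map_span_e]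
      apply mul_left_cancel₀ (a := Ideal.span {b'}) (by simpa using hb0)
      calc _ = Ideal.span {c.σ e} * (Ideal.span {b'} * I.map (c.σ : B →+* B)) := by ring
        _ = (Ideal.span {a} * Ideal.span {c.σ e}) * I := by rw [← h]; ring
        _ = (Ideal.span {b'} * Ideal.span {e}) * I := by
          rw [Ideal.span_singleton_mul_span_singleton, Ideal.span_singleton_mul_span_singleton, e3]
        _ = _ := by ring)
    rwa [cl_mul (by simpa using he0) hI, cl_span, one_mul] at this

theorem K_inv (c : Core d d' B) {x : ClassGroup B} (h : x ∈ c.K) :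
    ∃ I : Ideal B, I ≠ ⊥ ∧ cl I = x ∧ I.map (c.σ : B →+* B) = I := by
  rcases c.mem_K.1 h with ⟨y, hy⟩ | ⟨y, hy⟩
  · obtain ⟨J, hJ, rfl⟩ := cl_surj y
    rw [clHom_cl _ _ hJ] at hy
    exact ⟨J.map c.jA, map_ne_bot c.iA hJ, hy, c.σmapA J⟩
  · obtain ⟨J, hJ, rfl⟩ := cl_surj y
    rw [clHom_cl _ _ hJ] at hy
    refine ⟨c.P * J.map c.jA, mul_ne_zero c.P_ne (map_ne_bot c.iA hJ), ?_, ?_⟩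
    · rw [cl_mul c.P_ne (map_ne_bot c.iA hJ), hy, ← p0, ← mul_assoc, c.p0_sq, one_mul]
    · rw [Ideal.map_mul, c.σP, c.σmapA]

theorem K_le (c : Core d d' B) : c.K ≤ c.phi.ker := by
  intro x hx
  obtain ⟨I, hI, rfl, h⟩ := c.K_inv hx
  rw [mem_A0, c.sg_cl hI, h]

theorem K_PP (c : Core d d' B) {x : ClassGroup B} (hx : x ∈ c.K) {t : Bˣ} (h : c.PP x t) :
    ∃ u : Bˣ, t = u * c.sU u := by
  obtain ⟨J, hJ, hJx, hinv⟩ := c.K_inv hx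
  obtain ⟨I, hI, hIx, a, b, ha, hb, h, h2⟩ := h
  obtain ⟨f, g, hf, hg, h3⟩ := (cl_eq_iff hI hJ).1 (hIx.trans hJx.symm)
  have h4 := congrArg (Ideal.map (c.σ : B →+* B)) h3
  rw [Ideal.map_mul, Ideal.map_mul, map_span_e, map_span_e, hinv] at h4
  have h5 : Ideal.span {a * c.σ f * g} = Ideal.span {b * f * c.σ g} := by
    simp only [← Ideal.span_singleton_mul_span_singleton]
    apply mul_right_cancel₀ hJ
    calc _ = Ideal.span {a} * Ideal.span {c.σ f} * (Ideal.span {g} * J) := by ring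
      _ = Ideal.span {f} * Ideal.span {c.σ f} * (Ideal.span {a} * I) := by rw [← h3]; ring
      _ = Ideal.span {b} * Ideal.span {f} * (Ideal.span {c.σ f} * I.map (c.σ : B →+* B)) := by
        rw [h]; ring
      _ = _ := by rw [h4]; ring
  obtain ⟨u, hu⟩ := c.unit_of_span h5
  refine ⟨u, ?_⟩
  ext
  rw [Units.val_mul, sU_val]
  have h6 := congrArg c.σ hu
  simp only [map_mul, c.σσ] at h6
  have h7 : (t : B) * (b * c.σ b * (f * c.σ f) * (g * c.σ g)) =
      u * c.σ u * (b * c.σ b * (f * c.σ f) * (g * c.σ g)) := by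
    calc _ = (a * c.σ a) * ((f * c.σ f) * (g * c.σ g)) := by rw [h2]; ring
      _ = (a * c.σ f * g) * (c.σ a * f * c.σ g) := by ring
      _ = _ := by rw [hu, h6]; ring
  refine mul_right_cancel₀ ?_ h7
  exact mul_ne_zero (mul_ne_zero (mul_ne_zero hb (c.σ_ne hb)) (mul_ne_zero hf (c.σ_ne hf)))
    (mul_ne_zero hg (c.σ_ne hg))

theorem PP_of_norm (c : Core d d' B) {t : Bˣ} {a b : B} (ha : a ≠ 0) (hb : b ≠ 0)
    (h : (t : B) * (b * c.σ b) = a * c.σ a) : ∃ x, c.PP x t := by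
  set I : Ideal B := Ideal.span {c.σ a, b} with hI
  have hbI : b ∈ I := Ideal.subset_span (by simp)
  refine ⟨cl I, I, ?_, rfl, a, b, ha, hb, ?_, h.symm⟩
  · intro h0
    rw [h0] at hbI
    exact hb (by simpa using hbI)
  · have e1 : I.map (c.σ : B →+* B) = Ideal.span {a, c.σ b} := by
      rw [hI, Ideal.map_span, Set.image_pair]
      change Ideal.span {c.σ (c.σ a), c.σ b} = _
      rw [c.σσ]
    rw [e1, hI, Ideal.span_insert, Ideal.span_insert, Ideal.mul_sup, Ideal.mul_sup]
    simp only [Ideal.span_singleton_mul_span_singleton]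
    rw [← h, sup_comm, ← Ideal.span_singleton_mul_span_singleton (t : B),
      Ideal.span_singleton_eq_top.2 t.isUnit, Ideal.top_mul, mul_comm a b]

theorem pm_norm (c : Core d d' B) {E0 : Bˣ} {ξ : Bˣ} 
    (h : ξ * c.sU ξ = E0 ∨ ξ * c.sU ξ = - E0) : ∃ η : Bˣ, η * c.sU η = E0 := by
  rcases h with h | h
  · exact ⟨ξ, h⟩
  · refine ⟨ξ * c.E1, ?_⟩
    rw [map_mul, mul_mul_mul_comm, h, c.sE1]; simp

namespace Ar

variable {c : Core d d' B} {Q r s : ℤ} {E : Bˣ} {α : B}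

theorem caseI_xi (A : Ar c Q r s E α) {E0 : Bˣ} {α0 : B} (hσ : c.σ α0 = α0)
    (hα0 : α0 ^ 2 = Q * E0) :
    ∃ ξ : Bˣ, ξ ^ 2 = E0 * E ∧ (ξ * c.sU ξ = E0 ∨ ξ * c.sU ξ = - E0) := by
  have h1 : Ideal.span {α0 * α} = Ideal.span {(Q : B)} := by
    apply ideal_sq_inj
    rw [Ideal.span_singleton_pow, Ideal.span_singleton_pow, mul_pow, hα0, A.hα,
      show (Q : B) * E0 * (Q * E) = Q ^ 2 * ((E0 * E : Bˣ) : B) by push_cast; ring,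
      ← Ideal.span_singleton_mul_span_singleton, Ideal.span_singleton_eq_top.2 (Units.isUnit _),
      Ideal.mul_top]
  obtain ⟨ξ, hξ⟩ := c.unit_of_span h1
  have hQ := A.Q_ne
  refine ⟨ξ, ?_, ?_⟩
  · ext
    push_cast
    apply mul_right_cancel₀ (pow_ne_zero 2 hQ)
    rw [← mul_pow, ← hξ, mul_pow, hα0, A.hα]; ring
  · have h2 := congrArg c.σ hξ
    rw [map_mul, map_mul, hσ, map_intCast] at h2
    have h3 : (ξ : B) * c.σ ξ * (Q : B) ^ 2 = (Q * E0) * (α * c.σ α) := by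
      rw [← hα0]
      calc _ = ((ξ : B) * Q) * (c.σ ξ * Q) := by ring
        _ = _ := by rw [← hξ, ← h2]; ring
    rcases A.hασ with h | h
    · left; ext; rw [Units.val_mul, sU_val]
      apply mul_right_cancel₀ (pow_ne_zero 2 hQ)
      rw [h3, h]; ring
    · right; ext; rw [Units.val_mul, sU_val, Units.val_neg]
      apply mul_right_cancel₀ (pow_ne_zero 2 hQ)
      rw [h3, h]; ring

theorem A0_caseI (A : Ar c Q r s E α) {E0 ξ : Bˣ}
    (hu : ∀ u : Bˣ, c.σ u = u → ∃ k : ℤ, u = E0 ^ k ∨ u = - E0 ^ k)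
    (hξ : ξ * c.sU ξ = E0 ∨ ξ * c.sU ξ = - E0) : c.phi.ker = c.K := by
  obtain ⟨η, hη⟩ := c.pm_norm hξ
  refine le_antisymm ?_ c.K_le
  intro x hx
  obtain ⟨t, ht, hP⟩ := c.PP_exists hx
  obtain ⟨k, rfl | rfl⟩ := hu t ht
  · apply c.PP_K (u := η ^ k)
    rwa [map_zpow, ← mul_zpow, hη]
  · apply c.PP_K (u := η ^ k * c.E1)
    rw [map_mul, mul_mul_mul_comm, c.sE1, map_zpow, ← mul_zpow, hη]
    simpa using hP

/-- `u² = N_σ(u) N_τ(u) N_ρ(u)` for units. -/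
theorem unit_sq (A : Ar c Q r s E α) (u : Bˣ) :
    u ^ 2 = (u * c.sU u) * (u * c.tU u) * (u * c.sU (c.tU u)) := by
  have h := A.normA (u * c.sU u) (by
    rw [Units.val_mul, sU_val, map_mul, c.σσ, mul_comm])
  ext
  simp only [Units.val_mul, Units.val_pow_eq_pow_val, sU_val, tU_val] at h ⊢
  rw [map_mul, ← c.στ] at h
  linear_combination (- (u : B) ^ 2) * h

theorem norm_even (A : Ar c Q r s E α) {E0 : Bˣ} {b0 : ℤ} (g1 : Good d d' b0)
    (g2 : Good d d' (Q * b0)) {αb : B} (hαb : αb ^ 2 = b0 * E0) {u : Bˣ} {k : ℤ}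
    (h : u * c.sU u = E0 ^ k ∨ u * c.sU u = - E0 ^ k) : Even k := by
  by_contra hk
  rw [Int.not_even_iff_odd] at hk
  obtain ⟨n, rfl⟩ := hk
  obtain ⟨m, hm⟩ := A.units (u * c.sU (c.tU u)) (by
    rw [Units.val_mul, map_mul, sU_val, tU_val, ← ρ_apply, c.ρρ, mul_comm])
  obtain ⟨e, he, hh⟩ : ∃ e : Bˣ, (e = 1 ∨ e = -1) ∧
      (u * c.sU u) * (u * c.sU (c.tU u)) = e * (E0 ^ (2 * n + 1) * E ^ m) := by
    rcases pm_mul h hm with h | h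
    · exact ⟨1, Or.inl rfl, by rw [h, one_mul]⟩
    · exact ⟨-1, Or.inr rfl, by rw [h, neg_one_mul]⟩
  have h1 : u ^ 2 = (e * (u * c.tU u)) * E ^ m * E0 ^ (2 * n + 1) := by
    rw [A.unit_sq u, mul_right_comm, hh]
    simp only [mul_comm, mul_left_comm, mul_assoc]
  refine A.NSL g1 g2 (w := e * (u * c.tU u)) ?_ (k := m) (y := ((u * E0 ^ (-(n + 1)) : Bˣ) : B) * αb) ?_
  · rw [map_mul, map_mul, c.tU_tU, mul_comm (c.tU u)]
    congr 1
    rcases he with rfl | rfl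
    · simp
    · rw [c.tU_neg, map_one]
  · rw [mul_pow, hαb, ← Units.val_pow_eq_pow_val, mul_pow, h1]
    have : (e * (u * c.tU u)) * E ^ m * E0 ^ (2 * n + 1) * (E0 ^ (-(n + 1))) ^ 2 * E0 =
        (e * (u * c.tU u)) * E ^ m := by
      rw [mul_assoc, mul_assoc _ (E0 ^ (2 * n + 1)), ← zpow_natCast, ← zpow_mul]
      rw [show E0 ^ (2 * n + 1) * (E0 ^ (-(n + 1) * ((2 : ℕ) : ℤ)) * E0) = 1 by
        nth_rewrite 3 [← zpow_one E0]
        rw [← zpow_add, ← zpow_add, ← zpow_zero E0]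
        congr 1
        push_cast; ring]
      rw [mul_one]
    have h9 := congrArg Units.val this
    push_cast at h9 ⊢
    linear_combination (b0 : B) * h9

theorem A0_caseII (A : Ar c Q r s E α) {E0 : Bˣ} {b0 : ℤ} (g1 : Good d d' b0)
    (g2 : Good d d' (Q * b0)) {αb : B} (hαb : αb ^ 2 = b0 * E0) (hσE0 : c.σ E0 = E0)
    (hu : ∀ u : Bˣ, c.σ u = u → ∃ k : ℤ, u = E0 ^ k ∨ u = - E0 ^ k)
    {a b : B} (ha : a ≠ 0) (hb : b ≠ 0) (h : (E0 : B) * (b * c.σ b) = a * c.σ a)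
    [Finite (ClassGroup B)] :
    Nat.card c.phi.ker = 2 * Nat.card c.K := by
  obtain ⟨c0, hc0⟩ := c.PP_of_norm ha hb h
  have hsE0 : c.sU E0 = E0 := Units.ext hσE0
  have ev : ∀ {x : ClassGroup B} {k : ℤ}, Even k → (c.PP x (E0 ^ k) ∨ c.PP x (- E0 ^ k)) →
      x ∈ c.K := by
    rintro x k ⟨n, rfl⟩ (hP | hP)
    · apply c.PP_K (u := E0 ^ n)
      rwa [map_zpow, hsE0, ← zpow_add]
    · apply c.PP_K (u := E0 ^ n * c.E1)
      rw [map_mul, mul_mul_mul_comm, c.sE1, map_zpow, hsE0, ← zpow_add]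
      simpa using hP
  apply card_dbl c.K c.phi.ker c0
  · intro hK
    obtain ⟨u, hu⟩ := c.K_PP hK hc0
    have := A.norm_even g1 g2 hαb (u := u) (k := 1) (Or.inl (by rw [← hu, zpow_one]))
    exact absurd this (by decide)
  · intro x
    constructor
    · intro hx
      obtain ⟨t, ht, hP⟩ := c.PP_exists hx
      obtain ⟨k, hk⟩ := hu t ht
      rcases Int.even_or_odd k with h1 | h1
      · left
        apply ev h1
        rcases hk with rfl | rfl
        · exact Or.inl hP
        · exact Or.inr hP
      · right
        apply ev (k := 1 + k) (Odd.one_add h1)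
        have := c.PP_mul hc0 hP
        rw [zpow_add, zpow_one]
        rcases hk with rfl | rfl
        · exact Or.inl this
        · right; simpa using this
    · rintro (hx | hx)
      · exact c.K_le hx
      · have := c.phi.ker.mul_mem (c.phi.ker.inv_mem (c.PP_mem hc0)) (c.K_le hx)
        rwa [inv_mul_cancel_left] at this

end Ar

end Core


open Zs

set_option linter.unusedSectionVars false

namespace Zs

theorem Rex {D b c : ℤ} (hbc : IsCoprime b c) (hD : D = b * c) :
    ∃ R : Ideal (ℤ√D), R ^ 2 = Ideal.span {(b : ℤ√D)} := by
  set w : ℤ√D := Zsqrtd.sqrtd with hw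
  have hww : w * w = (b : ℤ√D) * c := by
    rw [← sq, hw, sqrtd_sq]
    have := congrArg (Int.cast : ℤ → ℤ√D) hD
    rw [this]; push_cast; ring
  refine ⟨Ideal.span {(b : ℤ√D), w}, ?_⟩
  rw [sq, Ideal.span_pair_mul_span_pair]
  apply le_antisymm
  · rw [Ideal.span_le]
    rintro x hx
    simp only [Set.mem_insert_iff, Set.mem_singleton_iff] at hx
    rw [SetLike.mem_coe, Ideal.mem_span_singleton]
    rcases hx with rfl | rfl | rfl | rfl
    · exact dvd_mul_right _ _
    · exact dvd_mul_right _ _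
    · exact dvd_mul_left _ _
    · rw [hww]; exact dvd_mul_right _ _
  · rw [Ideal.span_singleton_le_iff_mem]
    obtain ⟨u, v, huv⟩ := hbc
    have h1 : (b : ℤ√D) = u * (b * b) + v * (w * w) := by
      rw [hww]
      have : ((u * b + v * c : ℤ) : ℤ√D) = 1 := by rw [huv, Int.cast_one]
      push_cast at this
      linear_combination (-(b : ℤ√D)) * this
    have h2 : (u : ℤ√D) * (b * b) + v * (w * w) ∈
        Ideal.span {(b : ℤ√D) * b, (b : ℤ√D) * w, w * b, w * w} :=
      add_mem (Ideal.mul_mem_left _ _ (Ideal.subset_span (by simp)))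
        (Ideal.mul_mem_left _ _ (Ideal.subset_span (by simp)))
    rwa [← h1] at h2

theorem Rex2 {D : ℤ} (hD : D % 4 = 3) :
    ∃ R : Ideal (ℤ√D), R ^ 2 = Ideal.span {(2 : ℤ√D)} := by
  set w : ℤ√D := Zsqrtd.sqrtd with hw
  obtain ⟨k, hk⟩ : ∃ k, D = 4 * k + 3 := ⟨D / 4, by omega⟩
  have hww : w * w = 4 * (k : ℤ√D) + 3 := by
    rw [← sq, hw, sqrtd_sq]
    have := congrArg (Int.cast : ℤ → ℤ√D) hk
    rw [this]; push_cast; ring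
  refine ⟨Ideal.span {(2 : ℤ√D), 1 + w}, ?_⟩
  rw [sq, Ideal.span_pair_mul_span_pair]
  apply le_antisymm
  · rw [Ideal.span_le]
    rintro x hx
    simp only [Set.mem_insert_iff, Set.mem_singleton_iff] at hx
    rw [SetLike.mem_coe, Ideal.mem_span_singleton]
    rcases hx with rfl | rfl | rfl | rfl
    · exact dvd_mul_right _ _
    · exact dvd_mul_right _ _
    · exact dvd_mul_left _ _
    · exact ⟨w + 2 * k + 2, by linear_combination hww⟩
  · rw [Ideal.span_singleton_le_iff_mem]
    have h1 : (2 : ℤ√D) = (1 + w) * (1 + w) - 2 * (1 + w) - k * (2 * 2) := by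
      linear_combination -hww
    have h2 : (1 + w) * (1 + w) - 2 * (1 + w) - k * (2 * 2) ∈
        Ideal.span {(2 : ℤ√D) * 2, (2 : ℤ√D) * (1 + w), (1 + w) * 2, (1 + w) * (1 + w)} :=
      sub_mem (sub_mem (Ideal.subset_span (by simp)) (Ideal.subset_span (by simp)))
        (Ideal.mul_mem_left _ _ (Ideal.subset_span (by simp)))
    rwa [← h1] at h2

end Zs

namespace Hyp

variable {η η' q r s : ℕ} {Q d d' : ℤ}

theorem r_ndvd_Q (h : Hyp η η' q r s Q d d') : ¬ (r : ℤ) ∣ Q := by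
  rw [h.hQ]; exact h.not_dvd_mul h.ndvdη h.ndvd_q

theorem cop (h : Hyp η η' q r s Q d d') {x : ℤ} (hx : ¬ (r : ℤ) ∣ x) : IsCoprime (r : ℤ) x :=
  (Prime.coprime_iff_not_dvd h.rprime).2 hx

theorem ramR (h : Hyp η η' q r s Q d d') :
    ∃ R : Ideal (ℤ√d), R ^ 2 = Ideal.span {((r : ℤ) : ℤ√d)} :=
  Rex (c := Q * s) (h.cop (h.not_dvd_mul h.r_ndvd_Q h.ndvd_s)) (by rw [h.hd]; ring)

theorem ramQ (h : Hyp η η' q r s Q d d') :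
    ∃ R : Ideal (ℤ√d), R ^ 2 = Ideal.span {(Q : ℤ√d)} := by
  refine Rex (c := r * s) (IsCoprime.mul_right ?_ ?_) (by rw [h.hd]; ring)
  · exact (h.cop h.r_ndvd_Q).symm
  · exact (h.swap.cop h.swap.r_ndvd_Q).symm

theorem mod4 (h : Hyp η η' q r s Q d d') : ((q * r * s : ℕ) : ℤ) % 4 = 3 := by
  have h1 := h.hq4
  have h2 : r % 4 = 1 := by have := h.hr8; omega
  have h3 : s % 4 = 1 := by have := h.hs8; omega
  have : (q * r * s) % 4 = 3 := by
    rw [Nat.mul_mod, Nat.mul_mod q, h1, h2, h3]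
  omega

theorem ram2 (h : Hyp η η' q r s Q d d') :
    ∃ R : Ideal (ℤ√d), R ^ 2 = Ideal.span {(2 : ℤ√d)} := by
  have h4 := h.mod4
  have hd : d = η * ((q * r * s : ℕ) : ℤ) := by rw [h.hd, h.hQ]; push_cast; ring
  rcases h.η_or with he | he
  · apply Rex2
    rw [hd, he]; simpa using h4
  · have := Rex (D := d) (b := 2) (c := ((q * r * s : ℕ) : ℤ)) (by
      obtain ⟨k, hk⟩ : ∃ k, ((q * r * s : ℕ) : ℤ) = 2 * k + 1 :=
        ⟨((q * r * s : ℕ) : ℤ) / 2, by omega⟩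
      rw [hk]
      exact ⟨-k, 1, by ring⟩) (by rw [hd, he]; norm_num)
    exact_mod_cast this

open Core

theorem q_ndvd' (h : Hyp η η' q r s Q d d') : ¬ (q : ℤ) ∣ η * r := by
  intro h1
  exact h.q_ndvd h.η_or (h1.mul_right _)

theorem q_ndvd2 (h : Hyp η η' q r s Q d d') : ¬ (q : ℤ) ∣ 2 := by
  intro h1
  exact h.q_ndvd (a := 2) (Or.inr rfl) ((h1.mul_right _).mul_right _)

theorem dvd_r (h : Hyp η η' q r s Q d d') : (r : ℤ) ∣ d ∧ (r : ℤ) ∣ d' :=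
  ⟨by rw [h.hd]; exact ⟨Q * s, by ring⟩, by rw [h.hd']; exact ⟨η' * q * s, by ring⟩⟩

theorem goodQ (h : Hyp η η' q r s Q d d') : Good d d' Q :=
  ⟨h.Q_pos, q, r, η, h.qprime, h.q_ndvd2, by rw [h.hQ]; ring,
    fun h1 => h.q_ndvd' (h1.mul_right _), h.dvd_r.1, h.dvd_r.2, h.r_ndvd_Q⟩

theorem goodr (h : Hyp η η' q r s Q d d') : Good d d' r :=
  ⟨h.r_pos, r, s, 1, h.rprime, h.ndvd2, by ring, h.rprime.not_dvd_one, h.swap.dvd_r.1,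
    h.swap.dvd_r.2, h.swap.ndvd_s⟩

theorem goodQr (h : Hyp η η' q r s Q d d') : Good d d' (Q * r) :=
  ⟨mul_pos h.Q_pos h.r_pos, q, s, η * r, h.qprime, h.q_ndvd2, by rw [h.hQ]; ring, h.q_ndvd',
    h.swap.dvd_r.1, h.swap.dvd_r.2, h.swap.not_dvd_mul h.swap.r_ndvd_Q h.swap.ndvd_s⟩

variable {B : Type} [CommRing B] [IsDedekindDomain B]

theorem exists_Ar (h : Hyp η η' q r s Q d d') (c : Core d d' B) [IsDedekindDomain (ℤ√d')] :
    ∃ (E : Bˣ) (α : B), Ar c Q r s E α := by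
  obtain ⟨E', α', h1, h2, h3⟩ := h.alpha'
  refine ⟨Units.map (c.jD : ℤ√d' →* B) E', c.jD α', ?_⟩
  constructor
  · rw [← map_pow, h1, map_mul, map_intCast]; rfl
  · rw [c.σD, ← map_mul]
    rcases h3 with h3 | h3
    · left; rw [h3, map_intCast]
    · right; rw [h3, map_neg, map_intCast]
  · intro u hu
    obtain ⟨v, rfl⟩ := c.unit_D hu
    obtain ⟨k, rfl | rfl⟩ := h2 v
    · exact ⟨k, Or.inl (by rw [map_zpow])⟩
    · refine ⟨k, Or.inr ?_⟩
      rw [← map_zpow]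
      ext; simp
  · ext
    rw [Units.val_mul, sU_val]
    change c.jD E' * c.σ (c.jD E') = 1
    rw [c.σD, ← map_mul, mul_conj, units_all (fun X Y Z hZ hh => h.no_neg_d' hZ hh)]
    simp
  · intro u hu
    obtain ⟨v, rfl⟩ := c.unit_A hu
    change c.jA v * c.τ (c.jA v) = 1
    rw [c.τA, ← map_mul, mul_conj, units_all (fun X Y Z hZ hh => h.no_neg_d hZ hh)]
    simp
  · exact h.goodQ
  · exact h.goodr
  · exact h.swap.goodr
  · exact h.goodQr
  · exact h.swap.goodQr
  · exact h.hd

variable [IsDedekindDomain (ℤ√d)]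

theorem R_ne {D b : ℤ} (hb : b ≠ 0) {R : Ideal (ℤ√D)} (hR : R ^ 2 = Ideal.span {(b : ℤ√D)}) :
    R ≠ ⊥ := by
  rintro rfl
  rw [Ideal.bot_pow two_ne_zero, eq_comm, Ideal.span_singleton_eq_bot] at hR
  exact Zs.intCast_ne hb hR

theorem cl_R_sq {D b : ℤ} [IsDedekindDomain (ℤ√D)] (hb : b ≠ 0) {R : Ideal (ℤ√D)}
    (hR : R ^ 2 = Ideal.span {(b : ℤ√D)}) : cl R * cl R = 1 := by
  rw [← cl_mul (R_ne hb hR) (R_ne hb hR), ← sq, hR, cl_span]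

/-- `R₂` and `R₂R_Q` are not principal. -/
theorem R2_ne (h : Hyp η η' q r s Q d d') {RQ R2 : Ideal (ℤ√d)}
    (hRQ : RQ ^ 2 = Ideal.span {(Q : ℤ√d)}) (hR2 : R2 ^ 2 = Ideal.span {(2 : ℤ√d)})
    {e : ℕ} (he : e ≤ 1) : cl R2 * cl RQ ^ e ≠ 1 := by
  intro h1
  have hR2' : R2 ^ 2 = Ideal.span {((2 : ℤ) : ℤ√d)} := by exact_mod_cast hR2
  have n2 := R_ne (by norm_num) hR2'
  have nQ := R_ne h.Q_pos.ne' hRQ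
  rw [← cl_pow nQ, ← cl_mul n2 (pow_ne_zero e nQ),
    cl_eq_one_iff (mul_ne_zero n2 (pow_ne_zero e nQ))] at h1
  obtain ⟨x, hx, hh⟩ := h1
  have h2 : (R2 * RQ ^ e) ^ 2 = Ideal.span {((2 * (Q ^ e).natAbs : ℕ) : ℤ√d)} := by
    rw [mul_pow, hR2', ← pow_mul, mul_comm e, pow_mul, hRQ, Ideal.span_singleton_pow,
      Ideal.span_singleton_mul_span_singleton]
    congr 2
    rw [← Int.cast_natCast]
    push_cast
    rw [abs_of_pos (pow_pos h.Q_pos e)]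
    push_cast; ring
  have h3 := idnorm_sq h2
  rw [hh, Ideal.map_span, Set.image_singleton] at h3
  change _ * Ideal.span {conj d x} = _ at h3
  rw [Ideal.span_singleton_mul_span_singleton, mul_conj, ← Int.cast_natCast] at h3
  apply h.no_two x e he
  rcases span_int h3 with h4 | h4
  · rw [h4, Int.natAbs_natCast]
  · rw [h4, Int.natAbs_neg, Int.natAbs_natCast]

end Hyp


open Zs

set_option linter.unusedSectionVars false

theorem card_ker_range {G G' : Type} [Group G] [Group G'] (f : G →* G') :
    Nat.card f.ker * Nat.card f.range = Nat.card G := by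
  rw [← Subgroup.index_ker, Subgroup.card_mul_index]

theorem mem_zp {G : Type} [CommGroup G] {b : G} (hb : b * b = 1) {x : G} :
    x ∈ Subgroup.zpowers b ↔ x = 1 ∨ x = b := by
  constructor
  · rintro ⟨k, rfl⟩
    rcases Int.even_or_odd' k with ⟨n, rfl | rfl⟩
    · left; dsimp; rw [zpow_mul, zpow_ofNat, sq, hb, one_zpow]
    · right; dsimp; rw [zpow_add, zpow_mul, zpow_ofNat, sq, hb, one_zpow, one_mul, zpow_one]
  · rintro (rfl | rfl)
    · exact Subgroup.one_mem _
    · exact Subgroup.mem_zpowers _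

theorem odd_card_of_exp {G : Type} [CommGroup G] [Finite G] {m : ℕ} (hm : Odd m)
    (h : ∀ x : G, x ^ m = 1) : Odd (Nat.card G) := by
  by_contra h1
  rw [Nat.not_odd_iff_even, even_iff_two_dvd] at h1
  obtain ⟨x, hx⟩ := exists_prime_orderOf_dvd_card' 2 h1
  have h2 := orderOf_dvd_of_pow_eq_one (h x)
  rw [hx] at h2
  obtain ⟨k, rfl⟩ := hm
  omega

theorem card_two_odd {G : Type} [CommGroup G] [Finite G] {m : ℕ} (hm : Odd m) (p : G)
    (hp : p * p = 1) (hp1 : p ≠ 1) (h : ∀ x : G, x ^ m = 1 ∨ x ^ m = p) :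
    ∃ o, Odd o ∧ Nat.card G = 2 * o := by
  set f : G →* G := powMonoidHom m with hf
  have hf' : ∀ x, f x = x ^ m := fun x => rfl
  refine ⟨Nat.card f.ker, odd_card_of_exp hm ?_, ?_⟩
  · rintro ⟨x, hx⟩
    ext
    simpa [hf'] using hx
  · have h1 : f.range = Subgroup.zpowers p := by
      ext x
      rw [mem_zp hp]
      constructor
      · rintro ⟨y, rfl⟩; exact h y
      · rintro (rfl | rfl)
        · exact Subgroup.one_mem _
        · refine ⟨x, ?_⟩
          obtain ⟨k, rfl⟩ := hm
          rw [hf', pow_succ, pow_mul, sq, hp, one_pow, one_mul]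
    rw [← card_ker_range f, h1, Nat.card_zpowers, orderOf_eq_prime (by rw [sq, hp]) hp1, mul_comm]

namespace Hyp

open Core

variable {η η' q r s : ℕ} {Q d d' : ℤ}
variable {B : Type} [CommRing B] [IsDedekindDomain B] [IsDedekindDomain (ℤ√d)]
variable {c : Core d d' B} {E : Bˣ} {α : B}

theorem card_ker (h : Hyp η η' q r s Q d d') (A : Ar c Q r s E α) {RQ R2 : Ideal (ℤ√d)}
    (hRQ : RQ ^ 2 = Ideal.span {(Q : ℤ√d)}) (hR2 : R2 ^ 2 = Ideal.span {(2 : ℤ√d)})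
    [Finite (ClassGroup (ℤ√d))] :
    Nat.card (clHom c.jA c.iA).ker = 2 * orderOf (cl RQ) := by
  have hb := cl_R_sq h.Q_pos.ne' hRQ
  have ha := cl_R_sq (D := d) (b := 2) (by norm_num) (by exact_mod_cast hR2)
  rw [← Nat.card_zpowers]
  have h0 := h.R2_ne hRQ hR2 (e := 0) (by norm_num)
  have h1 := h.R2_ne hRQ hR2 (e := 1) (by norm_num)
  rw [pow_zero, mul_one] at h0
  rw [pow_one] at h1
  apply card_dbl _ _ (cl R2)
  · rw [mem_zp hb]
    rintro (h2 | h2)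
    · exact h0 h2
    · exact h1 (by rw [h2, hb])
  · intro x
    rw [mem_zp hb, mem_zp hb, MonoidHom.mem_ker]
    constructor
    · intro hx
      obtain ⟨i, j, hi, hj, hh⟩ := A.capit hRQ hR2 hx
      have hx' : x = cl RQ ^ i * cl R2 ^ j := by
        rw [← mul_one x, ← show (cl RQ ^ i * cl R2 ^ j) * (cl RQ ^ i * cl R2 ^ j) = 1 by
          rw [mul_mul_mul_comm, ← mul_pow, ← mul_pow, hb, ha, one_pow, one_pow, one_mul],
          ← mul_assoc, hh, one_mul]
      interval_cases i <;> interval_cases j <;> simp [hx']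
      · simp [ha]
      · rw [mul_left_comm, ha, mul_one]; simp
    · have e1 := A.capit_R2 hR2
      have e2 := A.capit_RQ hRQ
      rintro ((rfl | rfl) | (h2 | h2))
      · exact map_one _
      · exact e2
      · have := congrArg (clHom c.jA c.iA) h2
        rwa [map_mul, e1, one_mul, map_one] at this
      · have := congrArg (clHom c.jA c.iA) h2
        rwa [map_mul, e1, one_mul, e2] at this

theorem bQ_caseI {E0 : (ℤ√d)ˣ} {α0 : ℤ√d} (h : Hyp η η' q r s Q d d') {RQ : Ideal (ℤ√d)}
    (hRQ : RQ ^ 2 = Ideal.span {(Q : ℤ√d)}) (hα0 : α0 ^ 2 = Q * E0) : cl RQ = 1 := by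
  have : RQ = Ideal.span {α0} := by
    apply ideal_sq_inj
    rw [hRQ, Ideal.span_singleton_pow, hα0, ← Ideal.span_singleton_mul_span_singleton,
      Ideal.span_singleton_eq_top.2 E0.isUnit, Ideal.mul_top]
  rw [this, cl_span]

theorem bQ_caseII {E0 : (ℤ√d)ˣ} (h : Hyp η η' q r s Q d d') (c : Core d d' B)
    {RQ : Ideal (ℤ√d)}
    (hRQ : RQ ^ 2 = Ideal.span {(Q : ℤ√d)}) {b0 : ℤ} {αb : ℤ√d} (hαb : αb ^ 2 = b0 * E0)
    (g1 : Good d d' Q) (g2 : Good d d' (Q * b0))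
    (hu : ∀ u : (ℤ√d)ˣ, ∃ k : ℤ, u = E0 ^ k ∨ u = - E0 ^ k) : cl RQ ≠ 1 := by
  intro h1
  rw [cl_eq_one_iff (R_ne h.Q_pos.ne' hRQ)] at h1
  obtain ⟨x, hx, rfl⟩ := h1
  rw [Ideal.span_singleton_pow, Ideal.span_singleton_eq_span_singleton] at hRQ
  obtain ⟨u, hu1⟩ := hRQ.symm
  obtain ⟨k, hk⟩ := hu u
  obtain ⟨e, he, hke⟩ : ∃ e : Bˣ, c.τ e = e ∧
      Units.map (c.jA : ℤ√d →* B) u = e * Units.map (c.jA : ℤ√d →* B) (E0 ^ k) := by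
    rcases hk with rfl | rfl
    · exact ⟨1, by simp, by simp⟩
    · refine ⟨-1, by simp, ?_⟩
      ext; simp
  set F : Bˣ := Units.map (c.jA : ℤ√d →* B) E0 with hF
  rw [map_zpow, ← hF] at hke
  have h2 : (c.jA x) ^ 2 = Q * ((e * F ^ k : Bˣ) : B) := by
    rw [← map_pow, ← hu1, map_mul, map_intCast, ← hke]; rfl
  have h3 : (c.jA αb) ^ 2 = b0 * F := by
    rw [← map_pow, hαb, map_mul, map_intCast]; rfl
  rcases Int.even_or_odd' k with ⟨n, rfl | rfl⟩
  · refine c.NS g1 he (y := ((F ^ (-n) : Bˣ) : B) * c.jA x) ?_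
    rw [mul_pow, h2, ← Units.val_pow_eq_pow_val, mul_left_comm, ← Units.val_mul]
    congr 2
    rw [mul_left_comm, ← zpow_natCast, ← zpow_mul, ← zpow_add]
    rw [show -n * ((2 : ℕ) : ℤ) + 2 * n = 0 by push_cast; ring, zpow_zero, mul_one]
  · refine c.NS g2 he (y := ((F ^ (-(n + 1)) : Bˣ) : B) * (c.jA x * c.jA αb)) ?_
    rw [mul_pow, mul_pow, h2, h3, ← Units.val_pow_eq_pow_val]
    have : (F ^ (-(n+1))) ^ 2 * (e * F ^ (2 * n + 1) * F) = e := by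
      rw [mul_assoc, mul_left_comm, ← zpow_natCast, ← zpow_mul, ← zpow_add_one, ← zpow_add]
      rw [show -(n + 1) * ((2 : ℕ) : ℤ) + (2 * n + 1 + 1) = 0 by push_cast; ring, zpow_zero, mul_one]
    have h9 := congrArg Units.val this
    push_cast at h9 ⊢
    linear_combination (Q : B) * (b0 : B) * h9

/-- `x` is a norm from the fraction field. -/
def Nm (c : Core d d' B) (x : B) : Prop :=
  ∃ a b : B, a ≠ 0 ∧ b ≠ 0 ∧ x * (b * c.σ b) = a * c.σ a

theorem Nm_mul {x y : B} (hx : Nm c x) (hy : Nm c y) : Nm c (x * y) := by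
  obtain ⟨a, b, ha, hb, h⟩ := hx
  obtain ⟨a', b', ha', hb', h'⟩ := hy
  refine ⟨a * a', b * b', mul_ne_zero ha ha', mul_ne_zero hb hb', ?_⟩
  rw [map_mul, map_mul]
  linear_combination y * (b' * c.σ b') * h + a * c.σ a * h'

theorem Nm_div {x y : B} (hx : Nm c x) (hxy : Nm c (x * y)) : Nm c y := by
  obtain ⟨a, b, ha, hb, h⟩ := hx
  obtain ⟨a', b', ha', hb', h'⟩ := hxy
  refine ⟨a' * b, a * b', mul_ne_zero ha' hb, mul_ne_zero ha hb', ?_⟩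
  rw [map_mul, map_mul]
  linear_combination (-y * (b' * c.σ b')) * h + b * c.σ b * h'

theorem Nm_self {x : B} (hx : x ≠ 0) : Nm c (x * c.σ x) :=
  ⟨x, 1, hx, one_ne_zero, by simp⟩

theorem Nm_sq {x : B} (hx : x ≠ 0) (h : c.σ x = x) : Nm c (x ^ 2) := by
  have := Nm_self (c := c) hx
  rwa [h, ← sq] at this

theorem Nm_neg_one : Nm c (-1 : B) := by
  have := Nm_self (c := c) c.E1.ne_zero
  rwa [c.σE1] at this

theorem Nm_neg {x : B} (h : Nm c (-x)) : Nm c x := by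
  have := Nm_mul Nm_neg_one h
  rwa [neg_one_mul, neg_neg] at this

theorem Nm_one : Nm c (1 : B) := ⟨1, 1, one_ne_zero, one_ne_zero, by simp⟩

theorem Nm_pow {x : B} (h : Nm c x) (n : ℕ) : Nm c (x ^ n) := by
  induction n with
  | zero => rw [pow_zero]; exact Nm_one
  | succ n ih => rw [pow_succ]; exact Nm_mul ih h

theorem Nm_two : Nm c (2 : B) := by
  have := Nm_self (c := c) c.ω_ne
  rw [c.σω, mul_neg, ← sq, c.ω_sq] at this
  exact Nm_neg this

theorem exists_norm (h : Hyp η η' q r s Q d d') (A : Ar c Q r s E α) 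
    {l : ℤ} (hl : l ≠ 0) {π : ℤ√2} (hπ : π * conj 2 π = l ∨ π * conj 2 π = -(l : ℤ√2))
    {n i j k l' m0 : ℕ} {X Y Z e : ℤ} (hn : n ≠ 0) (hkl : k + l' = 1) (hm0 : m0 ≠ 0)
    (hn' : n = 2 ^ i * q ^ j * r ^ k * s ^ l' * m0 ^ 2) (he : e = 1 ∨ e = -1) (hZ : Z ≠ 0)
    (hh : (n : ℤ) * l * Z ^ 2 = e * (X ^ 2 - d' * Y ^ 2))
    {b0 : ℤ} (hb0 : b0 = r ∨ b0 = s) {E0 : Bˣ} {αb : B} (hαb : αb ^ 2 = b0 * E0)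
    (hσ : c.σ αb = αb) : ∃ a b : B, a ≠ 0 ∧ b ≠ 0 ∧ (E0 : B) * (b * c.σ b) = a * c.σ a := by
  have Nint : ∀ z : ℤ, z ≠ 0 → Nm c ((z : B) ^ 2) := fun z hz =>
    Nm_sq (c.intCast_ne hz) (map_intCast c.σ z)
  have hr0 := c.intCast_ne h.r_pos.ne'
  have hs0 := c.intCast_ne h.s_pos.ne'
  have N1 : Nm c (l : B) := by
    have hπ0 : c.j1 π ≠ 0 := by
      intro h0
      have : π = 0 := c.i1 (by rw [h0, map_zero])
      rw [this, zero_mul] at hπ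
      rcases hπ with h1 | h1
      · exact Zs.intCast_ne hl h1.symm
      · exact Zs.intCast_ne hl (neg_eq_zero.1 h1.symm)
    have := Nm_self (c := c) hπ0
    rw [c.σ1, ← map_mul] at this
    rcases hπ with h1 | h1
    · rwa [h1, map_intCast] at this
    · rw [h1, map_neg, map_intCast] at this
      exact Nm_neg this
  have NQ : Nm c (Q : B) := by
    have := Nm_self (c := c) A.α_ne
    rcases A.hασ with h1 | h1
    · rwa [h1] at this
    · rw [h1] at this; exact Nm_neg this
  have Nq : Nm c (q : B) := by
    have hQ := h.hQ
    rcases h.η_or with h1 | h1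
    · rw [h1] at hQ
      rw [hQ] at NQ
      simpa using NQ
    · rw [h1] at hQ
      rw [hQ] at NQ
      push_cast at NQ
      exact Nm_div Nm_two NQ
  have Ne : Nm c (e : B) := by
    rcases he with rfl | rfl
    · simpa using Nm_one
    · simpa using Nm_neg_one
  have NX : Nm c ((X ^ 2 - d' * Y ^ 2 : ℤ) : B) := by
    have hx : c.jD ⟨X, Y⟩ ≠ 0 := by
      intro h0
      have : (⟨X, Y⟩ : ℤ√d') = 0 := c.iD (by rw [h0, map_zero])
      have hX := congrArg Zsqrtd.re this
      have hY := congrArg Zsqrtd.im this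
      simp at hX hY
      rw [hX, hY] at hh
      have : (n : ℤ) * l * Z ^ 2 ≠ 0 :=
        mul_ne_zero (mul_ne_zero (by exact_mod_cast hn) hl) (pow_ne_zero 2 hZ)
      apply this
      rw [hh]; ring
    have := Nm_self (c := c) hx
    rwa [c.σD, ← map_mul, mul_conj, map_intCast, norm_expl] at this
  have Nn : Nm c (n : B) := by
    have h1 := Nm_mul Ne NX
    have h2 : (e : B) * ((X ^ 2 - d' * Y ^ 2 : ℤ) : B) = l * (Z ^ 2 * n) := by
      have := congrArg (Int.cast : ℤ → B) hh
      push_cast at this ⊢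
      linear_combination -this
    rw [h2] at h1
    exact Nm_div (Nint Z hZ) (Nm_div N1 h1)
  have Nrs : Nm c ((r : B) ^ k * (s : B) ^ l') := by
    have h1 : (n : B) = (2 ^ i) * ((q : B) ^ j * (((m0 : ℤ) : B) ^ 2 * ((r : B) ^ k * (s : B) ^ l'))) := by
      rw [hn']; push_cast; ring
    rw [h1] at Nn
    exact Nm_div (Nint m0 (by exact_mod_cast hm0)) (Nm_div (Nm_pow Nq j) (Nm_div (Nm_pow Nm_two i) Nn))
  have Nd : Nm c ((r : B) * s) := by
    have h1 : c.jA Zsqrtd.sqrtd ^ 2 = Q * ((r : B) * s) := by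
      rw [← map_pow, sqrtd_sq, map_intCast]
      have := congrArg (Int.cast : ℤ → B) h.hd
      rw [this]; push_cast; ring
    refine Nm_div NQ ?_
    rw [← h1]
    refine Nm_sq ?_ (c.σA _)
    intro h0
    rw [h0, zero_pow two_ne_zero] at h1
    refine mul_ne_zero A.Q_ne (mul_ne_zero ?_ ?_) h1.symm
    · exact_mod_cast hr0
    · exact_mod_cast hs0
  have Nboth : Nm c (r : B) ∧ Nm c (s : B) := by
    have : (k = 1 ∧ l' = 0) ∨ (k = 0 ∧ l' = 1) := by omega
    rcases this with ⟨rfl, rfl⟩ | ⟨rfl, rfl⟩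
    · rw [pow_one, pow_zero, mul_one] at Nrs
      exact ⟨Nrs, Nm_div Nrs Nd⟩
    · rw [pow_one, pow_zero, one_mul] at Nrs
      exact ⟨Nm_div Nrs (by rwa [mul_comm]), Nrs⟩
  have Nb : Nm c (b0 : B) ∧ (b0 : B) ≠ 0 := by
    rcases hb0 with rfl | rfl
    · exact ⟨by exact_mod_cast Nboth.1, hr0⟩
    · exact ⟨by exact_mod_cast Nboth.2, hs0⟩
  refine Nm_div (c := c) Nb.1 ?_
  rw [← hαb]
  refine Nm_sq ?_ hσ
  intro h0
  rw [h0, zero_pow two_ne_zero] at hαb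
  exact mul_ne_zero Nb.2 E0.ne_zero hαb.symm

end Hyp


open Zs

set_option linter.unusedSectionVars false

namespace Core

variable {d d' : ℤ} {B : Type} [CommRing B] [IsDedekindDomain B]

theorem fD' (c : Core d d' B) (x : B) (h : c.ρ x = x) : ∃ a, c.jD a = x := c.fD x h

theorem phi_of (c : Core d d' B) {I : Ideal B} (hI : I ≠ ⊥) {J : Ideal (ℤ√d')}
    (h : I * I.map (c.ρ : B →+* B) = J.map c.jD) : c.phi (cl I) = cl (J.map c.jD) := by
  have := pir2
  obtain ⟨J1, hJ1⟩ := ideal_norm_ext c.j1 c.τ c.ττ c.f1 I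
  obtain ⟨π, hπ⟩ := (IsPrincipalIdealRing.principal J1).principal
  have hπ' : J1 = Ideal.span {π} := hπ
  rw [hπ', map_span1] at hJ1
  have h1 := congrArg (Ideal.map (c.σ : B →+* B)) hJ1
  rw [Ideal.map_mul, Ideal.map_map, map_span_e] at h1
  have h2 : (c.σ : B →+* B).comp (c.τ : B →+* B) = (c.ρ : B →+* B) := RingHom.ext fun x => rfl
  rw [h2] at h1
  have hσ := c.map_σ_ne hI
  have hρ := map_ne_bot (inj_e c.ρ) hI
  have h3 : cl (I.map (c.σ : B →+* B)) * cl (I.map (c.ρ : B →+* B)) = 1 := by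
    rw [← cl_mul hσ hρ, h1, cl_span]
  rw [← h, cl_mul hI hρ, phi_apply, c.sg_cl hI, div_eq_mul_inv, inv_eq_of_mul_eq_one_right h3]

theorem phi_D (c : Core d d' B) [IsDedekindDomain (ℤ√d')] (x : ClassGroup B) :
    ∃ z, c.phi x = clHom c.jD c.iD z := by
  obtain ⟨I, hI, rfl⟩ := cl_surj x
  obtain ⟨J, hJ⟩ := ideal_norm_ext c.jD c.ρ c.ρρ c.fD' I
  refine ⟨cl J, ?_⟩
  have hJ0 : J ≠ ⊥ := by
    rintro rfl
    rw [Ideal.map_bot] at hJ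
    exact mul_ne_zero hI (map_ne_bot (inj_e c.ρ) hI) hJ
  rw [c.phi_of hI hJ, clHom_cl _ _ hJ0]

end Core

namespace Hyp

open Core

variable {η η' q r s : ℕ} {Q d d' : ℤ}
variable {B : Type} [CommRing B] [IsDedekindDomain B] [IsDedekindDomain (ℤ√d)]
variable {c : Core d d' B} {E : Bˣ} {α : B}

theorem beta (h : Hyp η η' q r s Q d d') (A : Ar c Q r s E α) : ∃ β : B, β ^ 2 = q * E := by
  have hα := A.hα
  rw [h.hQ] at hα
  rcases h.η_or with he | he
  · refine ⟨α, ?_⟩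
    rw [hα, he]; simp
  · have he' : (η : ℤ) = 2 := by exact_mod_cast he
    rw [he'] at hα
    push_cast at hα
    have h1 : Ideal.span {c.ω} ∣ Ideal.span {α} := by
      rw [← UniqueFactorizationMonoid.pow_dvd_pow_iff_dvd two_ne_zero, Ideal.span_singleton_pow,
        Ideal.span_singleton_pow, c.ω_sq, hα, Ideal.dvd_span_singleton, Ideal.mem_span_singleton]
      exact ⟨q * E, by ring⟩
    rw [Ideal.dvd_span_singleton, Ideal.mem_span_singleton] at h1
    obtain ⟨β, rfl⟩ := h1
    refine ⟨β, ?_⟩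
    rw [mul_pow, c.ω_sq, mul_assoc] at hα
    exact mul_left_cancel₀ c.two_ne hα

theorem span_unit (x : B) (u : Bˣ) : Ideal.span {x * (u : B)} = Ideal.span {x} := by
  rw [← Ideal.span_singleton_mul_span_singleton, Ideal.span_singleton_eq_top.2 u.isUnit,
    Ideal.mul_top]

theorem D_class (h : Hyp η η' q r s Q d d') (A : Ar c Q r s E α) {Rr Rs : Ideal (ℤ√d)}
    (hRr : Rr ^ 2 = Ideal.span {((r : ℤ) : ℤ√d)}) (hRs : Rs ^ 2 = Ideal.span {((s : ℤ) : ℤ√d)})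
    {I : Ideal (ℤ√d')} {n i j k l m : ℕ} (hm : m ≠ 0) (hI : I ^ 2 = Ideal.span {(n : ℤ√d')})
    (hn : n = 2 ^ i * q ^ j * r ^ k * s ^ l * m ^ 2) :
    cl (I.map c.jD) = clHom c.jA c.iA (cl Rr) ^ k * clHom c.jA c.iA (cl Rs) ^ l := by
  obtain ⟨β, hβ⟩ := h.beta A
  have nr := R_ne h.r_pos.ne' hRr
  have ns := R_ne h.s_pos.ne' hRs
  have nr' := map_ne_bot c.iA nr
  have ns' := map_ne_bot c.iA ns
  have hq0 : (q : B) ≠ 0 := by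
    have := c.intCast_ne h.q_pos.ne'
    exact_mod_cast this
  have nβ : β ≠ 0 := by
    intro h0
    rw [h0, zero_pow two_ne_zero] at hβ
    exact mul_ne_zero hq0 E.ne_zero hβ.symm
  have nm : (m : B) ≠ 0 := by
    have := c.intCast_ne (n := m) (by exact_mod_cast hm)
    exact_mod_cast this
  have e1 : (Rr.map c.jA) ^ 2 = Ideal.span {(r : B)} := by
    rw [← Ideal.map_pow, hRr, map_span1, map_intCast]; simp
  have e2 : (Rs.map c.jA) ^ 2 = Ideal.span {(s : B)} := by
    rw [← Ideal.map_pow, hRs, map_span1, map_intCast]; simp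
  have e3 : (Ideal.span {β}) ^ 2 = Ideal.span {(q : B)} := by
    rw [Ideal.span_singleton_pow, hβ, span_unit]
  have e4 : (Ideal.span {c.ω}) ^ 2 = Ideal.span {(2 : B)} := by
    rw [Ideal.span_singleton_pow, c.ω_sq]
  have key : I.map c.jD = Ideal.span {c.ω ^ i * β ^ j * m} * ((Rr.map c.jA) ^ k * (Rs.map c.jA) ^ l) := by
    apply ideal_sq_inj
    rw [← Ideal.map_pow, hI, map_span1, map_natCast, mul_pow, mul_pow, ← pow_mul, ← pow_mul,
      mul_comm k, mul_comm l, pow_mul, pow_mul, e1, e2, Ideal.span_singleton_pow,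
      Ideal.span_singleton_pow, Ideal.span_singleton_pow, Ideal.span_singleton_mul_span_singleton,
      Ideal.span_singleton_mul_span_singleton,
      show (c.ω ^ i * β ^ j * (m : B)) ^ 2 = (c.ω ^ 2) ^ i * (β ^ 2) ^ j * m ^ 2 by ring,
      c.ω_sq, hβ, show (2 : B) ^ i * (q * E) ^ j * m ^ 2 * (r ^ k * s ^ l) =
        (2 ^ i * q ^ j * r ^ k * s ^ l * m ^ 2) * ((E ^ j : Bˣ) : B) by push_cast; ring, span_unit, hn]
    push_cast
    rfl
  have np := pow_ne_zero k nr'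
  have ns2 := pow_ne_zero l ns'
  rw [key, cl_mul _ (mul_ne_zero np ns2), cl_span, one_mul, cl_mul np ns2, cl_pow nr', cl_pow ns',
    clHom_cl _ _ nr, clHom_cl _ _ ns]
  rw [Ne, Ideal.span_singleton_eq_bot]
  exact mul_ne_zero (mul_ne_zero (pow_ne_zero _ c.ω_ne) (pow_ne_zero _ nβ)) nm

theorem cr_sq {b : ℤ} (hb : b ≠ 0) {R : Ideal (ℤ√d)} (hR : R ^ 2 = Ideal.span {(b : ℤ√d)}) :
    clHom c.jA c.iA (cl R) * clHom c.jA c.iA (cl R) = 1 := by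
  rw [← map_mul, cl_R_sq hb hR, map_one]

theorem cs_eq (h : Hyp η η' q r s Q d d') (A : Ar c Q r s E α) {RQ Rr Rs : Ideal (ℤ√d)}
    (hRQ : RQ ^ 2 = Ideal.span {(Q : ℤ√d)})
    (hRr : Rr ^ 2 = Ideal.span {((r : ℤ) : ℤ√d)}) (hRs : Rs ^ 2 = Ideal.span {((s : ℤ) : ℤ√d)}) :
    clHom c.jA c.iA (cl Rs) = clHom c.jA c.iA (cl Rr) := by
  have nr := R_ne h.r_pos.ne' hRr
  have ns := R_ne h.s_pos.ne' hRs
  have nQ := R_ne h.Q_pos.ne' hRQ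
  have h1 : RQ * (Rr * Rs) = Ideal.span {Zsqrtd.sqrtd} := by
    apply ideal_sq_inj
    rw [mul_pow, mul_pow, hRQ, hRr, hRs, Ideal.span_singleton_mul_span_singleton,
      Ideal.span_singleton_mul_span_singleton, Ideal.span_singleton_pow, sqrtd_sq, ← Int.cast_mul,
      ← Int.cast_mul, ← mul_assoc, ← h.hd]
  have h2 := congrArg (fun z => clHom c.jA c.iA (cl z)) h1
  rw [cl_span, map_one, cl_mul nQ (mul_ne_zero nr ns), cl_mul nr ns, map_mul, map_mul,
    A.capit_RQ hRQ, one_mul] at h2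
  have h3 := cr_sq (c := c) h.r_pos.ne' hRr
  exact mul_left_cancel (h2.trans h3.symm)

theorem cr_caseII {b : ℤ} {R : Ideal (ℤ√d)} (hR : R ^ 2 = Ideal.span {(b : ℤ√d)})
    {E0 : (ℤ√d)ˣ} {αb : ℤ√d} (hαb : αb ^ 2 = b * E0) : cl R = 1 := by
  have : R = Ideal.span {αb} := by
    apply ideal_sq_inj
    rw [hR, Ideal.span_singleton_pow, hαb, ← Ideal.span_singleton_mul_span_singleton,
      Ideal.span_singleton_eq_top.2 E0.isUnit, Ideal.mul_top]
  rw [this, cl_span]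

theorem phi_pow (h : Hyp η η' q r s Q d d') (A : Ar c Q r s E α) [IsDedekindDomain (ℤ√d')]
    {RQ Rr Rs : Ideal (ℤ√d)} (hRQ : RQ ^ 2 = Ideal.span {(Q : ℤ√d)})
    (hRr : Rr ^ 2 = Ideal.span {((r : ℤ) : ℤ√d)}) (hRs : Rs ^ 2 = Ideal.span {((s : ℤ) : ℤ√d)})
    {m : ℕ} (hz : ∀ z : ClassGroup (ℤ√d'), (z ^ m) ^ 2 = 1) (x : ClassGroup B) :
    c.phi x ^ m = 1 ∨ c.phi x ^ m = clHom c.jA c.iA (cl Rr) := by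
  have hneg : ∀ X Y Z : ℤ, Z ≠ 0 → X ^ 2 - d' * Y ^ 2 = - Z ^ 2 → False :=
    fun _ _ _ => h.no_neg_d'
  obtain ⟨z, hzx⟩ := c.phi_D x
  obtain ⟨I, hI0, hI, n, hn0, hn⟩ := two_torsion hneg (hz z)
  obtain ⟨i, j, k, l, m0, hi, hj, hk, hl, hm0, hnn⟩ := h.ram_d' hn0 hn
  rw [hzx, ← map_pow, ← hI, clHom_cl _ _ hI0, h.D_class A hRr hRs hm0 hn hnn,
    h.cs_eq A hRQ hRr hRs, ← pow_add, ← mem_zp (cr_sq h.r_pos.ne' hRr)]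
  exact Subgroup.npow_mem_zpowers _ _

end Hyp


open Zs

set_option linter.unusedSectionVars false

namespace Hyp

open Core

variable {η η' q r s : ℕ} {Q d d' : ℤ}
variable {B : Type} [CommRing B] [IsDedekindDomain B] [IsDedekindDomain (ℤ√d)]
variable {c : Core d d' B} {E : Bˣ} {α : B}

theorem cr_ne (h : Hyp η η' q r s Q d d') (A : Ar c Q r s E α) {Rr : Ideal (ℤ√d)}
    (hRr : Rr ^ 2 = Ideal.span {((r : ℤ) : ℤ√d)}) {E0 ξ : Bˣ} (hξ : ξ ^ 2 = E0 * E)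
    (hu : ∀ u : Bˣ, c.σ u = u → ∃ k : ℤ, u = E0 ^ k ∨ u = - E0 ^ k) :
    clHom c.jA c.iA (cl Rr) ≠ 1 := by
  intro h1
  have nr := R_ne h.r_pos.ne' hRr
  rw [clHom_cl _ _ nr, cl_eq_one_iff (map_ne_bot c.iA nr)] at h1
  obtain ⟨a, ha, h1⟩ := h1
  have e1 : (Ideal.span {a}) ^ 2 = Ideal.span {((r : ℤ) : B)} := by
    rw [← h1, ← Ideal.map_pow, hRr, map_span1, map_intCast]
  have hr0 := c.intCast_ne h.r_pos.ne'
  have key : ∀ f : B ≃+* B, (∀ x, f (f x) = x) → ∃ u : Bˣ, a * f a = u * ((r : ℤ) : B) ∧ f u = u := by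
    intro f hf
    have e2 : Ideal.span {f a} = Ideal.span {a} := by
      apply ideal_sq_inj
      rw [← map_span_e, ← Ideal.map_pow, e1, map_span_e, map_intCast]
    obtain ⟨u, hu⟩ := c.unit_of_span (x := a * f a) (y := ((r : ℤ) : B)) (by
      rw [← Ideal.span_singleton_mul_span_singleton, e2, ← sq, e1])
    refine ⟨u, hu, mul_right_cancel₀ hr0 ?_⟩
    rw [← hu]
    have := congrArg f hu
    rw [map_mul, map_mul, hf, map_intCast] at this
    rw [← this, mul_comm]
  obtain ⟨w, hw, hw'⟩ := key c.σ c.σσ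
  obtain ⟨w1, hw1, hw1'⟩ := key c.τ c.ττ
  obtain ⟨w2, hw2, hw2'⟩ := key c.ρ c.ρρ
  have N1 := A.normA w hw'
  have N2 := congrArg c.τ hw
  rw [map_mul, map_mul, map_intCast, ← c.στ] at N2
  rw [c.ρ_apply] at hw2
  have h3 : a ^ 2 = ((r : ℤ) : B) * ((w * w1 * w2 : Bˣ) : B) := by
    apply mul_left_cancel₀ (pow_ne_zero 2 hr0)
    push_cast at *
    have h4 : (a * c.σ a) * (c.τ a * c.σ (c.τ a)) = (r : B) ^ 2 := by
      rw [hw, N2]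
      linear_combination (r : B) ^ 2 * N1
    calc (r : B) ^ 2 * a ^ 2 = (a * c.σ a) * (a * c.τ a) * (a * c.σ (c.τ a)) := by
          rw [← h4]; ring
      _ = _ := by rw [hw, hw1, hw2]; ring
  obtain ⟨k, hk⟩ := hu w hw'
  obtain ⟨m, hm⟩ := A.units w2 hw2'
  have hE0 : E0 = ξ ^ 2 * E⁻¹ := by rw [hξ, mul_inv_cancel_right]
  obtain ⟨v, hv, hv'⟩ : ∃ v : Bˣ, c.tU v = v ∧ w * w1 * w2 = v * (E0 ^ k * E ^ m) := by
    have t1 : c.tU w1 = w1 := Units.ext hw1'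
    rcases hk with rfl | rfl <;> rcases hm with rfl | rfl
    · exact ⟨w1, t1, by rw [mul_assoc, mul_left_comm]⟩
    · exact ⟨-w1, by rw [c.tU_neg, t1], by rw [mul_neg, neg_mul, mul_assoc, mul_left_comm]⟩
    · exact ⟨-w1, by rw [c.tU_neg, t1], by rw [neg_mul, neg_mul, neg_mul, mul_assoc, mul_left_comm]⟩
    · exact ⟨w1, t1, by rw [neg_mul, neg_mul, mul_neg, neg_neg, mul_assoc, mul_left_comm]⟩
  refine A.NSL A.gr A.gQr hv (k := m - k) (y := a * ((ξ ^ (-k) : Bˣ) : B)) ?_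
  rw [mul_pow, h3, hv', mul_assoc, ← Units.val_pow_eq_pow_val, ← Units.val_mul]
  congr 2
  rw [hE0, mul_zpow, ← zpow_natCast, ← zpow_natCast, ← zpow_mul, ← zpow_mul, inv_zpow, zpow_sub,
    mul_assoc, mul_assoc, mul_assoc]
  congr 1
  rw [mul_comm (ξ ^ _), mul_assoc, mul_assoc, ← zpow_add,
    show -k * ((2 : ℕ) : ℤ) + ((2 : ℕ) : ℤ) * k = 0 by ring, zpow_zero, mul_one, mul_comm]

theorem cr_mem (h : Hyp η η' q r s Q d d') (A : Ar c Q r s E α) [IsDedekindDomain (ℤ√d')]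
    {RQ Rr Rs : Ideal (ℤ√d)} (hRQ : RQ ^ 2 = Ideal.span {(Q : ℤ√d)})
    (hRr : Rr ^ 2 = Ideal.span {((r : ℤ) : ℤ√d)}) (hRs : Rs ^ 2 = Ideal.span {((s : ℤ) : ℤ√d)})
    {m : ℕ} (hm : Odd m) (hz : ∀ z : ClassGroup (ℤ√d'), (z ^ m) ^ 2 = 1) :
    clHom c.jA c.iA (cl Rr) ∈ c.phi.range := by
  obtain ⟨l, 𝔩, I, n, π, i, j, k, l', m0, X, Y, Z, e, hl, hs1, hs2, hπ, hI0, hI, hn, hn0, hi, hj,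
    hkl, hm0, hnn, -⟩ := h.exists_l hm hz
  have h𝔩0 : 𝔩 ≠ ⊥ := by
    rintro rfl
    rw [Ideal.bot_mul, eq_comm, Ideal.span_singleton_eq_bot] at hs1
    exact Zs.intCast_ne hl hs1
  set L : Ideal B := 𝔩.map c.jD with hL
  set L' : Ideal B := (𝔩.map (conj d' : ℤ√d' →+* ℤ√d')).map c.jD with hL'
  have hL0 : L ≠ ⊥ := map_ne_bot c.iD h𝔩0
  have a1 : L * L' = Ideal.span {(l : B)} := by
    rw [hL, hL', ← Ideal.map_mul, hs1, map_span1, map_intCast]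
  have a2 : L ⊔ L' = ⊤ := by
    rw [hL, hL', ← Ideal.map_sup, hs2, Ideal.map_top]
  have a3 : Ideal.span {c.j1 π} * Ideal.span {c.j1 (conj 2 π)} = Ideal.span {(l : B)} := by
    rw [Ideal.span_singleton_mul_span_singleton, ← map_mul]
    rcases hπ with h1 | h1
    · rw [h1, map_intCast]
    · rw [h1, map_neg, map_intCast, Ideal.span_singleton_neg]
  have b1 : L.map (c.ρ : B →+* B) = L := by
    rw [hL, Ideal.map_map]
    congr 1
    refine RingHom.ext fun x => ?_
    change c.σ (c.τ (c.jD x)) = c.jD x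
    rw [c.τD, c.σD, conj_conj]
  have b2 : (Ideal.span {c.j1 π}).map (c.ρ : B →+* B) = Ideal.span {c.j1 (conj 2 π)} := by
    rw [map_span_e, c.ρ_apply, c.τ1, c.σ1]
  set 𝔏 : Ideal B := L ⊔ Ideal.span {c.j1 π} with h𝔏
  have h𝔏0 : 𝔏 ≠ ⊥ := by
    intro h0
    exact hL0 (le_bot_iff.1 (h0 ▸ le_sup_left))
  have key : 𝔏 * 𝔏.map (c.ρ : B →+* B) = 𝔩.map c.jD := by
    rw [← hL, h𝔏, Ideal.map_sup, b1, b2, Ideal.sup_mul, Ideal.mul_sup, Ideal.mul_sup, a3, ← a1,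
      mul_comm (Ideal.span {c.j1 π}), ← Ideal.mul_sup, ← Ideal.mul_sup, ← Ideal.mul_sup]
    have : L ⊔ Ideal.span {c.j1 (conj 2 π)} ⊔ (Ideal.span {c.j1 π} ⊔ L') = ⊤ := by
      rw [eq_top_iff, ← a2]
      exact sup_le (le_sup_left.trans le_sup_left) (le_sup_right.trans le_sup_right)
    rw [this, Ideal.mul_top]
  refine ⟨cl 𝔏 ^ m, ?_⟩
  rw [map_pow, c.phi_of h𝔏0 key, ← clHom_cl _ c.iD h𝔩0, ← map_pow, hI, clHom_cl _ _ hI0,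
    h.D_class A hRr hRs hm0 hn hnn, h.cs_eq A hRQ hRr hRs, ← pow_add, hkl, pow_one]

/-- The comparison of class numbers. -/
theorem final (h : Hyp η η' q r s Q d d') (c : Core d d' B) [IsDedekindDomain (ℤ√d')]
    [Finite (ClassGroup (ℤ√d))] [Finite (ClassGroup (ℤ√d'))] [Finite (ClassGroup B)]
    {a : Pell.Solution₁ d} (ha : Pell.IsFundamental a) :
    (IsSquare (Q * (2 * (a.x - 1))) →
      ∃ o, Odd o ∧ Nat.card (ClassGroup B) = Nat.card (ClassGroup (ℤ√d)) * (2 * o)) ∧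
    (¬ IsSquare (Q * (2 * (a.x - 1))) →
      ∃ o, Odd o ∧ Nat.card (ClassGroup B) = Nat.card (ClassGroup (ℤ√d)) * o) := by
  obtain ⟨E, α, A⟩ := h.exists_Ar c
  obtain ⟨RQ, hRQ⟩ := h.ramQ
  obtain ⟨R2, hR2⟩ := h.ram2
  obtain ⟨Rr, hRr⟩ := h.ramR
  obtain ⟨Rs, hRs⟩ := h.swap.ramR
  obtain ⟨m, hm, hz⟩ := h.odd_exp
  obtain ⟨E0, hE0, hcase⟩ := h.alpha ha
  set F : Bˣ := Units.map (c.jA : ℤ√d →* B) E0 with hF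
  have hFv : (F : B) = c.jA E0 := rfl
  have hσF : c.σ F = F := by rw [hFv, c.σA]
  have hu : ∀ u : Bˣ, c.σ u = u → ∃ k : ℤ, u = F ^ k ∨ u = - F ^ k := by
    intro u hu
    obtain ⟨v, hv⟩ := c.unit_A hu
    obtain ⟨k, hk⟩ := hE0 v
    refine ⟨k, ?_⟩
    have hv' : u = Units.map (c.jA : ℤ√d →* B) v := hv.symm
    rw [hv', hF, ← map_zpow]
    rcases hk with rfl | rfl
    · left; rfl
    · right; ext; simp
  have cA : Nat.card (ClassGroup (ℤ√d)) = 2 * orderOf (cl RQ) * Nat.card c.H := by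
    rw [← card_ker_range (clHom c.jA c.iA), h.card_ker A hRQ hR2]; rfl
  have cK := A.card_K hRQ hR2
  have cB := card_ker_range c.phi
  have hpow := fun x => h.phi_pow A hRQ hRr hRs hz x
  rcases hcase with ⟨hsq, α0, hα0⟩ | ⟨hsq, αb, hαb⟩
  · refine ⟨fun _ => ?_, fun h1 => absurd hsq h1⟩
    have hα0' : (c.jA α0) ^ 2 = Q * F := by
      rw [← map_pow, hα0, map_mul, map_intCast, hFv]
    obtain ⟨ξ, hξ, hξ'⟩ := A.caseI_xi (c.σA α0) hα0'
    have k0 := A.A0_caseI hu hξ'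
    have o1 : orderOf (cl RQ) = 1 := by rw [h.bQ_caseI hRQ hα0, orderOf_one]
    have hne := h.cr_ne A hRr hξ hu
    have hmem := h.cr_mem A hRQ hRr hRs hm hz
    obtain ⟨o, ho, hc⟩ := card_two_odd (G := c.phi.range) hm ⟨_, hmem⟩
      (Subtype.ext (cr_sq h.r_pos.ne' hRr)) (fun h1 => hne (congrArg Subtype.val h1)) (by
        rintro ⟨_, x, rfl⟩
        rcases hpow x with h1 | h1
        · left; exact Subtype.ext h1
        · right; exact Subtype.ext h1)
    refine ⟨o, ho, ?_⟩
    rw [← cB, k0, cK, cA, o1, hc]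
  · refine ⟨fun h1 => absurd h1 hsq, fun _ => ?_⟩
    obtain ⟨b0, hb0, hαb'⟩ : ∃ b0 : ℤ, (b0 = r ∨ b0 = s) ∧ αb ^ 2 = b0 * E0 := by
      rcases hαb with h1 | h1
      · exact ⟨r, Or.inl rfl, by exact_mod_cast h1⟩
      · exact ⟨s, Or.inr rfl, by exact_mod_cast h1⟩
    have g : Good d d' b0 ∧ Good d d' (Q * b0) := by
      rcases hb0 with rfl | rfl
      · exact ⟨A.gr, A.gQr⟩
      · exact ⟨A.gs, A.gQs⟩
    have hαB : (c.jA αb) ^ 2 = b0 * F := by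
      rw [← map_pow, hαb', map_mul, map_intCast, hFv]
    obtain ⟨l, 𝔩, I, n, π, i, j, k, l', m0, X, Y, Z, e, hl, hs1, hs2, hπ, hI0, hI, hn, hn0, hi, hj,
      hkl, hm0, hnn, he, hZ, hh⟩ := h.exists_l hm hz
    obtain ⟨x, y, hx, hy, hxy⟩ := h.exists_norm A hl hπ hn0 hkl hm0 hnn he hZ hh hb0 hαB (c.σA αb)
    have k0 := A.A0_caseII g.1 g.2 hαB hσF hu hx hy hxy
    have o1 : orderOf (cl RQ) = 2 := by
      refine orderOf_eq_prime ?_ (h.bQ_caseII c hRQ hαb' A.gQ g.2 hE0)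
      rw [sq, cl_R_sq h.Q_pos.ne' hRQ]
    have hcr : clHom c.jA c.iA (cl Rr) = 1 := by
      rcases hb0 with rfl | rfl
      · rw [cr_caseII hRr hαb', map_one]
      · rw [← h.cs_eq A hRQ hRr hRs, cr_caseII hRs hαb', map_one]
    refine ⟨Nat.card c.phi.range, odd_card_of_exp hm ?_, ?_⟩
    · rintro ⟨_, x, rfl⟩
      apply Subtype.ext
      rcases hpow x with h1 | h1
      · exact h1
      · rw [hcr] at h1; exact h1
    · rw [← cB, k0, cK, cA, o1]; ring

end Hyp


open Zs NumberField

set_option linter.unusedSectionVars false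

namespace Zs

theorem rat_sq {D : ℤ} (hD : Squarefree D) {v : ℚ} {N : ℤ} (h : (D : ℚ) * v ^ 2 = N) :
    ∃ n : ℤ, v = n := by
  have hden : (v.den : ℚ) ≠ 0 := by exact_mod_cast v.den_nz
  have h1 : D * v.num ^ 2 = N * (v.den : ℤ) ^ 2 := by
    have h2 := Rat.num_div_den v
    rw [← h2, div_pow, mul_div_assoc', div_eq_iff (pow_ne_zero 2 hden)] at h
    exact_mod_cast h
  have h3 : (v.den : ℤ) * v.den ∣ D := by
    have : IsCoprime ((v.den : ℤ) ^ 2) (v.num ^ 2) := by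
      apply IsCoprime.pow
      rw [Int.isCoprime_iff_gcd_eq_one, Int.gcd_comm]
      exact v.reduced
    rw [← sq]
    exact this.dvd_of_dvd_mul_right ⟨N, by rw [h1]; ring⟩
  have h4 := hD _ h3
  have h5 : v.den = 1 := by
    rcases Int.isUnit_iff.1 h4 with h5 | h5 <;> omega
  exact ⟨v.num, (Rat.den_eq_one_iff v).1 h5 ▸ rfl⟩

theorem half_int {D : ℤ} (hD : Squarefree D) (hD4 : D % 4 = 2 ∨ D % 4 = 3) {a c : ℚ} {u N : ℤ}
    (h1 : 2 * a = u) (h2 : a ^ 2 - D * c ^ 2 = N) : (∃ n : ℤ, a = n) ∧ ∃ n : ℤ, c = n := by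
  obtain ⟨v, hv⟩ := rat_sq hD (v := 2 * c) (N := u ^ 2 - 4 * N) (by
    push_cast; rw [← h1, ← h2]; ring)
  have h3 : u ^ 2 - D * v ^ 2 = 4 * N := by
    have : (u : ℚ) ^ 2 - D * v ^ 2 = 4 * N := by
      rw [← h1, ← hv, ← h2]; ring
    exact_mod_cast this
  have key : u % 2 = 0 ∧ v % 2 = 0 := by
    have h4 := congrArg (· % 4) h3
    rcases Int.even_or_odd' u with ⟨x, rfl | rfl⟩ <;> rcases Int.even_or_odd' v with ⟨y, rfl | rfl⟩
    · omega
    · exfalso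
      have h5 : D * (2 * y + 1) ^ 2 = 4 * (D * (y ^ 2 + y)) + D := by ring
      have h6 : (2 * x) ^ 2 = 4 * x ^ 2 := by ring
      rw [h5, h6] at h3; omega
    · exfalso
      have h5 : D * (2 * y) ^ 2 = 4 * (D * y ^ 2) := by ring
      have h6 : (2 * x + 1) ^ 2 = 4 * (x ^ 2 + x) + 1 := by ring
      rw [h5, h6] at h3; omega
    · exfalso
      have h5 : D * (2 * y + 1) ^ 2 = 4 * (D * (y ^ 2 + y)) + D := by ring
      have h6 : (2 * x + 1) ^ 2 = 4 * (x ^ 2 + x) + 1 := by ring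
      rw [h5, h6] at h3; omega
  obtain ⟨⟨x, hx⟩, ⟨y, hy⟩⟩ := And.imp Int.dvd_of_emod_eq_zero Int.dvd_of_emod_eq_zero key
  refine ⟨⟨x, ?_⟩, ⟨y, ?_⟩⟩
  · rw [hx] at h1; push_cast at h1; linarith
  · rw [hy] at hv; push_cast at hv; linarith

theorem rat_nonsq {D : ℤ} (hD : ∀ n : ℤ, D ≠ n * n) (x : ℚ) : x ^ 2 ≠ D := by
  intro h
  have h1 : IsIntegral ℤ x := by
    refine IsIntegral.of_pow (n := 2) (by norm_num) ?_
    rw [h]; exact isIntegral_algebraMap (R := ℤ) (A := ℚ) (x := D)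
  obtain ⟨n, hn⟩ := IsIntegrallyClosed.isIntegral_iff.1 h1
  apply hD n
  rw [← hn] at h
  simp at h
  rw [← sq]
  exact_mod_cast h.symm

open Polynomial in
theorem quad_int {D : ℤ} (hD : Squarefree D) (hD4 : D % 4 = 2 ∨ D % 4 = 3)
    (hns : ∀ n : ℤ, D ≠ n * n) {t : ℝ} (ht : t ^ 2 = D) {a c : ℚ}
    (hx : IsIntegral ℤ (a + c * t : ℝ)) : ∃ m n : ℤ, a = m ∧ c = n := by
  by_cases hc : c = 0
  · subst hc
    have h1 : IsIntegral ℤ a := by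
      have h2 : IsIntegral ℤ (algebraMap ℚ ℝ a) := by simpa using hx
      exact (isIntegral_algebraMap_iff (algebraMap ℚ ℝ).injective).1 h2
    obtain ⟨n, hn⟩ := IsIntegrallyClosed.isIntegral_iff.1 h1
    exact ⟨n, 0, by simpa using hn.symm, by simp⟩
  obtain ⟨b1, hb1⟩ : ∃ b1 : ℚ, b1 = -(2 * a) := ⟨_, rfl⟩
  obtain ⟨b0, hb0⟩ : ∃ b0 : ℚ, b0 = a ^ 2 - D * c ^ 2 := ⟨_, rfl⟩
  set p : ℚ[X] := X ^ 2 + C b1 * X + C b0 with hp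
  have hdeg : p.natDegree = 2 := by rw [hp]; compute_degree!
  have hmon : p.Monic := by rw [hp]; monicity!
  have hirr : Irreducible p := by
    apply irreducible_of_degree_le_three_of_not_isRoot
    · rw [hdeg]; simp
    · intro x hxr
      rw [IsRoot, hp] at hxr
      simp [hb1, hb0] at hxr
      apply rat_nonsq hns ((x - a) / c)
      rw [div_pow, div_eq_iff (pow_ne_zero 2 hc)]
      linear_combination hxr
  have hroot : aeval (a + c * t : ℝ) p = 0 := by
    rw [hp]; simp [hb1, hb0]
    linear_combination (c : ℝ) ^ 2 * ht
  have hmin := minpoly.eq_of_irreducible_of_monic hirr hroot hmon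
  rw [minpoly.isIntegrallyClosed_eq_field_fractions' ℚ hx] at hmin
  have c1 := congrArg (fun f => coeff f 1) hmin
  have c0 := congrArg (fun f => coeff f 0) hmin
  rw [coeff_map] at c1 c0
  simp [hp, coeff_X] at c1 c0
  obtain ⟨⟨m, hm⟩, ⟨n, hn⟩⟩ := half_int hD hD4 (a := a) (c := c)
    (u := -(minpoly ℤ (a + c * t : ℝ)).coeff 1) (N := (minpoly ℤ (a + c * t : ℝ)).coeff 0)
    (by push_cast; rw [← c1, hb1, neg_neg]) (by rw [← c0, hb0])
  exact ⟨m, n, hm, hn⟩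

/-- Isomorphic rings have isomorphic class groups. -/
theorem cl_equiv {R S : Type} [CommRing R] [CommRing S] [IsDedekindDomain R] [IsDedekindDomain S]
    (e : R ≃+* S) : Nonempty (ClassGroup R ≃* ClassGroup S) := by
  have i1 : Function.Injective (e : R →+* S) := e.injective
  have i2 : Function.Injective (e.symm : S →+* R) := e.symm.injective
  refine ⟨MonoidHom.toMulEquiv (clHom (e : R →+* S) i1) (clHom (e.symm : S →+* R) i2) ?_ ?_⟩
  · ext x
    obtain ⟨I, hI, rfl⟩ := cl_surj x
    rw [MonoidHom.comp_apply, clHom_cl _ _ hI, clHom_cl _ _ (map_ne_bot i1 hI), Ideal.map_map,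
      RingEquiv.symm_comp, Ideal.map_id, MonoidHom.id_apply]
  · ext x
    obtain ⟨I, hI, rfl⟩ := cl_surj x
    rw [MonoidHom.comp_apply, clHom_cl _ _ hI, clHom_cl _ _ (map_ne_bot i2 hI), Ideal.map_map,
      RingEquiv.comp_symm, Ideal.map_id, MonoidHom.id_apply]

theorem mem_adj {D : ℤ} {t : ℝ} (ht : t ^ 2 = D) {x : ℝ}
    (hx : x ∈ IntermediateField.adjoin ℚ {t}) : ∃ a c : ℚ, x = a + c * t := by
  have halg : IsIntegral ℚ t := by
    refine IsIntegral.of_pow (n := 2) (by norm_num) ?_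
    rw [ht]
    exact_mod_cast (isIntegral_algebraMap (R := ℚ) (A := ℝ) (x := (D : ℚ)))
  rw [← IntermediateField.mem_toSubalgebra,
    IntermediateField.adjoin_simple_toSubalgebra_of_isAlgebraic halg.isAlgebraic] at hx
  induction hx using Algebra.adjoin_induction with
  | mem x hx => exact ⟨0, 1, by simpa using hx⟩
  | algebraMap a => exact ⟨a, 0, by simp⟩
  | add x y _ _ hx hy =>
    obtain ⟨a, c, rfl⟩ := hx
    obtain ⟨a', c', rfl⟩ := hy
    exact ⟨a + a', c + c', by push_cast; ring⟩
  | mul x y _ _ hx hy =>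
    obtain ⟨a, c, rfl⟩ := hx
    obtain ⟨a', c', rfl⟩ := hy
    refine ⟨a * a' + D * c * c', a * c' + c * a', ?_⟩
    push_cast
    linear_combination (c : ℝ) * c' * ht

theorem t_int {D : ℤ} {R : Type} [CommRing R] {t : R} (ht : t ^ 2 = D) : IsIntegral ℤ t := by
  refine IsIntegral.of_pow (n := 2) (by norm_num) ?_
  rw [ht]; exact isIntegral_algebraMap (R := ℤ) (A := R) (x := D)

theorem irr {D : ℤ} (hns : ∀ n : ℤ, D ≠ n * n) {t : ℝ} (ht : t ^ 2 = D) {a c : ℚ}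
    (h : (a + c * t : ℝ) = 0) : a = 0 ∧ c = 0 := by
  by_cases hc : c = 0
  · subst hc
    simpa using h
  · exfalso
    apply rat_nonsq hns (-a / c)
    have : t = ((-a / c : ℚ) : ℝ) := by
      push_cast
      have hc' : (c : ℝ) ≠ 0 := by exact_mod_cast hc
      field_simp
      linarith
    rw [this] at ht
    exact_mod_cast ht

theorem oK {D : ℤ} (hD : Squarefree D) (hD4 : D % 4 = 2 ∨ D % 4 = 3)
    (hns : ∀ n : ℤ, D ≠ n * n) {t : ℝ} (ht : t ^ 2 = D) :
    ∃ _ : IsDedekindDomain (ℤ√D), Finite (ClassGroup (ℤ√D)) ∧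
      Nat.card (ClassGroup (𝓞 (IntermediateField.adjoin ℚ {t}))) = Nat.card (ClassGroup (ℤ√D)) := by
  have halg : IsIntegral ℚ t := (t_int ht).tower_top
  set K := IntermediateField.adjoin ℚ {t} with hK
  have : FiniteDimensional ℚ K := IntermediateField.adjoin.finiteDimensional halg
  have : NumberField K := ⟨⟩
  have htK : t ∈ K := IntermediateField.mem_adjoin_simple_self ℚ t
  set tK : K := ⟨t, htK⟩ with htK'
  have htK2 : tK * tK = (D : K) := by
    apply Subtype.ext
    push_cast
    rw [← ht, sq]
  let f : ℤ√D →+* K := Zsqrtd.lift ⟨tK, htK2⟩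
  have hf : Function.Injective f := Zsqrtd.lift_injective _ hns
  have hfa : ∀ x : ℤ√D, ((f x : K) : ℝ) = x.re + x.im * t := by
    intro x
    change ((x.re + x.im * tK : K) : ℝ) = _
    push_cast; rfl
  let : Algebra (ℤ√D) K := f.toAlgebra
  have hic : IsIntegralClosure (ℤ√D) ℤ K := by
    refine ⟨hf, fun {x} => ⟨?_, ?_⟩⟩
    · intro hx
      obtain ⟨a, c, hac⟩ := mem_adj ht x.2
      have hx' : IsIntegral ℤ (x : ℝ) := hx.map (K.val.restrictScalars ℤ)
      rw [hac] at hx'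
      obtain ⟨m, n, rfl, rfl⟩ := quad_int hD hD4 hns ht hx'
      refine ⟨⟨m, n⟩, Subtype.ext ?_⟩
      change ((f _ : K) : ℝ) = _
      rw [hfa, hac]; push_cast; rfl
    · rintro ⟨y, rfl⟩
      change IsIntegral ℤ (f y)
      change IsIntegral ℤ (y.re + y.im * tK : K)
      have h1 : ∀ n : ℤ, IsIntegral ℤ (n : K) := fun n => isIntegral_algebraMap (R := ℤ) (A := K) (x := n)
      exact (h1 _).add ((h1 _).mul (t_int (by rw [sq, htK2])))
  have i1 : IsDomain (ℤ√D) := hf.isDomain f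
  have i2 : IsDedekindDomain (ℤ√D) := IsIntegralClosure.isDedekindDomain ℤ ℚ K (ℤ√D)
  let e : (ℤ√D) ≃+* 𝓞 K := (IsIntegralClosure.equiv ℤ (ℤ√D) K (𝓞 K)).toRingEquiv
  obtain ⟨g⟩ := cl_equiv e
  exact ⟨i2, Finite.of_equiv _ g.symm.toEquiv, Nat.card_congr g.symm.toEquiv⟩

end Zs


open Zs NumberField

set_option linter.unusedSectionVars false

/-- A real biquadratic field with its standard generators. -/
structure Bi (F : IntermediateField ℚ ℝ) (w t t' : ℝ) (d d' η η' m : ℤ) : Prop where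
  w2 : w ^ 2 = (2 : ℤ)
  t2 : t ^ 2 = d
  t2' : t' ^ 2 = d'
  wt : w * t = η * t'
  wt' : w * t' = η' * t
  tt' : t * t' = m * w
  hw : w ∈ F
  ht : t ∈ F
  ht' : t' ∈ F
  rep : ∀ x ∈ F, ∃ a b c e : ℚ, x = a + b * w + c * t + e * t'
  n2 : ∀ n : ℤ, 2 ≠ n * n
  nd : ∀ n : ℤ, d ≠ n * n
  nd' : ∀ n : ℤ, d' ≠ n * n
  η0 : η ≠ 0
  m0 : m ≠ 0

namespace Bi

variable {F : IntermediateField ℚ ℝ} {w t t' : ℝ} {d d' η η' m : ℤ}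

theorem ind (H : Bi F w t t' d d' η η' m) {a b c e : ℚ} (h : (a + b * w + c * t + e * t' : ℝ) = 0) :
    a = 0 ∧ b = 0 ∧ c = 0 ∧ e = 0 := by
  have hd0 : d ≠ 0 := fun h0 => H.nd 0 (by rw [h0]; ring)
  have w2 := H.w2
  push_cast at w2
  have h1 : (a + b * w : ℝ) * t = -(c * d + e * m * w) := by
    linear_combination t * h - (c : ℝ) * H.t2 - (e : ℝ) * H.tt'
  obtain ⟨N, hN⟩ : ∃ N : ℚ, N = a ^ 2 - 2 * b ^ 2 := ⟨_, rfl⟩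
  obtain ⟨X, hX⟩ : ∃ X : ℚ, X = -(c * d * a - 2 * e * m * b) := ⟨_, rfl⟩
  obtain ⟨Y, hY⟩ : ∃ Y : ℚ, Y = -(e * m * a - c * d * b) := ⟨_, rfl⟩
  have h2 : (N : ℝ) * t = X + Y * w := by
    rw [hN, hX, hY]; push_cast
    linear_combination (a - b * w : ℝ) * h1 + (b : ℝ) ^ 2 * t * w2 + (b : ℝ) * e * m * w2
  have hN0 : N = 0 := by
    have h3 : ((X ^ 2 + 2 * Y ^ 2 - N ^ 2 * d : ℚ) + (2 * X * Y : ℚ) * w : ℝ) = 0 := by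
      push_cast
      linear_combination (-(N : ℝ) * t - X - Y * w) * h2 + (N : ℝ) ^ 2 * H.t2 - (Y : ℝ) ^ 2 * w2
    have h4 := (irr H.n2 H.w2 h3).2
    rcases mul_eq_zero.1 h4 with h5 | h5
    · have h6 : X = 0 := by linarith
      rw [h6] at h2
      have h7 : (((-(2 * Y) : ℚ) : ℝ) + (N * η : ℚ) * t') = 0 := by
        push_cast at h2 ⊢
        linear_combination w * h2 - (N : ℝ) * H.wt + (Y : ℝ) * w2
      have h8 := (irr H.nd' H.t2' h7).2
      exact (mul_eq_zero.1 h8).resolve_right (by exact_mod_cast H.η0)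
    · rw [h5] at h2
      have h7 : (((-X : ℚ) : ℝ) + (N : ℚ) * t) = 0 := by
        push_cast at h2 ⊢
        linear_combination h2
      exact (irr H.nd H.t2 h7).2
  have hab : a = 0 ∧ b = 0 := by
    have h3 : (a + b * w : ℝ) * (a - b * w) = 0 := by
      have : (N : ℝ) = 0 := by exact_mod_cast hN0
      rw [hN] at this
      push_cast at this
      linear_combination this - (b : ℝ) ^ 2 * w2
    rcases mul_eq_zero.1 h3 with h4 | h4
    · exact irr H.n2 H.w2 h4
    · have h5 : ((a : ℝ) + (-b : ℚ) * w) = 0 := by push_cast; linear_combination h4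
      have := irr H.n2 H.w2 h5
      exact ⟨this.1, neg_eq_zero.1 this.2⟩
  obtain ⟨rfl, rfl⟩ := hab
  have h5 : (((c * d : ℚ) : ℝ) + (e * m : ℚ) * w) = 0 := by
    push_cast at h1 ⊢
    linear_combination h1
  have h6 := irr H.n2 H.w2 h5
  refine ⟨rfl, rfl, (mul_eq_zero.1 h6.1).resolve_right (by exact_mod_cast hd0),
    (mul_eq_zero.1 h6.2).resolve_right (by exact_mod_cast H.m0)⟩

theorem uniq (H : Bi F w t t' d d' η η' m) {a b c e a' b' c' e' : ℚ}
    (h : (a + b * w + c * t + e * t' : ℝ) = a' + b' * w + c' * t + e' * t') :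
    a = a' ∧ b = b' ∧ c = c' ∧ e = e' := by
  have h1 : (((a - a' : ℚ) : ℝ) + (b - b' : ℚ) * w + (c - c' : ℚ) * t + (e - e' : ℚ) * t') = 0 := by
    push_cast
    linear_combination h
  have := H.ind h1
  refine ⟨?_, ?_, ?_, ?_⟩ <;> linarith

theorem sgn (H : Bi F w t t' d d' η η' m) (ε1 ε2 : ℚ) (h1 : ε1 ^ 2 = 1) (h2 : ε2 ^ 2 = 1) :
    ∃ φ : F ≃+* F, (∀ (a b c e : ℚ) (x : F), (x : ℝ) = a + b * w + c * t + e * t' →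
      (φ x : ℝ) = a + ε1 * b * w + ε2 * c * t + ε1 * ε2 * e * t') ∧ ∀ x, φ (φ x) = x := by
  have hq : ∀ a : ℚ, (a : ℝ) ∈ F := fun a => F.algebraMap_mem a
  have ex : ∀ x : F, ∃ y : F, ∀ a b c e : ℚ, (x : ℝ) = a + b * w + c * t + e * t' →
      (y : ℝ) = a + ε1 * b * w + ε2 * c * t + ε1 * ε2 * e * t' := by
    intro x
    obtain ⟨a, b, c, e, hx⟩ := H.rep x x.2
    refine ⟨⟨a + ε1 * b * w + ε2 * c * t + ε1 * ε2 * e * t', ?_⟩, ?_⟩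
    · refine F.add_mem (F.add_mem (F.add_mem (hq a) ?_) ?_) ?_
      · exact F.mul_mem (F.mul_mem (hq _) (hq _)) H.hw
      · exact F.mul_mem (F.mul_mem (hq _) (hq _)) H.ht
      · exact F.mul_mem (F.mul_mem (F.mul_mem (hq _) (hq _)) (hq _)) H.ht'
    · intro a' b' c' e' h
      obtain ⟨rfl, rfl, rfl, rfl⟩ := H.uniq (hx.symm.trans h)
      rfl
  choose g hg using ex
  have h1' : (ε1 : ℝ) ^ 2 = 1 := by exact_mod_cast h1
  have h2' : (ε2 : ℝ) ^ 2 = 1 := by exact_mod_cast h2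
  have w2 := H.w2
  push_cast at w2
  let φ : F →+* F :=
    { toFun := g
      map_one' := by
        apply Subtype.ext
        rw [hg 1 1 0 0 0 (by push_cast; ring)]
        push_cast; ring
      map_zero' := by
        apply Subtype.ext
        rw [hg 0 0 0 0 0 (by push_cast; ring)]
        push_cast; ring
      map_add' := by
        intro x y
        apply Subtype.ext
        obtain ⟨a, b, c, e, hx⟩ := H.rep x x.2
        obtain ⟨a', b', c', e', hy⟩ := H.rep y y.2
        rw [hg (x + y) (a + a') (b + b') (c + c') (e + e') (by push_cast; rw [hx, hy]; ring)]
        push_cast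
        rw [hg x _ _ _ _ hx, hg y _ _ _ _ hy]
        ring
      map_mul' := by
        intro x y
        apply Subtype.ext
        obtain ⟨a, b, c, e, hx⟩ := H.rep x x.2
        obtain ⟨a', b', c', e', hy⟩ := H.rep y y.2
        rw [hg (x * y) (a * a' + 2 * b * b' + d * c * c' + d' * e * e')
          (a * b' + b * a' + m * (c * e' + e * c')) (a * c' + c * a' + η' * (b * e' + e * b'))
          (a * e' + e * a' + η * (b * c' + c * b')) (by
            push_cast; rw [hx, hy]
            linear_combination (b : ℝ) * b' * w2 + (c : ℝ) * c' * H.t2 + (e : ℝ) * e' * H.t2' +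
              (b * c' + c * b' : ℝ) * H.wt + (b * e' + e * b' : ℝ) * H.wt' +
              (c * e' + e * c' : ℝ) * H.tt')]
        push_cast
        rw [hg x _ _ _ _ hx, hg y _ _ _ _ hy]
        linear_combination -(ε1 ^ 2 * b * b' : ℝ) * w2 - 2 * (b : ℝ) * b' * h1'
          - (ε2 ^ 2 * c * c' : ℝ) * H.t2 - (d : ℝ) * c * c' * h2'
          - (ε1 ^ 2 * ε2 ^ 2 * e * e' : ℝ) * H.t2' - (d' : ℝ) * e * e' * (ε2 ^ 2 * h1' + h2')
          - (ε1 * ε2 : ℝ) * (b * c' + c * b' : ℝ) * H.wt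
          - (ε1 ^ 2 * ε2 : ℝ) * (b * e' + e * b' : ℝ) * H.wt'
          - (ε2 : ℝ) * η' * t * (b * e' + e * b' : ℝ) * h1'
          - (ε1 * ε2 ^ 2 : ℝ) * (c * e' + e * c' : ℝ) * H.tt'
          - (ε1 : ℝ) * m * w * (c * e' + e * c' : ℝ) * h2' }
  have hφ : ∀ x, φ (φ x) = x := by
    intro x
    apply Subtype.ext
    obtain ⟨a, b, c, e, hx⟩ := H.rep x x.2
    have hy := hg x _ _ _ _ hx
    change (g (g x) : ℝ) = x
    rw [hg (g x) a (ε1 * b) (ε2 * c) (ε1 * ε2 * e) (by rw [hy]; push_cast; ring), hx]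
    push_cast
    linear_combination (b : ℝ) * w * h1' + (c : ℝ) * t * h2' + (e : ℝ) * t' * (ε2 ^ 2 * h1' + h2')
  exact ⟨RingEquiv.ofRingHom φ φ (RingHom.ext hφ) (RingHom.ext hφ), fun a b c e x hx => hg x a b c e hx, hφ⟩

theorem finrank (H : Bi F w t t' d d' η η' m) : FiniteDimensional ℚ F ∧ Module.finrank ℚ F = 4 := by
  let f : (ℚ × ℚ × ℚ × ℚ) →ₗ[ℚ] F :=
    { toFun := fun v => (v.1 : F) + v.2.1 * (⟨w, H.hw⟩ : F) + v.2.2.1 * (⟨t, H.ht⟩ : F) +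
        v.2.2.2 * (⟨t', H.ht'⟩ : F)
      map_add' := by intro x y; simp; ring
      map_smul' := by
        intro x y
        simp [Algebra.smul_def]; ring }
  have hf : ∀ v, ((f v : F) : ℝ) = v.1 + v.2.1 * w + v.2.2.1 * t + v.2.2.2 * t' := by
    intro v
    simp [f]
  have hb : Function.Bijective f := by
    constructor
    · rintro ⟨a, b, c, e⟩ ⟨a', b', c', e'⟩ h
      have h1 := congrArg (Subtype.val : F → ℝ) h
      rw [hf, hf] at h1
      obtain ⟨rfl, rfl, rfl, rfl⟩ := H.uniq h1
      rfl
    · intro x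
      obtain ⟨a, b, c, e, hx⟩ := H.rep x x.2
      refine ⟨(a, b, c, e), Subtype.ext ?_⟩
      rw [hf, hx]
  let g := LinearEquiv.ofBijective f hb
  refine ⟨Module.Finite.equiv g, ?_⟩
  rw [← g.finrank_eq]
  simp

end Bi


open Zs NumberField

set_option linter.unusedSectionVars false

namespace Bi

variable {F : IntermediateField ℚ ℝ} {w t t' : ℝ} {d d' η η' m : ℤ}

theorem prime_over_two [NumberField F] (h4 : Module.finrank ℚ F = 4) {ω κ μ : 𝓞 F} {n : ℤ}
    (hω : ω ^ 2 = 2) (h1 : κ * ω = 1 + μ) (h2 : κ ^ 2 = 2 * n + μ) :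
    (Ideal.span {κ - 1, ω}) ^ 2 = Ideal.span {ω} ∧ (Ideal.span {κ - 1, ω}).IsPrime := by
  have hP : (Ideal.span {κ - 1, ω}) ^ 2 = Ideal.span {ω} := by
    have hm1 : κ - 1 ∈ Ideal.span {κ - 1, ω} := Ideal.subset_span (by simp)
    have hm2 : ω ∈ Ideal.span {κ - 1, ω} := Ideal.subset_span (by simp)
    apply le_antisymm
    · rw [sq, Ideal.span_mul_span', Ideal.span_le]
      rintro x ⟨y, hy, z, hz, rfl⟩
      have e1 : (κ - 1) * (κ - 1) = ω * (n * ω + κ - ω * κ) := by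
        linear_combination h2 - h1 + (κ - n) * hω
      simp only [Set.mem_insert_iff, Set.mem_singleton_iff] at hy hz
      simp only [SetLike.mem_coe, Ideal.mem_span_singleton]
      rcases hy with rfl | rfl <;> rcases hz with rfl | rfl
      · exact ⟨_, e1⟩
      · exact Dvd.intro_left _ rfl
      · exact Dvd.intro _ rfl
      · exact Dvd.intro _ rfl
    · rw [Ideal.span_singleton_le_iff_mem, sq]
      have e2 : ω = (κ - 1) * (κ - 1) - (κ - 1) * ω - (n - κ) * (ω * ω) := by
        linear_combination -h2 + h1 - (κ - n) * hω
      have e3 : (κ - 1) * (κ - 1) - (κ - 1) * ω - (n - κ) * (ω * ω) ∈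
          Ideal.span {κ - 1, ω} * Ideal.span {κ - 1, ω} := sub_mem (sub_mem (Ideal.mul_mem_mul hm1 hm1) (Ideal.mul_mem_mul hm1 hm2))
        (Ideal.mul_mem_left _ _ (Ideal.mul_mem_mul hm2 hm2))
      rwa [← e2] at e3
  refine ⟨hP, ?_⟩
  apply Ideal.isPrime_of_irreducible_absNorm
  have e3 : (Ideal.span {κ - 1, ω}) ^ 4 = Ideal.span {(2 : 𝓞 F)} := by
    rw [show 4 = 2 * 2 from rfl, pow_mul, hP, Ideal.span_singleton_pow, hω]
  have e4 := congrArg Ideal.absNorm e3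
  rw [map_pow, Ideal.absNorm_span_singleton,
    show (2 : 𝓞 F) = algebraMap ℤ (𝓞 F) 2 by simp, Algebra.norm_algebraMap,
    RingOfIntegers.rank, h4] at e4
  have e5 : Ideal.absNorm (Ideal.span {κ - 1, ω}) = 2 :=
    Nat.pow_left_injective (n := 4) (by norm_num) (by simpa using e4)
  rw [e5]
  exact Nat.prime_two

theorem core (H : Bi F w t t' d d' η η' m) (hd : Squarefree d) (hd4 : d % 4 = 2 ∨ d % 4 = 3)
    (hd' : Squarefree d') (hd4' : d' % 4 = 2 ∨ d' % 4 = 3) {μ : ℝ} (hμ : μ ∈ F) {M : ℤ}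
    (hμ2 : μ ^ 2 = M) (hM : M % 4 = 3) : Nonempty (Core d d' (𝓞 F)) := by
  obtain ⟨hfd, h4⟩ := H.finrank
  have : NumberField F := ⟨⟩
  obtain ⟨σ', hσ, hσσ⟩ := H.sgn (-1) 1 (by norm_num) (by norm_num)
  obtain ⟨τ', hτ, hττ⟩ := H.sgn 1 (-1) (by norm_num) (by norm_num)
  let V : 𝓞 F →+* ℝ := (F.val : F →+* ℝ).comp (algebraMap (𝓞 F) F)
  have hV : Function.Injective V := F.val.injective.comp (RingOfIntegers.coe_injective)
  have hVi : ∀ x, IsIntegral ℤ (V x) := fun x =>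
    (RingOfIntegers.isIntegral_coe x).map (F.val.restrictScalars ℤ)
  have mk : ∀ x : ℝ, x ∈ F → IsIntegral ℤ x → ∃ y : 𝓞 F, V y = x := by
    intro x hx hi
    have : IsIntegral ℤ (⟨x, hx⟩ : F) :=
      (isIntegral_algHom_iff (F.val.restrictScalars ℤ) F.val.injective).1 hi
    exact ⟨⟨⟨x, hx⟩, this⟩, rfl⟩
  let σ : 𝓞 F ≃+* 𝓞 F := RingOfIntegers.mapRingEquiv σ'
  let τ : 𝓞 F ≃+* 𝓞 F := RingOfIntegers.mapRingEquiv τ'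
  have rep : ∀ x : 𝓞 F, ∃ a b c e : ℚ, V x = a + b * w + c * t + e * t' := fun x =>
    H.rep _ (x : F).2
  have Vσ : ∀ (x : 𝓞 F) (a b c e : ℚ), V x = a + b * w + c * t + e * t' →
      V (σ x) = a + (-b : ℚ) * w + c * t + (-e : ℚ) * t' := by
    intro x a b c e h
    refine (hσ a b c e (x : F) h).trans ?_
    push_cast; ring
  have Vτ : ∀ (x : 𝓞 F) (a b c e : ℚ), V x = a + b * w + c * t + e * t' →
      V (τ x) = a + b * w + (-c : ℚ) * t + (-e : ℚ) * t' := by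
    intro x a b c e h
    refine (hτ a b c e (x : F) h).trans ?_
    push_cast; ring
  obtain ⟨ω, hω⟩ := mk w H.hw (t_int H.w2)
  obtain ⟨θ, hθ⟩ := mk t H.ht (t_int H.t2)
  obtain ⟨θ', hθ'⟩ := mk t' H.ht' (t_int H.t2')
  have ω2 : ω * ω = (2 : ℤ) := by
    apply hV; rw [map_mul, map_intCast, hω, ← H.w2, sq]
  have θ2 : θ * θ = (d : ℤ) := by
    apply hV; rw [map_mul, map_intCast, hθ, ← H.t2, sq]
  have θ2' : θ' * θ' = (d' : ℤ) := by
    apply hV; rw [map_mul, map_intCast, hθ', ← H.t2', sq]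
  let jA : ℤ√d →+* 𝓞 F := Zsqrtd.lift ⟨θ, θ2⟩
  let jD : ℤ√d' →+* 𝓞 F := Zsqrtd.lift ⟨θ', θ2'⟩
  let j1 : ℤ√2 →+* 𝓞 F := Zsqrtd.lift ⟨ω, ω2⟩
  have VA : ∀ x, V (jA x) = ((x.re : ℚ) : ℝ) + (0 : ℚ) * w + (x.im : ℚ) * t + (0 : ℚ) * t' := by
    intro x
    change V (x.re + x.im * θ) = _
    rw [map_add, map_mul, map_intCast, map_intCast, hθ]; push_cast; ring
  have VD : ∀ x, V (jD x) = ((x.re : ℚ) : ℝ) + (0 : ℚ) * w + (0 : ℚ) * t + (x.im : ℚ) * t' := by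
    intro x
    change V (x.re + x.im * θ') = _
    rw [map_add, map_mul, map_intCast, map_intCast, hθ']; push_cast; ring
  have V1 : ∀ x, V (j1 x) = ((x.re : ℚ) : ℝ) + (x.im : ℚ) * w + (0 : ℚ) * t + (0 : ℚ) * t' := by
    intro x
    change V (x.re + x.im * ω) = _
    rw [map_add, map_mul, map_intCast, map_intCast, hω]; push_cast; ring
  have w0 : w ≠ 0 := by
    intro h0
    have := H.w2
    rw [h0] at this
    norm_num at this
  have w2 := H.w2
  push_cast at w2
  have hκF : (1 + μ) / w ∈ F := F.div_mem (F.add_mem F.one_mem hμ) H.hw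
  obtain ⟨n, hn⟩ : ∃ n, M = 4 * n - 1 := ⟨(M + 1) / 4, by omega⟩
  have hκ2 : ((1 + μ) / w) ^ 2 = ((2 * n : ℤ) : ℝ) + μ := by
    rw [div_pow, w2]
    have : (M : ℝ) = 4 * n - 1 := by rw [hn]; push_cast; ring
    push_cast
    linear_combination hμ2 / 2 + this / 2
  have hκi : IsIntegral ℤ ((1 + μ) / w) := by
    apply IsIntegral.of_pow (n := 2) (by norm_num)
    rw [hκ2]
    exact (isIntegral_algebraMap (R := ℤ) (A := ℝ) (x := 2 * n)).add (t_int hμ2)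
  obtain ⟨κ, hκ⟩ := mk _ hκF hκi
  obtain ⟨ν, hν⟩ := mk _ hμ (t_int hμ2)
  obtain ⟨hP2, hPp⟩ := prime_over_two (F := F) h4 (ω := ω) (κ := κ) (μ := ν) (n := n)
    (by rw [sq, ω2]; norm_num)
    (by apply hV; rw [map_mul, map_add, map_one, hω, hκ, hν]; field_simp)
    (by apply hV
        rw [map_pow, map_add, map_mul, hκ, hν, map_intCast, hκ2, map_ofNat]; push_cast; ring)
  have hj1 : j1 Zsqrtd.sqrtd = ω := by
    change ((0 : ℤ) : 𝓞 F) + ((1 : ℤ) : 𝓞 F) * ω = ω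
    simp
  refine ⟨⟨σ, τ, jA, jD, j1, V, Ideal.span {κ - 1, ω}, ?_, ?_, ?_, Zsqrtd.lift_injective _ H.nd,
    Zsqrtd.lift_injective _ H.nd', Zsqrtd.lift_injective _ H.n2,
    ?_, ?_, ?_, ?_, ?_, ?_, ?_, ?_, ?_, by rw [hj1]; exact hP2, hPp⟩⟩
  · intro x
    exact RingOfIntegers.coe_injective (hσσ (x : F))
  · intro x
    exact RingOfIntegers.coe_injective (hττ (x : F))
  · intro x
    obtain ⟨a, b, c, e, h⟩ := rep x
    apply hV
    rw [Vσ _ _ _ _ _ (Vτ _ _ _ _ _ h), Vτ _ _ _ _ _ (Vσ _ _ _ _ _ h)]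
  · intro a
    apply hV
    rw [Vσ _ _ _ _ _ (VA a), VA]; push_cast; ring
  · intro a
    apply hV
    rw [Vτ _ _ _ _ _ (VA a), VA, conj_apply, Zsqrtd.re_star, Zsqrtd.im_star]; push_cast; ring
  · intro a
    apply hV
    rw [Vσ _ _ _ _ _ (VD a), VD, conj_apply, Zsqrtd.re_star, Zsqrtd.im_star]; push_cast; ring
  · intro a
    apply hV
    rw [Vτ _ _ _ _ _ (VD a), VD, conj_apply, Zsqrtd.re_star, Zsqrtd.im_star]; push_cast; ring
  · intro a
    apply hV
    rw [Vσ _ _ _ _ _ (V1 a), V1, conj_apply, Zsqrtd.re_star, Zsqrtd.im_star]; push_cast; ring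
  · intro a
    apply hV
    rw [Vτ _ _ _ _ _ (V1 a), V1]; push_cast; ring
  · intro x hx
    obtain ⟨a, b, c, e, h⟩ := rep x
    have h1 := Vσ _ _ _ _ _ h
    rw [hx, h] at h1
    obtain ⟨-, h2, -, h3⟩ := H.uniq h1
    have hb : b = 0 := by linarith
    have he : e = 0 := by linarith
    subst hb he
    have h5 : V x = a + c * t := by rw [h]; push_cast; ring
    have h6 := hVi x
    rw [h5] at h6
    obtain ⟨k, l, rfl, rfl⟩ := quad_int hd hd4 H.nd H.t2 h6
    refine ⟨⟨k, l⟩, hV ?_⟩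
    rw [VA, h]
  · intro x hx
    obtain ⟨a, b, c, e, h⟩ := rep x
    have h1 := Vτ _ _ _ _ _ h
    rw [hx, h] at h1
    obtain ⟨-, -, h2, h3⟩ := H.uniq h1
    have hc : c = 0 := by linarith
    have he : e = 0 := by linarith
    subst hc he
    have h5 : V x = a + b * w := by rw [h]; push_cast; ring
    have h6 := hVi x
    rw [h5] at h6
    obtain ⟨k, l, rfl, rfl⟩ := quad_int Int.prime_two.squarefree (Or.inl rfl) H.n2 H.w2 h6
    refine ⟨⟨k, l⟩, hV ?_⟩
    rw [V1, h]
  · intro x hx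
    obtain ⟨a, b, c, e, h⟩ := rep x
    have h1 := Vσ _ _ _ _ _ (Vτ _ _ _ _ _ h)
    rw [hx, h] at h1
    obtain ⟨-, h2, h3, -⟩ := H.uniq h1
    have hb : b = 0 := by linarith
    have hc : c = 0 := by linarith
    subst hb hc
    have h5 : V x = a + e * t' := by rw [h]; push_cast; ring
    have h6 := hVi x
    rw [h5] at h6
    obtain ⟨k, l, rfl, rfl⟩ := quad_int hd' hd4' H.nd' H.t2' h6
    refine ⟨⟨k, l⟩, hV ?_⟩
    rw [VD, h]

end Bi


open Zs NumberField

set_option linter.unusedSectionVars false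

theorem biquad_rep {w μ : ℝ} {M : ℤ} (w2 : w ^ 2 = (2 : ℤ)) (μ2 : μ ^ 2 = M) :
    ∀ x ∈ IntermediateField.adjoin ℚ {w, μ}, ∃ a b c e : ℚ,
      x = a + b * w + c * μ + e * (w * μ) := by
  intro x hx
  have ha : ∀ x ∈ ({w, μ} : Set ℝ), IsAlgebraic ℚ x := by
    rintro x (rfl | rfl)
    · exact (t_int w2).tower_top.isAlgebraic
    · exact (t_int μ2).tower_top.isAlgebraic
  rw [← IntermediateField.mem_toSubalgebra,
    IntermediateField.adjoin_toSubalgebra_of_isAlgebraic ha] at hx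
  push_cast at w2
  induction hx using Algebra.adjoin_induction with
  | mem x hx =>
    rcases hx with rfl | rfl
    · exact ⟨0, 1, 0, 0, by push_cast; ring⟩
    · exact ⟨0, 0, 1, 0, by push_cast; ring⟩
  | algebraMap a => exact ⟨a, 0, 0, 0, by simp⟩
  | add x y _ _ hx hy =>
    obtain ⟨a, b, c, e, rfl⟩ := hx
    obtain ⟨a', b', c', e', rfl⟩ := hy
    exact ⟨a + a', b + b', c + c', e + e', by push_cast; ring⟩
  | mul x y _ _ hx hy =>
    obtain ⟨a, b, c, e, rfl⟩ := hx
    obtain ⟨a', b', c', e', rfl⟩ := hy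
    refine ⟨a * a' + 2 * b * b' + M * c * c' + 2 * M * e * e',
      a * b' + b * a' + M * (c * e' + e * c'),
      a * c' + c * a' + 2 * (b * e' + e * b'), a * e' + e * a' + b * c' + c * b', ?_⟩
    push_cast
    linear_combination (b * b' + b * e' * μ + e * b' * μ + e * e' * μ ^ 2 : ℝ) * w2 +
      (c * c' + c * e' * w + e * c' * w + 2 * e * e' : ℝ) * μ2

namespace Hyp

variable {η η' q r s : ℕ} {Q d d' : ℤ}

theorem sqf_qrs (h : Hyp η η' q r s Q d d') : Squarefree (q * r * s) := by
  have c1 : Nat.Coprime q r := (Nat.coprime_primes h.hq h.hr).2 h.qr_ne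
  have c2 : Nat.Coprime q s := (Nat.coprime_primes h.hq h.hs).2 h.qs_ne
  have c3 : Nat.Coprime r s := (Nat.coprime_primes h.hr h.hs).2 h.rs_ne
  rw [Nat.squarefree_mul (Nat.Coprime.mul_left c2 c3), Nat.squarefree_mul c1]
  exact ⟨⟨h.hq.squarefree, h.hr.squarefree⟩, h.hs.squarefree⟩

theorem sqf_mul (h : Hyp η η' q r s Q d d') {k : ℕ} (hk : k = 1 ∨ k = 2) {D : ℤ}
    (hD : D = k * (q * r * s : ℕ)) : Squarefree D ∧ (D % 4 = 2 ∨ D % 4 = 3) := by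
  have hm := h.mod4
  have e : D = ((k * (q * r * s) : ℕ) : ℤ) := by rw [hD]; push_cast; ring
  rcases hk with rfl | rfl
  · refine ⟨?_, by right; rw [hD]; omega⟩
    rw [e, Int.squarefree_natCast, one_mul]
    exact h.sqf_qrs
  · refine ⟨?_, by left; rw [hD]; omega⟩
    rw [e, Int.squarefree_natCast, Nat.squarefree_mul]
    · exact ⟨Nat.prime_two.squarefree, h.sqf_qrs⟩
    · rw [Nat.coprime_two_left, Nat.odd_iff]; omega

theorem exists_bi (h : Hyp η η' q r s Q d d') {w μ t t' : ℝ} (hw : w = Real.sqrt 2)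
    (hμ : μ = Real.sqrt (q * r * s : ℕ)) (ht : t = Real.sqrt d) (ht' : t' = Real.sqrt d') :
    Bi (IntermediateField.adjoin ℚ {w, μ}) w t t' d d' η η' ((q * r * s : ℕ) : ℤ) := by
  have w2 : w ^ 2 = (2 : ℤ) := by rw [hw, Real.sq_sqrt (by norm_num)]; norm_num
  have μ2 : μ ^ 2 = ((q * r * s : ℕ) : ℤ) := by
    rw [hμ, Real.sq_sqrt (by positivity)]; push_cast; ring
  have w2' : w ^ 2 = 2 := by rw [w2]; norm_num
  have μ2' : μ ^ 2 = q * r * s := by rw [μ2]; push_cast; ring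
  have hwF : w ∈ IntermediateField.adjoin ℚ {w, μ} :=
    IntermediateField.subset_adjoin ℚ _ (by simp)
  have hμF : μ ∈ IntermediateField.adjoin ℚ {w, μ} :=
    IntermediateField.subset_adjoin ℚ _ (by simp)
  have hwμ := mul_mem hwF hμF
  have rep := biquad_rep w2 μ2
  have hm0 : ((q * r * s : ℕ) : ℤ) ≠ 0 := by have := h.mod4; omega
  have n2 : ∀ n : ℤ, 2 ≠ n * n := by
    intro n hn
    exact Int.prime_two.irreducible.not_isSquare ⟨n, hn⟩
  have nd : ∀ n : ℤ, d ≠ n * n := fun n hn => h.d_nonsq ⟨n, hn⟩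
  have nd' : ∀ n : ℤ, d' ≠ n * n := fun n hn => h.d'_nonsq ⟨n, hn⟩
  have hd1 : d = η * (q * r * s : ℕ) := by rw [h.hdq]; push_cast; ring
  have hd1' : d' = η' * (q * r * s : ℕ) := by rw [h.hd']; push_cast; ring
  have s2 : Real.sqrt (2 * (q * r * s : ℕ)) = w * μ := by
    rw [hw, hμ, Real.sqrt_mul (by norm_num)]
  have t2 : t ^ 2 = d := by
    rw [ht, Real.sq_sqrt]; exact_mod_cast h.d_pos.le
  have t2' : t' ^ 2 = d' := by
    rw [ht', Real.sq_sqrt]; exact_mod_cast h.d'_pos.le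
  rcases h.hη with ⟨rfl, rfl⟩ | ⟨rfl, rfl⟩
  · have e1 : t = μ := by rw [ht, hμ, hd1]; push_cast; ring_nf
    have e2 : t' = w * μ := by rw [← s2, ht', hd1']; push_cast; ring_nf
    refine ⟨w2, t2, t2', ?_, ?_, ?_, hwF, e1 ▸ hμF, e2 ▸ hwμ, ?_, n2, nd, nd', by norm_num, hm0⟩
    · rw [e1, e2]; push_cast; ring
    · rw [e1, e2]; push_cast; linear_combination μ * w2'
    · rw [e1, e2]; push_cast; linear_combination w * μ2'
    · rw [e1, e2]; exact rep
  · have e1 : t' = μ := by rw [ht', hμ, hd1']; push_cast; ring_nf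
    have e2 : t = w * μ := by rw [← s2, ht, hd1]; push_cast; ring_nf
    refine ⟨w2, t2, t2', ?_, ?_, ?_, hwF, e2 ▸ hwμ, e1 ▸ hμF, ?_, n2, nd, nd', by norm_num, hm0⟩
    · rw [e1, e2]; push_cast; linear_combination μ * w2'
    · rw [e1, e2]; push_cast; ring
    · rw [e1, e2]; push_cast; linear_combination w * μ2'
    · rw [e1, e2]
      intro x hx
      obtain ⟨a, b, c, e, hx⟩ := rep x hx
      exact ⟨a, b, e, c, by rw [hx]; ring⟩

theorem field_final (h : Hyp η η' q r s Q d d') {a : Pell.Solution₁ d} (ha : Pell.IsFundamental a)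
    {F D : IntermediateField ℚ ℝ}
    (hF : F = IntermediateField.adjoin ℚ {Real.sqrt 2, Real.sqrt (q * r * s : ℕ)})
    (hD : D = IntermediateField.adjoin ℚ {Real.sqrt d}) :
    Nat.card (ClassGroup (𝓞 D)) ≠ 0 ∧
    (IsSquare (Q * (2 * (a.x - 1))) →
      ∃ o, Odd o ∧ Nat.card (ClassGroup (𝓞 F)) = Nat.card (ClassGroup (𝓞 D)) * (2 * o)) ∧
    (¬ IsSquare (Q * (2 * (a.x - 1))) →
      ∃ o, Odd o ∧ Nat.card (ClassGroup (𝓞 F)) = Nat.card (ClassGroup (𝓞 D)) * o) := by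
  have H := h.exists_bi rfl rfl rfl rfl
  rw [← hF] at H
  have hd1 : d = η * (q * r * s : ℕ) := by rw [h.hdq]; push_cast; ring
  have hd1' : d' = η' * (q * r * s : ℕ) := by rw [h.hd']; push_cast; ring
  obtain ⟨f1, f2⟩ := h.sqf_mul h.η_or hd1
  obtain ⟨g1, g2⟩ := h.sqf_mul h.η'_or hd1'
  obtain ⟨i1, i2, i3⟩ := oK f1 f2 H.nd H.t2
  obtain ⟨k1, k2, k3⟩ := oK g1 g2 H.nd' H.t2'
  have hμF : Real.sqrt (q * r * s : ℕ) ∈ F := by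
    rw [hF]; exact IntermediateField.subset_adjoin ℚ _ (by simp)
  obtain ⟨c⟩ := H.core f1 f2 g1 g2 hμF (M := ((q * r * s : ℕ) : ℤ))
    (by rw [Real.sq_sqrt (by positivity)]; push_cast; ring) h.mod4
  obtain ⟨hfd, -⟩ := H.finrank
  have : NumberField F := ⟨⟩
  rw [hD, i3]
  exact ⟨Nat.card_pos.ne', h.final c ha⟩

end Hyp


theorem two_part {x y o : ℕ} (hy : y ≠ 0) (ho : Odd o) :
    (x = y * o → 2 ^ x.factorization 2 = 2 ^ y.factorization 2) ∧
    (x = y * (2 * o) → 2 ^ x.factorization 2 = 2 * 2 ^ y.factorization 2) := by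
  have o0 : o ≠ 0 := by rintro rfl; simp at ho
  have f0 : o.factorization 2 = 0 :=
    Nat.factorization_eq_zero_of_not_dvd (fun hd => (Nat.not_even_iff_odd.2 ho) (even_iff_two_dvd.2 hd))
  constructor
  · rintro rfl
    rw [Nat.factorization_mul hy o0, Finsupp.add_apply, f0, add_zero]
  · rintro rfl
    rw [Nat.factorization_mul hy (mul_ne_zero two_ne_zero o0),
      Nat.factorization_mul two_ne_zero o0, Finsupp.add_apply, Finsupp.add_apply, f0,
      Nat.Prime.factorization_self Nat.prime_two, add_zero, pow_add, pow_one, mul_comm]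

theorem sq_cond {η q : ℕ} {γ : ℤ} (hη : η = 1 ∨ η = 2) :
    IsSquare ((η * q : ℤ) * (2 * (γ - 1))) ↔
      ∃ t : ℤ, 2 ^ (if η = 1 then 1 else 0) * (q : ℤ) * (γ - 1) = t ^ 2 := by
  rcases hη with rfl | rfl
  · constructor
    · rintro ⟨t, ht⟩
      refine ⟨t, ?_⟩
      simp only [if_true]
      push_cast at ht
      linear_combination ht
    · rintro ⟨t, ht⟩
      refine ⟨t, ?_⟩
      simp only [if_true] at ht
      push_cast
      linear_combination ht
  · constructor
    · rintro ⟨t, ht⟩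
      push_cast at ht
      have h2 : (2 : ℤ) ∣ t := by
        have : (2 : ℤ) ∣ t * t := ⟨2 * (q * (γ - 1)), by linear_combination -ht⟩
        rcases Int.prime_two.dvd_or_dvd this with h | h <;> exact h
      obtain ⟨u, rfl⟩ := h2
      refine ⟨u, ?_⟩
      rw [if_neg (by norm_num)]
      nlinarith [ht]
    · rintro ⟨t, ht⟩
      refine ⟨2 * t, ?_⟩
      rw [if_neg (by norm_num)] at ht
      push_cast
      linear_combination 4 * ht

theorem statement_9 (η q r s : ℕ) [Fact q.Prime] [Fact r.Prime] [Fact s.Prime]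
    (hη : η = 1 ∨ η = 2)
    (hq4 : q % 4 = 3) (hr8 : r % 8 = 5) (hs8 : s % 8 = 5)
    (hqr : legendreSym r q = (-1) ^ (if η = 2 then 1 else 0))
    (hqs : legendreSym s q = (-1) ^ (if η = 2 then 1 else 0))
    (hrs : legendreSym s r = 1)
    (γ γ' : ℤ) (hγ : 0 < γ) (hγ' : 0 < γ')
    (hPell : γ ^ 2 - (η * q * r * s : ℕ) * γ' ^ 2 = 1)
    (hfund : ∀ a b : ℤ, 0 < a → 0 < b → a ^ 2 - (η * q * r * s : ℕ) * b ^ 2 = 1 → γ ≤ a) :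
    let F1 := IntermediateField.adjoin ℚ {Real.sqrt 2, Real.sqrt (q * r * s : ℕ)}
    let D := IntermediateField.adjoin ℚ {Real.sqrt (η * q * r * s : ℕ)}
    (h2 F1 = h2 D ∨ h2 F1 = 2 * h2 D) ∧
      (h2 F1 = h2 D ↔ ¬ ∃ t : ℤ, 2 ^ (if η = 1 then 1 else 0) * (q : ℤ) * (γ - 1) = t ^ 2) := by
  intro F1 D
  have hsgn : ((-1 : ℤ)) ^ (if η = 2 then 1 else 0) = (-1) ^ (η + 1) := by
    rcases hη with rfl | rfl <;> norm_num
  obtain ⟨η', hη'⟩ : ∃ η', (η = 1 ∧ η' = 2) ∨ (η = 2 ∧ η' = 1) := by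
    rcases hη with h | h
    · exact ⟨2, Or.inl ⟨h, rfl⟩⟩
    · exact ⟨1, Or.inr ⟨h, rfl⟩⟩
  have h : Hyp η η' q r s (η * q : ℤ) ((η * q * r * s : ℕ) : ℤ) (η' * q * r * s : ℤ) :=
    { hq := Fact.out
      hr := Fact.out
      hs := Fact.out
      hη := hη'
      hq4 := hq4
      hr8 := hr8
      hs8 := hs8
      hQ := rfl
      hd := by push_cast; ring
      hd' := rfl
      qr := by intro _; rw [← hsgn]; exact hqr
      qs := by intro _; rw [← hsgn]; exact hqs
      rs := by intro _; exact hrs }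
  have ha := h.isFund hγ hγ' hPell hfund
  obtain ⟨h0, hA, hB⟩ := h.field_final ha (F := F1) (D := D) rfl (by simp only [D, Int.cast_natCast])
  rw [Pell.Solution₁.x_mk, sq_cond hη] at hA hB
  have hpos : 0 < h2 D := pow_pos (by norm_num) _
  by_cases hc : ∃ t : ℤ, 2 ^ (if η = 1 then 1 else 0) * (q : ℤ) * (γ - 1) = t ^ 2
  · obtain ⟨o, ho, ho'⟩ := hA hc
    have e : h2 F1 = 2 * h2 D := (two_part h0 ho).2 ho'
    refine ⟨Or.inr e, ⟨fun e' => ?_, fun hn => absurd hc hn⟩⟩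
    omega
  · obtain ⟨o, ho, ho'⟩ := hB hc
    have e : h2 F1 = h2 D := (two_part h0 ho).1 ho'
    exact ⟨Or.inl e, ⟨fun _ => hc, fun _ => e⟩⟩
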